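/- arXiv:2410.19387 — 2 statements merged into one kernel-verified Lean document; each statement's English description precedes it below -/
import Mathlib

section
/- Let −A be the generator of a C₀-semigroup (e^{-tA})_{t≥0} on a complex Hilbert space H, assume A is injective, and assume that −A^{-1} (the inverse operator, with domain the range of A) is the generator of a bounded C₀-semigroup (e^{-tA^{-1}})_{t≥0} on H. Fix β ∈ (0,1] and λ ∈ ρ(−A). Then the following are equivalent: (i) (e^{-tA})_{t≥0} is in the Crandall–Pazy class with parameter β, σ(A) ∩ iℝ ⊆ {0}, and ‖(iη + A)^{-1}‖ = O(|η|^{-2}) as η → 0; (ii) ‖e^{-tA^{-1}} (λ + A)^{-1}‖ = O(t^{-1/(2−β)}) as t → ∞. -/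
open Filter Topology

noncomputable section

variable {H : Type*} [NormedAddCommGroup H] [InnerProductSpace ℂ H]

/-- `T` is a strongly continuous one-parameter semigroup on `H` (written `T t = e^{-tA}`). -/
structure IsC0Semigroup (T : ℝ → H →L[ℂ] H) : Prop where
  map_zero : T 0 = 1
  map_add : ∀ s t : ℝ, 0 ≤ s → 0 ≤ t → T (s + t) = T s ∘L T t
  strong_continuity : ∀ x : H, ContinuousOn (fun t : ℝ => T t x) (Set.Ici 0)

/-- `-A` is the generator of the semigroup `T`. -/
def IsGenerator (T : ℝ → H →L[ℂ] H) (A : H →ₗ.[ℂ] H) : Prop :=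
  (∀ x : H, x ∈ A.domain ↔
      ∃ y : H, Tendsto (fun h : ℝ => (h : ℂ)⁻¹ • (T h x - x)) (𝓝[>] 0) (𝓝 y)) ∧
  ∀ x : A.domain,
    Tendsto (fun h : ℝ => (h : ℂ)⁻¹ • (T h (x : H) - (x : H))) (𝓝[>] 0) (𝓝 (-(A x)))

/-- `R` is a (two-sided) bounded inverse of the operator `lam + A`, so `R = (lam + A)⁻¹`. -/
def IsResolventAt (A : H →ₗ.[ℂ] H) (lam : ℂ) (R : H →L[ℂ] H) : Prop :=
  (∀ x : H, ∃ hx : R x ∈ A.domain, lam • R x + A ⟨R x, hx⟩ = x) ∧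
  ∀ x : A.domain, R (lam • (x : H) + A x) = (x : H)

/-- The semigroup `T = (e^{-tA})_{t ≥ 0}` is in the Crandall–Pazy class with parameter `β`. -/
def InCrandallPazy (T : ℝ → H →L[ℂ] H) (A : H →ₗ.[ℂ] H) (β : ℝ) : Prop :=
  ∃ B : ℝ → H →L[ℂ] H,
    (∀ t : ℝ, 0 < t → ∀ x : H, ∃ hx : T t x ∈ A.domain, B t x = A ⟨T t x, hx⟩) ∧
    ∃ M t₀ : ℝ, 0 < M ∧ 0 < t₀ ∧ ∀ t : ℝ, 0 < t → t ≤ t₀ → ‖B t‖ ≤ M * t ^ (-(1 / β))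

/-- `B` is the inverse of the (injective) partially defined operator `A`: its domain is the
range of `A` and `B (A x) = x`, `A (B y) = y`. -/
def IsInversePMap (A B : H →ₗ.[ℂ] H) : Prop :=
  (∀ x : A.domain, ∃ h : A x ∈ B.domain, B ⟨A x, h⟩ = (x : H)) ∧
  ∀ y : B.domain, ∃ h : B y ∈ A.domain, A ⟨B y, h⟩ = (y : H)

section Auxiliary

open MeasureTheory FourierTransform

/-- On `L¹ ∩ L²` the `L²` Fourier transform is given by the Fourier integral. -/
theorem fourier_toLp_ae_eq_fourierIntegral
    {H : Type*} [NormedAddCommGroup H] [InnerProductSpace ℂ H] [CompleteSpace H]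
    {f : ℝ → H} (hf1 : Integrable f) (hf2 : MemLp f 2) :
    ((𝓕 (hf2.toLp f) : Lp (α := ℝ) H 2) : ℝ → H) =ᵐ[volume] 𝓕 f := by
  refine ae_eq_of_integral_contDiff_smul_eq ?_ ?_ ?_
  · exact (Lp.memLp _).locallyIntegrable (by norm_num)
  · exact (VectorFourier.fourierIntegral_continuous Real.continuous_fourierChar
      (by fun_prop) hf1 : Continuous (𝓕 f)).locallyIntegrable
  · intro g hg hgs
    have h₂' : HasCompactSupport (fun x => (g x : ℂ)) := hgs.comp_left (g := Complex.ofReal) rfl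
    let φ : SchwartzMap ℝ ℂ := h₂'.toSchwartzMap (Complex.ofRealCLM.contDiff.comp hg)
    have hφ : ∀ x, φ x = (g x : ℂ) := fun x => rfl
    have h1 := congrArg (fun u => u φ) (Lp.fourier_toTemperedDistribution_eq (hf2.toLp f))
    simp only [TemperedDistribution.fourier_apply, Lp.toTemperedDistribution_apply] at h1
    have h2 : ∫ x, (𝓕 φ) x • (hf2.toLp f) x = ∫ x, (𝓕 φ) x • f x := by
      refine integral_congr_ae ?_
      filter_upwards [hf2.coeFn_toLp] with x hx
      rw [hx]
    have h3 : ∫ x, (𝓕 φ) x • f x = ∫ x, φ x • 𝓕 f x := by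
      have := VectorFourier.integral_fourierIntegral_smul_eq_flip (L := innerₗ ℝ)
        Real.continuous_fourierChar (by fun_prop) (φ.integrable (μ := volume)) hf1
      rw [flip_innerₗ] at this
      exact this
    rw [h2, h3] at h1
    simpa [hφ] using h1.symm

theorem eLpNorm_two_fourier_eq
    {H : Type*} [NormedAddCommGroup H] [InnerProductSpace ℂ H] [CompleteSpace H]
    {f : ℝ → H} (hf1 : Integrable f) (hf2 : MemLp f 2) :
    eLpNorm (𝓕 f) 2 volume = eLpNorm f 2 volume := by
  rw [← eLpNorm_congr_ae (fourier_toLp_ae_eq_fourierIntegral hf1 hf2),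
    ← eLpNorm_congr_ae hf2.coeFn_toLp]
  have := Lp.norm_fourier_eq (hf2.toLp f)
  rw [Lp.norm_def, Lp.norm_def] at this
  exact (ENNReal.toReal_eq_toReal_iff' (Lp.eLpNorm_ne_top _) (Lp.eLpNorm_ne_top _)).1 this


theorem integral_sq_norm_le_of_norm_fourier_le
    {H : Type*} [NormedAddCommGroup H] [InnerProductSpace ℂ H] [CompleteSpace H]
    {f g : ℝ → H} (hf1 : Integrable f) (hf2 : MemLp f 2) (hg1 : Integrable g) (hg2 : MemLp g 2)
    {K : ℝ} (hK : 0 ≤ K) (h : ∀ s, ‖𝓕 g s‖ ≤ K * ‖𝓕 f s‖) :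
    ∫ x, ‖g x‖ ^ 2 ≤ K ^ 2 * ∫ x, ‖f x‖ ^ 2 := by
  have key : eLpNorm g 2 volume ≤ ENNReal.ofReal K * eLpNorm f 2 volume := by
    rw [← eLpNorm_two_fourier_eq hf1 hf2, ← eLpNorm_two_fourier_eq hg1 hg2]
    exact eLpNorm_le_mul_eLpNorm_of_ae_le_mul (Eventually.of_forall h) 2
  have conv : ∀ {u : ℝ → H}, MemLp u 2 → ∫ x, ‖u x‖ ^ 2 = (eLpNorm u 2 volume).toReal ^ 2 := by
    intro u hu
    rw [hu.eLpNorm_eq_integral_rpow_norm (by norm_num) (by norm_num)]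
    have h0 : 0 ≤ ∫ x, ‖u x‖ ^ 2 := integral_nonneg fun _ => by positivity
    simp only [ENNReal.toReal_ofNat, Real.rpow_ofNat]
    rw [ENNReal.toReal_ofReal (by positivity), ← one_div, ← Real.sqrt_eq_rpow, Real.sq_sqrt h0]
  rw [conv hf2, conv hg2, ← mul_pow]
  have h2 := ENNReal.toReal_mono (ENNReal.mul_ne_top ENNReal.ofReal_ne_top hf2.eLpNorm_ne_top) key
  rw [ENNReal.toReal_mul, ENNReal.toReal_ofReal hK] at h2
  exact pow_le_pow_left₀ ENNReal.toReal_nonneg h2 2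

section Semigroup

variable {H : Type*} [NormedAddCommGroup H] [InnerProductSpace ℂ H]

theorem IsC0Semigroup.exists_norm_le_exp [CompleteSpace H] {T : ℝ → H →L[ℂ] H}
    (hT : IsC0Semigroup T) :
    ∃ M ω : ℝ, 1 ≤ M ∧ 0 ≤ ω ∧ ∀ t : ℝ, 0 ≤ t → ‖T t‖ ≤ M * Real.exp (ω * t) := by
  have hpt : ∀ x : H, ∃ C, ∀ i : Set.Icc (0 : ℝ) 1, ‖T i x‖ ≤ C := by
    intro x
    obtain ⟨C, hC⟩ := isCompact_Icc.exists_bound_of_continuousOn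
      ((hT.strong_continuity x).mono (Set.Icc_subset_Ici_self : Set.Icc (0 : ℝ) 1 ⊆ _))
    exact ⟨C, fun i => hC i i.2⟩
  obtain ⟨C, hC⟩ := banach_steinhaus hpt
  set M := max C 1 with hM
  have hM1 : 1 ≤ M := le_max_right _ _
  have hloc : ∀ t : ℝ, 0 ≤ t → t ≤ 1 → ‖T t‖ ≤ M := fun t h0 h1 =>
    (hC ⟨t, h0, h1⟩).trans (le_max_left _ _)
  have hn : ∀ n : ℕ, ∀ t : ℝ, 0 ≤ t → t ≤ 1 → ‖T (n + t)‖ ≤ M * M ^ n := by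
    intro n
    induction n with
    | zero => intro t h0 h1; simpa using hloc t h0 h1
    | succ n ih =>
      intro t h0 h1
      have : ((n + 1 : ℕ) : ℝ) + t = 1 + (n + t) := by push_cast; ring
      rw [this, hT.map_add _ _ zero_le_one (by positivity)]
      calc _ ≤ ‖T 1‖ * ‖T (n + t)‖ := ContinuousLinearMap.opNorm_comp_le _ _
        _ ≤ M * (M * M ^ n) := by
          gcongr
          · exact hloc 1 zero_le_one le_rfl
          · exact ih t h0 h1
        _ = _ := by ring
  refine ⟨M, Real.log M, hM1, Real.log_nonneg hM1, fun t ht => ?_⟩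
  have h1 := hn ⌊t⌋₊ (t - ⌊t⌋₊) (by linarith [Nat.floor_le ht])
    (by linarith [Nat.lt_floor_add_one t])
  rw [add_sub_cancel] at h1
  refine h1.trans ?_
  gcongr
  rw [← Real.exp_log (pow_pos (by linarith) _), Real.log_pow, mul_comm]
  gcongr
  · exact Real.log_nonneg hM1
  · exact Nat.floor_le ht

variable {T : ℝ → H →L[ℂ] H} {A : H →ₗ.[ℂ] H}

theorem IsGenerator.map_mem_domain (hT : IsC0Semigroup T) (hA : IsGenerator T A)
    (x : A.domain) {t : ℝ} (ht : 0 ≤ t) :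
    ∃ h : T t x ∈ A.domain, A ⟨T t x, h⟩ = T t (A x) := by
  have key : Tendsto (fun h : ℝ => (h : ℂ)⁻¹ • (T h (T t x) - T t x)) (𝓝[>] 0)
      (𝓝 (-(T t (A x)))) := by
    have h1 := ((T t).continuous.tendsto _).comp (hA.2 x)
    rw [map_neg] at h1
    refine h1.congr' ?_
    filter_upwards [self_mem_nhdsWithin] with h (hh : 0 < h)
    have : T h (T t x) = T t (T h x) := by
      rw [← ContinuousLinearMap.comp_apply, ← ContinuousLinearMap.comp_apply,
        ← hT.map_add _ _ hh.le ht, ← hT.map_add _ _ ht hh.le, add_comm]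
    simp [this]
  have hmem : T t x ∈ A.domain := (hA.1 _).2 ⟨_, key⟩
  exact ⟨hmem, neg_injective (tendsto_nhds_unique (hA.2 ⟨T t x, hmem⟩) key)⟩

theorem IsGenerator.hasDerivWithinAt (hT : IsC0Semigroup T) (hA : IsGenerator T A)
    (x : A.domain) {t : ℝ} (ht : 0 ≤ t) :
    HasDerivWithinAt (fun s => T s x) (-(T t (A x))) (Set.Ioi t) t := by
  rw [hasDerivWithinAt_iff_tendsto_slope' (by simp)]
  obtain ⟨hmem, heq⟩ := hA.map_mem_domain hT x ht
  have h1 := hA.2 ⟨T t x, hmem⟩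
  rw [heq] at h1
  have h2 : Tendsto (fun s : ℝ => s - t) (𝓝[>] t) (𝓝[>] 0) := by
    refine tendsto_nhdsWithin_iff.2 ⟨?_, ?_⟩
    · exact ((continuous_id.sub continuous_const).tendsto' t 0 (by simp)).mono_left
        nhdsWithin_le_nhds
    · filter_upwards [self_mem_nhdsWithin] with s (hs : t < s)
      simpa using hs
  refine (h1.comp h2).congr' ?_
  filter_upwards [self_mem_nhdsWithin] with s (hs : t < s)
  have : T s x = T (s - t) (T t x) := by
    rw [← ContinuousLinearMap.comp_apply, ← hT.map_add _ _ (by linarith) ht, sub_add_cancel]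
  simp only [Function.comp_apply, slope_def_module, this]
  rw [← Complex.ofReal_inv, Complex.coe_smul]

/-- The scalar kernel `τ ↦ τ ^ k / k! * e ^ (-z τ)`. -/
def laplaceWeight (k : ℕ) (z : ℂ) (τ : ℝ) : ℂ :=
  (τ : ℂ) ^ k / (k.factorial : ℂ) * Complex.exp (-(z * τ))

theorem continuous_laplaceWeight (k : ℕ) (z : ℂ) : Continuous (laplaceWeight k z) := by
  unfold laplaceWeight; fun_prop

theorem hasDerivAt_laplaceWeight_zero (z : ℂ) (τ : ℝ) :
    HasDerivAt (laplaceWeight 0 z) (-(z * laplaceWeight 0 z τ)) τ := by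
  have h0 : HasDerivAt (fun t : ℝ => -(z * (t : ℂ))) (-z) τ := by
    simpa using ((Complex.ofRealCLM.hasDerivAt (x := τ)).const_mul z).fun_neg
  have h := h0.cexp
  unfold laplaceWeight
  simp only [pow_zero, Nat.factorial_zero, Nat.cast_one, div_one, one_mul]
  convert h using 1
  ring

theorem hasDerivAt_laplaceWeight_succ (k : ℕ) (z : ℂ) (τ : ℝ) :
    HasDerivAt (laplaceWeight (k + 1) z)
      (laplaceWeight k z τ - z * laplaceWeight (k + 1) z τ) τ := by
  have h0 : HasDerivAt (fun t : ℝ => -(z * (t : ℂ))) (-z) τ := by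
    simpa using ((Complex.ofRealCLM.hasDerivAt (x := τ)).const_mul z).fun_neg
  have h1 : HasDerivAt (fun t : ℝ => (t : ℂ) ^ (k + 1) / ((k + 1).factorial : ℂ))
      ((τ : ℂ) ^ k / (k.factorial : ℂ)) τ := by
    have := ((Complex.ofRealCLM.hasDerivAt (x := τ)).fun_pow (k + 1)).div_const
      ((k + 1).factorial : ℂ)
    refine this.congr_deriv ?_
    have hk : (k.factorial : ℂ) ≠ 0 := by exact_mod_cast k.factorial_ne_zero
    have hk' : (k : ℂ) + 1 ≠ 0 := by exact_mod_cast k.succ_ne_zero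
    rw [Nat.factorial_succ]
    simp only [Complex.ofRealCLM_apply, Complex.ofReal_one, Nat.add_sub_cancel]
    push_cast
    field_simp
  refine (h1.mul h0.cexp).congr_deriv ?_
  unfold laplaceWeight
  ring

theorem norm_laplaceWeight (k : ℕ) (z : ℂ) {τ : ℝ} (hτ : 0 ≤ τ) :
    ‖laplaceWeight k z τ‖ = τ ^ k / k.factorial * Real.exp (-(z.re * τ)) := by
  unfold laplaceWeight
  rw [norm_mul, norm_div, norm_pow, Complex.norm_exp]
  simp [abs_of_nonneg hτ]

/-- Exponential decay of the weighted orbits. -/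
theorem norm_laplaceWeight_smul_le {M ω : ℝ} (hM : ∀ t, 0 ≤ t → ‖T t‖ ≤ M * Real.exp (ω * t))
    (k : ℕ) {z : ℂ} (hz : ω < z.re) (x : H) {τ : ℝ} (hτ : 0 ≤ τ) :
    ‖laplaceWeight k z τ • T τ x‖ ≤
      M * ‖x‖ * (2 / (z.re - ω)) ^ k * Real.exp (-((z.re - ω) / 2) * τ) := by
  have hc : 0 < z.re - ω := by linarith
  set c := z.re - ω with hcdef
  have h1 : τ ^ k / k.factorial ≤ (2 / c) ^ k * Real.exp (c / 2 * τ) := by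
    have := Real.pow_div_factorial_le_exp (x := c / 2 * τ) (by positivity) k
    calc τ ^ k / k.factorial = (2 / c) ^ k * ((c / 2 * τ) ^ k / k.factorial) := by
          rw [← mul_div_assoc, ← mul_pow]; congr 2; field_simp
      _ ≤ _ := by gcongr
  have hM0 : 0 ≤ M := by
    have := (norm_nonneg _).trans (hM 0 le_rfl)
    simpa using this
  rw [norm_smul, norm_laplaceWeight k z hτ]
  calc τ ^ k / k.factorial * Real.exp (-(z.re * τ)) * ‖T τ x‖
      ≤ (2 / c) ^ k * Real.exp (c / 2 * τ) * Real.exp (-(z.re * τ)) *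
          (M * Real.exp (ω * τ) * ‖x‖) := by
        gcongr
        exact (T τ).le_of_opNorm_le (hM τ hτ) x
    _ = M * ‖x‖ * (2 / c) ^ k *
          (Real.exp (c / 2 * τ) * Real.exp (-(z.re * τ)) * Real.exp (ω * τ)) := by ring
    _ = _ := by
        rw [← Real.exp_add, ← Real.exp_add]
        congr 2
        rw [hcdef]; ring

theorem IsC0Semigroup.continuousOn_laplaceWeight_smul (hT : IsC0Semigroup T) (k : ℕ) (z : ℂ)
    (x : H) : ContinuousOn (fun τ => laplaceWeight k z τ • T τ x) (Set.Ici 0) :=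
  (continuous_laplaceWeight k z).continuousOn.smul (hT.strong_continuity x)

theorem integrableOn_laplaceWeight_smul (hT : IsC0Semigroup T) {M ω : ℝ}
    (hM : ∀ t, 0 ≤ t → ‖T t‖ ≤ M * Real.exp (ω * t))
    (k : ℕ) {z : ℂ} (hz : ω < z.re) (x : H) :
    IntegrableOn (fun τ => laplaceWeight k z τ • T τ x) (Set.Ioi 0) := by
  have hc : 0 < (z.re - ω) / 2 := by linarith
  refine Integrable.mono'
    ((integrableOn_exp_mul_Ioi (neg_lt_zero.2 hc) 0).const_mul (M * ‖x‖ * (2 / (z.re - ω)) ^ k))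
    (((hT.continuousOn_laplaceWeight_smul k z x).mono
      Set.Ioi_subset_Ici_self).aestronglyMeasurable measurableSet_Ioi) ?_
  filter_upwards [ae_restrict_mem measurableSet_Ioi] with τ hτ
  exact norm_laplaceWeight_smul_le hM k hz x (le_of_lt hτ)

theorem tendsto_laplaceWeight_smul_atTop {M ω : ℝ}
    (hM : ∀ t, 0 ≤ t → ‖T t‖ ≤ M * Real.exp (ω * t))
    (k : ℕ) {z : ℂ} (hz : ω < z.re) (x : H) :
    Tendsto (fun τ => laplaceWeight k z τ • T τ x) atTop (𝓝 0) := by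
  have hc : 0 < (z.re - ω) / 2 := by linarith
  have h1 : Tendsto (fun τ : ℝ => Real.exp (-((z.re - ω) / 2) * τ)) atTop (𝓝 0) :=
    Real.tendsto_exp_atBot.comp (tendsto_id.const_mul_atTop_of_neg (neg_lt_zero.2 hc))
  have h2 := h1.const_mul (M * ‖x‖ * (2 / (z.re - ω)) ^ k)
  rw [mul_zero] at h2
  refine squeeze_zero_norm' ?_ h2
  filter_upwards [eventually_ge_atTop 0] with τ hτ
  exact norm_laplaceWeight_smul_le hM k hz x hτ

theorem integral_laplaceWeight_smul_deriv [CompleteSpace H] (hT : IsC0Semigroup T)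
    (hA : IsGenerator T A)
    {M ω : ℝ} (hM : ∀ t, 0 ≤ t → ‖T t‖ ≤ M * Real.exp (ω * t))
    (k : ℕ) {z : ℂ} (hz : ω < z.re) (x : A.domain) (w : ℝ → ℂ) (hw : Continuous w)
    (hd : ∀ τ : ℝ, HasDerivAt (laplaceWeight k z) (w τ) τ)
    (hInt : IntegrableOn (fun τ => w τ • T τ x - laplaceWeight k z τ • T τ (A x)) (Set.Ioi 0)) :
    ∫ τ in Set.Ioi 0, (w τ • T τ x - laplaceWeight k z τ • T τ (A x)) =
      -(laplaceWeight k z 0 • (x : H)) := by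
  have h1 := intervalIntegral_tendsto_integral_Ioi 0 hInt tendsto_id
  have h2 := (tendsto_laplaceWeight_smul_atTop hM k hz (x : H)).sub_const
    (laplaceWeight k z 0 • (x : H))
  rw [zero_sub] at h2
  refine tendsto_nhds_unique h1 (h2.congr' ?_)
  filter_upwards [eventually_ge_atTop 0] with b hb
  symm
  have hcont : ∀ y : H, ContinuousOn (fun τ => T τ y) (Set.Icc 0 b) := fun y =>
    (hT.strong_continuity y).mono Set.Icc_subset_Ici_self
  have := intervalIntegral.integral_eq_sub_of_hasDeriv_right_of_le
    (f := fun τ => laplaceWeight k z τ • T τ (x : H))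
    (f' := fun τ => w τ • T τ (x : H) - laplaceWeight k z τ • T τ (A x)) hb
    ((continuous_laplaceWeight k z).continuousOn.smul (hcont _)) ?_ ?_
  · simpa [hT.map_zero] using this
  · intro τ hτ
    have h3 := ((hd τ).hasDerivWithinAt (s := Set.Ioi τ)).smul
      (hA.hasDerivWithinAt hT x hτ.1.le)
    refine h3.congr_deriv ?_
    rw [smul_neg]; abel
  · exact (ContinuousOn.sub (hw.continuousOn.smul (hcont _))
      ((continuous_laplaceWeight k z).continuousOn.smul (hcont _))).intervalIntegrable_of_Icc hb

theorem integral_laplaceWeight_zero_smul [CompleteSpace H] (hT : IsC0Semigroup T)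
    (hA : IsGenerator T A)
    {M ω : ℝ} (hM : ∀ t, 0 ≤ t → ‖T t‖ ≤ M * Real.exp (ω * t))
    {z : ℂ} (hz : ω < z.re) (x : A.domain) :
    ∫ τ in Set.Ioi 0, laplaceWeight 0 z τ • T τ (z • (x : H) + A x) = x := by
  have heq : (fun τ => (-(z * laplaceWeight 0 z τ)) • T τ (x : H) -
      laplaceWeight 0 z τ • T τ (A x)) =
      fun τ => -(laplaceWeight 0 z τ • T τ (z • (x : H) + A x)) := by
    funext τ
    rw [map_add, map_smul]; module
  have := integral_laplaceWeight_smul_deriv hT hA hM 0 hz x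
    (fun τ => -(z * laplaceWeight 0 z τ))
    ((continuous_const.mul (continuous_laplaceWeight 0 z)).neg)
    (hasDerivAt_laplaceWeight_zero z)
    (by rw [heq]; exact (integrableOn_laplaceWeight_smul hT hM 0 hz _).neg)
  rw [heq, integral_neg, neg_inj] at this
  rw [this]
  simp [laplaceWeight]

theorem integral_laplaceWeight_succ_smul [CompleteSpace H] (hT : IsC0Semigroup T)
    (hA : IsGenerator T A)
    {M ω : ℝ} (hM : ∀ t, 0 ≤ t → ‖T t‖ ≤ M * Real.exp (ω * t))
    (k : ℕ) {z : ℂ} (hz : ω < z.re) (x : A.domain) :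
    ∫ τ in Set.Ioi 0, laplaceWeight (k + 1) z τ • T τ (z • (x : H) + A x) =
      ∫ τ in Set.Ioi 0, laplaceWeight k z τ • T τ (x : H) := by
  have heq : (fun τ => (laplaceWeight k z τ - z * laplaceWeight (k + 1) z τ) • T τ (x : H) -
      laplaceWeight (k + 1) z τ • T τ (A x)) =
      fun τ => laplaceWeight k z τ • T τ (x : H) -
        laplaceWeight (k + 1) z τ • T τ (z • (x : H) + A x) := by
    funext τ
    rw [map_add, map_smul]; module
  have hi1 := integrableOn_laplaceWeight_smul hT hM k hz (x : H)
  have hi2 := integrableOn_laplaceWeight_smul hT hM (k + 1) hz (z • (x : H) + A x)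
  have := integral_laplaceWeight_smul_deriv hT hA hM (k + 1) hz x
    (fun τ => laplaceWeight k z τ - z * laplaceWeight (k + 1) z τ)
    ((continuous_laplaceWeight k z).sub
      (continuous_const.mul (continuous_laplaceWeight (k + 1) z)))
    (hasDerivAt_laplaceWeight_succ k z)
    (by rw [heq]; exact hi1.sub hi2)
  rw [heq, integral_sub hi1 hi2] at this
  rw [eq_comm, ← sub_eq_zero, this]
  simp [laplaceWeight]

/-- The Laplace transforms of weighted orbits are powers of the resolvent. -/
theorem integral_laplaceWeight_smul_eq_pow [CompleteSpace H] (hT : IsC0Semigroup T)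
    (hA : IsGenerator T A)
    {M ω : ℝ} (hM : ∀ t, 0 ≤ t → ‖T t‖ ≤ M * Real.exp (ω * t))
    {z : ℂ} (hz : ω < z.re) {R : H →L[ℂ] H} (hR : IsResolventAt A z R) (k : ℕ) (x : H) :
    ∫ τ in Set.Ioi 0, laplaceWeight k z τ • T τ x = (R ^ (k + 1)) x := by
  induction k generalizing x with
  | zero =>
    obtain ⟨hx, h⟩ := hR.1 x
    have := integral_laplaceWeight_zero_smul hT hA hM hz ⟨R x, hx⟩
    simpa [h] using this
  | succ k ih =>
    obtain ⟨hx, h⟩ := hR.1 x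
    have := integral_laplaceWeight_succ_smul hT hA hM k hz ⟨R x, hx⟩
    simp only [h] at this
    rw [this, ih, pow_succ R (k + 1)]
    rfl

end Semigroup

section Resolvent

variable {H : Type*} [NormedAddCommGroup H] [InnerProductSpace ℂ H]
variable {A B : H →ₗ.[ℂ] H} {z w : ℂ} {R R' : H →L[ℂ] H}

theorem IsResolventAt.norm_le_of_lower_bound (hR : IsResolventAt A z R) {K : ℝ} (hK : 0 ≤ K)
    (h : ∀ x : A.domain, ‖(x : H)‖ ≤ K * ‖z • (x : H) + A x‖) : ‖R‖ ≤ K := by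
  refine R.opNorm_le_bound hK fun y => ?_
  obtain ⟨hy, e⟩ := hR.1 y
  simpa [e] using h ⟨R y, hy⟩

/-- The resolvent identity. -/
theorem IsResolventAt.resolvent_identity (hR : IsResolventAt A z R) (hR' : IsResolventAt A w R') :
    R' = R + (z - w) • (R * R') := by
  ext y
  obtain ⟨hy, e⟩ := hR'.1 y
  have h := hR.2 ⟨R' y, hy⟩
  have e2 : z • R' y + A ⟨R' y, hy⟩ = y + (z - w) • R' y := by
    rw [eq_sub_of_add_eq' e, sub_smul]
    abel
  simp only [e2, map_add, map_smul] at h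
  simp [h]

theorem IsResolventAt.unique (hR : IsResolventAt A z R) (hR' : IsResolventAt A z R') : R = R' := by
  simpa using (hR.resolvent_identity hR').symm

theorem IsResolventAt.commute (hR : IsResolventAt A z R) (hR' : IsResolventAt A w R') :
    R * R' = R' * R := by
  rcases eq_or_ne z w with rfl | hne
  · rw [hR.unique hR']
  · have h1 := hR.resolvent_identity hR'
    have h2 := hR'.resolvent_identity hR
    have h3 : (z - w) • (R * R') = (z - w) • (R' * R) := by
      calc (z - w) • (R * R') = R' - R := (sub_eq_of_eq_add' h1).symm
        _ = -(R - R') := (neg_sub _ _).symm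
        _ = -((w - z) • (R' * R)) := by rw [← sub_eq_of_eq_add' h2]
        _ = (z - w) • (R' * R) := by rw [← neg_smul, neg_sub]
    exact smul_right_injective _ (sub_ne_zero.2 hne) h3

theorem IsResolventAt.norm_le (hR : IsResolventAt A z R) (hR' : IsResolventAt A w R') :
    ‖R'‖ ≤ ‖R‖ * (1 + ‖z - w‖ * ‖R'‖) := by
  calc ‖R'‖ = ‖R + (z - w) • (R * R')‖ := by rw [← hR.resolvent_identity hR']
    _ ≤ ‖R‖ + ‖z - w‖ * (‖R‖ * ‖R'‖) := by
      refine (norm_add_le _ _).trans ?_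
      rw [norm_smul]
      gcongr
      exact norm_mul_le _ _
    _ = _ := by ring

/-- The resolvent set is open, by the Neumann series. -/
theorem IsResolventAt.exists_of_norm_lt [CompleteSpace H] (hR : IsResolventAt A z R)
    (h : ‖w - z‖ * ‖R‖ < 1) : ∃ R', IsResolventAt A w R' := by
  have hlt : ‖-((w - z) • R)‖ < 1 := by rwa [norm_neg, norm_smul]
  set U := Units.oneSub _ hlt with hU
  have hUv : (U : H →L[ℂ] H) = 1 + (w - z) • R := by simp [hU]
  have hUapp : ∀ y, (U : H →L[ℂ] H) y = y + (w - z) • R y := fun y => by rw [hUv]; simp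
  refine ⟨R * (↑U⁻¹ : H →L[ℂ] H), fun x => ?_, fun x => ?_⟩
  · obtain ⟨hx, e⟩ := hR.1 ((↑U⁻¹ : H →L[ℂ] H) x)
    refine ⟨hx, ?_⟩
    have h1 : (U : H →L[ℂ] H) ((↑U⁻¹ : H →L[ℂ] H) x) = x := by
      rw [← mul_apply_eq_comp, U.mul_inv]; rfl
    rw [hUapp] at h1
    set v := (↑U⁻¹ : H →L[ℂ] H) x
    change w • R v + A ⟨R v, hx⟩ = x
    have e' : A ⟨R v, hx⟩ = v - z • R v := eq_sub_of_add_eq' e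
    rw [e', ← h1, sub_smul]
    abel
  · set y := z • (x : H) + A x with hy
    have hRy : R y = x := hR.2 x
    have : w • (x : H) + A x = (U : H →L[ℂ] H) y := by
      rw [hUapp, hRy, hy]; module
    rw [this, mul_apply_eq_comp, ← mul_apply_eq_comp (↑U⁻¹ : H →L[ℂ] H),
      U.inv_mul]
    exact hRy

theorem IsInversePMap.symm (h : IsInversePMap A B) : IsInversePMap B A := ⟨h.2, h.1⟩

theorem IsInversePMap.isResolventAt_inv (h : IsInversePMap A B) (hz : z ≠ 0)
    (hR : IsResolventAt B z R) : IsResolventAt A z⁻¹ (z • (1 - z • R)) := by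
  refine ⟨fun y => ?_, fun x => ?_⟩
  · obtain ⟨hv, e⟩ := hR.1 y
    obtain ⟨hb, e2⟩ := h.2 ⟨R y, hv⟩
    have e3 : (z • (1 - z • R)) y = z • B ⟨R y, hv⟩ := by
      have : B ⟨R y, hv⟩ = y - z • R y := eq_sub_of_add_eq' e
      simp [this]
    have hmem : (z • (1 - z • R)) y ∈ A.domain := by rw [e3]; exact A.domain.smul_mem _ hb
    refine ⟨hmem, ?_⟩
    have e4 : (⟨(z • (1 - z • R)) y, hmem⟩ : A.domain) = z • ⟨B ⟨R y, hv⟩, hb⟩ :=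
      Subtype.ext e3
    rw [e4, LinearPMap.map_smul, e2, e3, inv_smul_smul₀ hz, add_comm]
    exact e
  · obtain ⟨hb, e⟩ := h.1 x
    have h1 := hR.2 ⟨A x, hb⟩
    rw [e] at h1
    have h2 : z • (z⁻¹ • (x : H) + A x) = z • A x + x := by
      rw [smul_add, smul_inv_smul₀ hz, add_comm]
    have h3 : z • R (z⁻¹ • (x : H) + A x) = A x := by
      rw [← map_smul, h2]; exact h1
    simp only [smul_apply, sub_apply,
      one_apply_eq_self, h3]
    rw [add_sub_cancel_right, smul_inv_smul₀ hz]

theorem norm_smul_one_sub_smul_le (z : ℂ) (R : H →L[ℂ] H) :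
    ‖z • (1 - z • R)‖ ≤ ‖z‖ * (1 + ‖z‖ * ‖R‖) := by
  rw [norm_smul]
  gcongr
  refine (norm_sub_le _ _).trans ?_
  rw [norm_smul]
  gcongr
  exact ContinuousLinearMap.norm_id_le

end Resolvent

section Laplace

variable {H : Type*} [NormedAddCommGroup H] [InnerProductSpace ℂ H]
variable {T : ℝ → H →L[ℂ] H} {A : H →ₗ.[ℂ] H}

/-- The Laplace transform of an orbit lies in the domain of the generator. -/
theorem laplace_mem_domain [CompleteSpace H] (hT : IsC0Semigroup T)
    (hA : IsGenerator T A) {M ω : ℝ} (hM : ∀ t, 0 ≤ t → ‖T t‖ ≤ M * Real.exp (ω * t))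
    {z : ℂ} (hz : ω < z.re) (x : H) {V : H}
    (hV : V = ∫ τ in Set.Ioi 0, laplaceWeight 0 z τ • T τ x) :
    ∃ h : V ∈ A.domain, z • V + A ⟨V, h⟩ = x := by
  have hInt := integrableOn_laplaceWeight_smul hT hM 0 hz x
  let g : ℝ → H := fun τ => laplaceWeight 0 z τ • T (max τ 0) x
  have hg : Continuous g := by
    refine (continuous_laplaceWeight 0 z).smul ?_
    exact (hT.strong_continuity x).comp_continuous (by fun_prop) (fun τ => le_max_right τ 0)
  have hgint : IntegrableOn g (Set.Ioi 0) := by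
    refine hInt.congr_fun (fun τ (hτ : 0 < τ) => ?_) measurableSet_Ioi
    simp [g, max_eq_left hτ.le]
  have hVg : V = ∫ τ in Set.Ioi 0, g τ := by
    rw [hV]
    refine setIntegral_congr_fun measurableSet_Ioi (fun τ (hτ : 0 < τ) => ?_)
    simp [g, max_eq_left hτ.le]
  let G : ℝ → H := fun h => Complex.exp (z * h) • (V - ∫ τ in (0 : ℝ)..h, g τ)
  have hG0 : G 0 = V := by simp [G]
  have hGT : ∀ h : ℝ, 0 ≤ h → T h V = G h := by
    intro h hh
    have h1 : V - ∫ τ in (0 : ℝ)..h, g τ = ∫ τ in Set.Ioi h, g τ := by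
      rw [hVg, ← intervalIntegral.integral_interval_add_Ioi (a := 0) (b := h) hgint
        (hgint.mono_set (Set.Ioi_subset_Ioi hh)), add_sub_cancel_left]
    have h2 : ∫ τ in Set.Ioi h, g τ = ∫ τ in Set.Ioi 0, g (τ + h) := by
      have := (measurePreserving_add_right volume h).setIntegral_preimage_emb
        (measurableEmbedding_addRight h) g (Set.Ioi h)
      rw [← this, Set.preimage_add_const_Ioi, sub_self]
    simp only [G]
    rw [h1, h2, hV, ← ContinuousLinearMap.integral_comp_comm _ hInt, ← integral_smul]
    refine setIntegral_congr_fun measurableSet_Ioi (fun τ (hτ : 0 < τ) => ?_)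
    have h3 : T (max (τ + h) 0) x = T h (T τ x) := by
      rw [max_eq_left (by positivity), add_comm, hT.map_add _ _ hh hτ.le]; rfl
    have h4 : Complex.exp (z * h) * laplaceWeight 0 z (τ + h) = laplaceWeight 0 z τ := by
      simp only [laplaceWeight, pow_zero, Nat.factorial_zero, Nat.cast_one, div_one, one_mul,
        ← Complex.exp_add]
      push_cast
      ring_nf
    simp only [g, h3, smul_smul, h4, map_smul]
  have hd : HasDerivAt G (z • V - x) 0 := by
    have e1 : HasDerivAt (fun h : ℝ => Complex.exp (z * (h : ℂ))) z 0 := by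
      have : HasDerivAt (fun t : ℝ => z * (t : ℂ)) z 0 := by
        simpa using ((Complex.ofRealCLM.hasDerivAt (x := (0 : ℝ))).const_mul z)
      simpa using this.cexp
    have e2 : HasDerivAt (fun h : ℝ => V - ∫ τ in (0 : ℝ)..h, g τ) (-g 0) 0 :=
      ((hg.integral_hasStrictDerivAt 0 0).hasDerivAt).const_sub V
    have e3 := e1.smul e2
    refine e3.congr_deriv ?_
    simp [g, laplaceWeight, hT.map_zero]
    abel
  have key : Tendsto (fun h : ℝ => (h : ℂ)⁻¹ • (T h V - V)) (𝓝[>] 0) (𝓝 (z • V - x)) := by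
    have h1 := (hasDerivWithinAt_iff_tendsto_slope' (by simp)).1 (hd.hasDerivWithinAt (s := Set.Ioi 0))
    refine h1.congr' ?_
    filter_upwards [self_mem_nhdsWithin] with h (hh : 0 < h)
    rw [hGT h hh.le, slope_def_module, hG0, ← Complex.ofReal_inv, Complex.coe_smul, sub_zero]
  have hmem : V ∈ A.domain := (hA.1 _).2 ⟨_, key⟩
  refine ⟨hmem, ?_⟩
  have h1 := tendsto_nhds_unique (hA.2 ⟨V, hmem⟩) key
  have h2 : A ⟨V, hmem⟩ = -(z • V - x) := by rw [← h1, neg_neg]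
  rw [h2]; abel

theorem exists_isResolventAt_of_semigroup [CompleteSpace H] (hT : IsC0Semigroup T)
    (hA : IsGenerator T A) {M ω : ℝ} (hM : ∀ t, 0 ≤ t → ‖T t‖ ≤ M * Real.exp (ω * t))
    {z : ℂ} (hz : ω < z.re) :
    ∃ R : H →L[ℂ] H, IsResolventAt A z R ∧ ‖R‖ ≤ M / (z.re - ω) := by
  have hc : 0 < z.re - ω := by linarith
  have hInt := fun x => integrableOn_laplaceWeight_smul hT hM 0 hz x
  have hM0 : 0 ≤ M := by simpa using (norm_nonneg _).trans (hM 0 le_rfl)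
  let L : H →ₗ[ℂ] H :=
    { toFun := fun x => ∫ τ in Set.Ioi 0, laplaceWeight 0 z τ • T τ x
      map_add' := fun x y => by
        simp only [map_add, smul_add]
        exact integral_add (hInt x) (hInt y)
      map_smul' := fun c x => by
        simp only [map_smul, RingHom.id_apply]
        rw [← integral_smul]
        simp only [smul_comm c] }
  have hL : ∀ x, ‖L x‖ ≤ M / (z.re - ω) * ‖x‖ := by
    intro x
    have h1 : ‖L x‖ ≤ ∫ τ in Set.Ioi 0, M * ‖x‖ * Real.exp (-(z.re - ω) * τ) := by
      refine norm_integral_le_of_norm_le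
        ((integrableOn_exp_mul_Ioi (neg_lt_zero.2 hc) 0).const_mul _) ?_
      filter_upwards [ae_restrict_mem measurableSet_Ioi] with τ (hτ : 0 < τ)
      rw [norm_smul, norm_laplaceWeight 0 z hτ.le]
      calc τ ^ 0 / (Nat.factorial 0) * Real.exp (-(z.re * τ)) * ‖T τ x‖
          ≤ 1 * Real.exp (-(z.re * τ)) * (M * Real.exp (ω * τ) * ‖x‖) := by
            gcongr
            · simp
            · exact (T τ).le_of_opNorm_le (hM τ hτ.le) x
        _ = M * ‖x‖ * (Real.exp (-(z.re * τ)) * Real.exp (ω * τ)) := by ring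
        _ = _ := by rw [← Real.exp_add]; congr 2; ring
    refine h1.trans_eq ?_
    rw [integral_const_mul, integral_exp_mul_Ioi (neg_lt_zero.2 hc)]
    rw [mul_zero, Real.exp_zero, neg_div_neg_eq]
    ring
  refine ⟨L.mkContinuous _ hL, ⟨fun x => ?_, fun x => ?_⟩,
    L.mkContinuous_norm_le (by positivity) hL⟩
  · exact laplace_mem_domain hT hA hM hz x rfl
  · exact integral_laplaceWeight_zero_smul hT hA hM hz x

/-- Truncating the Laplace integral bounds vectors by their images under `z + A` and the orbit. -/
theorem norm_le_of_truncated_laplace [CompleteSpace H] (hT : IsC0Semigroup T)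
    (hA : IsGenerator T A) {M t : ℝ} (ht : 0 ≤ t) (hM : ∀ τ, 0 ≤ τ → τ ≤ t → ‖T τ‖ ≤ M)
    {z : ℂ} (hz : 0 ≤ z.re) (x : A.domain) :
    ‖(x : H)‖ ≤ M * t * ‖z • (x : H) + A x‖ + ‖T t x‖ := by
  have hw : ∀ τ : ℝ, 0 ≤ τ → ‖laplaceWeight 0 z τ‖ ≤ 1 := by
    intro τ hτ
    rw [norm_laplaceWeight 0 z hτ]
    simpa using mul_nonneg hz hτ
  have hcont : ∀ y : H, ContinuousOn (fun τ => T τ y) (Set.Icc 0 t) := fun y =>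
    (hT.strong_continuity y).mono Set.Icc_subset_Ici_self
  have h1 := intervalIntegral.integral_eq_sub_of_hasDeriv_right_of_le
    (f := fun τ => laplaceWeight 0 z τ • T τ (x : H))
    (f' := fun τ => -(laplaceWeight 0 z τ • T τ (z • (x : H) + A x))) ht
    ((continuous_laplaceWeight 0 z).continuousOn.smul (hcont _))
    (fun τ hτ => by
      have h3 := ((hasDerivAt_laplaceWeight_zero z τ).hasDerivWithinAt (s := Set.Ioi τ)).smul
        (hA.hasDerivWithinAt hT x hτ.1.le)
      refine h3.congr_deriv ?_
      rw [map_add, map_smul]; module)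
    ((((continuous_laplaceWeight 0 z).continuousOn.smul (hcont _)).neg).intervalIntegrable_of_Icc
      ht)
  have h0 : laplaceWeight 0 z 0 • T 0 (x : H) = x := by simp [laplaceWeight, hT.map_zero]
  rw [h0] at h1
  have h2 : ‖∫ τ in (0 : ℝ)..t, -(laplaceWeight 0 z τ • T τ (z • (x : H) + A x))‖ ≤
      M * ‖z • (x : H) + A x‖ * |t - 0| := by
    refine intervalIntegral.norm_integral_le_of_norm_le_const fun τ hτ => ?_
    rw [Set.uIoc_of_le ht] at hτ
    rw [norm_neg, norm_smul]
    calc _ ≤ 1 * (M * ‖z • (x : H) + A x‖) := by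
          gcongr
          · exact hw τ hτ.1.le
          · exact (T τ).le_of_opNorm_le (hM τ hτ.1.le hτ.2) _
      _ = _ := one_mul _
  rw [h1, sub_zero, abs_of_nonneg ht] at h2
  have h3 : ‖(x : H)‖ ≤ ‖laplaceWeight 0 z t • T t (x : H) - x‖ + ‖laplaceWeight 0 z t • T t (x : H)‖ := by
    rw [norm_sub_rev]
    simpa using norm_add_le ((x : H) - laplaceWeight 0 z t • T t (x : H)) (laplaceWeight 0 z t • T t (x : H))
  have h4 : ‖laplaceWeight 0 z t • T t (x : H)‖ ≤ ‖T t x‖ := by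
    rw [norm_smul]
    exact mul_le_of_le_one_left (norm_nonneg _) (hw t ht)
  linarith

end Laplace

section HilbertDecay

variable {H : Type*} [NormedAddCommGroup H] [InnerProductSpace ℂ H]
variable {T : ℝ → H →L[ℂ] H} {A : H →ₗ.[ℂ] H}

theorem integrableOn_sq_norm_laplaceWeight_smul (hT : IsC0Semigroup T) {M ω : ℝ}
    (hM : ∀ t, 0 ≤ t → ‖T t‖ ≤ M * Real.exp (ω * t))
    (k : ℕ) {z : ℂ} (hz : ω < z.re) (x : H) :
    IntegrableOn (fun τ => ‖laplaceWeight k z τ • T τ x‖ ^ 2) (Set.Ioi 0) := by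
  have hc : 0 < z.re - ω := by linarith
  refine Integrable.mono' ((integrableOn_exp_mul_Ioi (neg_lt_zero.2 hc) 0).const_mul
    ((M * ‖x‖ * (2 / (z.re - ω)) ^ k) ^ 2))
    ((((hT.continuousOn_laplaceWeight_smul k z x).mono
      Set.Ioi_subset_Ici_self).norm.pow 2).aestronglyMeasurable measurableSet_Ioi) ?_
  filter_upwards [ae_restrict_mem measurableSet_Ioi] with τ (hτ : 0 < τ)
  rw [norm_pow, norm_norm]
  refine (pow_le_pow_left₀ (norm_nonneg _)
    (norm_laplaceWeight_smul_le hM k hz x hτ.le) 2).trans_eq ?_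
  rw [mul_pow, ← Real.exp_nat_mul]
  congr 2
  push_cast
  ring

theorem memLp_two_indicator_laplaceWeight_smul (hT : IsC0Semigroup T) {M ω : ℝ}
    (hM : ∀ t, 0 ≤ t → ‖T t‖ ≤ M * Real.exp (ω * t))
    (k : ℕ) {z : ℂ} (hz : ω < z.re) (x : H) :
    MemLp ((Set.Ioi 0).indicator fun τ => laplaceWeight k z τ • T τ x) 2 := by
  rw [memLp_indicator_iff_restrict measurableSet_Ioi, memLp_two_iff_integrable_sq_norm]
  · exact integrableOn_sq_norm_laplaceWeight_smul hT hM k hz x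
  · exact (integrableOn_laplaceWeight_smul hT hM k hz x).aestronglyMeasurable

theorem fourier_indicator_laplaceWeight_smul (k : ℕ) (a : ℝ) (x : H) (s : ℝ) :
    𝓕 ((Set.Ioi 0).indicator fun τ => laplaceWeight k (a : ℂ) τ • T τ x) s =
      ∫ τ in Set.Ioi 0, laplaceWeight k (a + (2 * Real.pi * s : ℝ) * Complex.I) τ • T τ x := by
  rw [Real.fourier_real_eq_integral_exp_smul, ← integral_indicator measurableSet_Ioi]
  congr 1
  funext τ
  by_cases hτ : τ ∈ Set.Ioi (0 : ℝ)
  · rw [Set.indicator_of_mem hτ, Set.indicator_of_mem hτ, smul_smul]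
    congr 1
    simp only [laplaceWeight]
    rw [mul_left_comm, ← Complex.exp_add]
    congr 2
    push_cast
    ring
  · rw [Set.indicator_of_notMem hτ, Set.indicator_of_notMem hτ, smul_zero]

/-- Resolvent bounds along the line `Re z = 1 / t` control the semigroup at time `t`;
this rests on Plancherel's theorem. -/
theorem norm_apply_le_of_resolvent_bound [CompleteSpace H] (hT : IsC0Semigroup T)
    (hA : IsGenerator T A) {M ω : ℝ} (hM1 : 1 ≤ M) (hω : 0 ≤ ω)
    (hM : ∀ t, 0 ≤ t → ‖T t‖ ≤ M * Real.exp (ω * t))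
    {t : ℝ} (ht : 0 < t) (hωt : ω * t ≤ 1 / 2) (k : ℕ)
    (R : ℝ → H →L[ℂ] H) (hR : ∀ s : ℝ, IsResolventAt A ((t⁻¹ : ℝ) + s * Complex.I) (R s))
    {K : ℝ} (hK : 0 ≤ K) (x y : H) (h : ∀ s, ‖(R s ^ (k + 1)) y‖ ≤ K * ‖R s x‖) :
    ‖T t y‖ ≤ 2 * M ^ 2 * k.factorial * Real.exp 2 * 2 ^ k * K * (t ^ k)⁻¹ * ‖x‖ := by
  set a : ℝ := t⁻¹ with ha
  have hat : a * t = 1 := inv_mul_cancel₀ ht.ne'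
  have ha0 : 0 < a := inv_pos.2 ht
  have hωa : ω ≤ a / 2 := by
    have : ω * t ≤ a / 2 * t := by linarith
    exact le_of_mul_le_mul_right this ht
  have hz : ω < (a : ℂ).re := by rw [Complex.ofReal_re]; linarith
  have hzs : ∀ s : ℝ, ω < ((a : ℂ) + (s : ℂ) * Complex.I).re := by
    intro s; simpa using hz
  set f := (Set.Ioi (0 : ℝ)).indicator fun τ => laplaceWeight 0 (a : ℂ) τ • T τ x with hf
  set g := (Set.Ioi (0 : ℝ)).indicator fun τ => laplaceWeight k (a : ℂ) τ • T τ y with hg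
  have hplan : ∫ τ, ‖g τ‖ ^ 2 ≤ K ^ 2 * ∫ τ, ‖f τ‖ ^ 2 := by
    refine integral_sq_norm_le_of_norm_fourier_le
      ((integrable_indicator_iff measurableSet_Ioi).2
        (integrableOn_laplaceWeight_smul hT hM 0 hz x))
      (memLp_two_indicator_laplaceWeight_smul hT hM 0 hz x)
      ((integrable_indicator_iff measurableSet_Ioi).2
        (integrableOn_laplaceWeight_smul hT hM k hz y))
      (memLp_two_indicator_laplaceWeight_smul hT hM k hz y) hK fun s => ?_
    rw [fourier_indicator_laplaceWeight_smul, fourier_indicator_laplaceWeight_smul,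
      integral_laplaceWeight_smul_eq_pow hT hA hM (hzs _) (hR _),
      integral_laplaceWeight_smul_eq_pow hT hA hM (hzs _) (hR _)]
    simpa using h (2 * Real.pi * s)
  have hsq : ∀ (j : ℕ) (v : H), (fun τ => ‖(Set.Ioi (0 : ℝ)).indicator
      (fun τ => laplaceWeight j (a : ℂ) τ • T τ v) τ‖ ^ 2) =
      (Set.Ioi (0 : ℝ)).indicator fun τ => ‖laplaceWeight j (a : ℂ) τ • T τ v‖ ^ 2 := by
    intro j v
    funext τ
    by_cases hτ : τ ∈ Set.Ioi (0 : ℝ) <;> simp [hτ]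
  rw [hf, hg, hsq, hsq, integral_indicator measurableSet_Ioi,
    integral_indicator measurableSet_Ioi] at hplan
  have hup : ∫ τ in Set.Ioi 0, ‖laplaceWeight 0 (a : ℂ) τ • T τ x‖ ^ 2 ≤
      2 * M ^ 2 * ‖x‖ ^ 2 * t := by
    have hc : 0 < a - ω := by linarith
    calc _ ≤ ∫ τ in Set.Ioi 0, (M * ‖x‖) ^ 2 * Real.exp (-(a - ω) * τ) := by
          refine setIntegral_mono_on (integrableOn_sq_norm_laplaceWeight_smul hT hM 0 hz x)
            ((integrableOn_exp_mul_Ioi (neg_lt_zero.2 hc) 0).const_mul _) measurableSet_Ioi ?_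
          intro τ (hτ : 0 < τ)
          refine (pow_le_pow_left₀ (norm_nonneg _)
            (norm_laplaceWeight_smul_le hM 0 hz x hτ.le) 2).trans_eq ?_
          rw [mul_pow, ← Real.exp_nat_mul, pow_zero, mul_one]
          congr 2
          rw [Complex.ofReal_re]
          push_cast
          ring
      _ = (M * ‖x‖) ^ 2 * (1 / (a - ω)) := by
          rw [integral_const_mul, integral_exp_mul_Ioi (neg_lt_zero.2 hc), mul_zero,
            Real.exp_zero, neg_div_neg_eq]
      _ ≤ (M * ‖x‖) ^ 2 * (2 * t) := by
          gcongr
          rw [div_le_iff₀ hc]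
          nlinarith
      _ = _ := by ring
  set c : ℝ := (t / 2) ^ k / k.factorial * Real.exp (-1) * ((M * Real.exp 1)⁻¹ * ‖T t y‖) with hc
  have hc0 : 0 ≤ c := by positivity
  have hlow : t / 2 * c ^ 2 ≤ ∫ τ in Set.Ioi 0, ‖laplaceWeight k (a : ℂ) τ • T τ y‖ ^ 2 := by
    have hsub : Set.Ioc (t / 2) t ⊆ Set.Ioi 0 := fun τ hτ =>
      lt_of_le_of_lt (by positivity) hτ.1
    have hI := integrableOn_sq_norm_laplaceWeight_smul hT hM k hz y
    calc t / 2 * c ^ 2 = ∫ τ in Set.Ioc (t / 2) t, c ^ 2 := by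
          rw [setIntegral_const, smul_eq_mul, Measure.real, Real.volume_Ioc,
            ENNReal.toReal_ofReal (by linarith)]
          ring
      _ ≤ ∫ τ in Set.Ioc (t / 2) t, ‖laplaceWeight k (a : ℂ) τ • T τ y‖ ^ 2 := by
          refine setIntegral_mono_on (by simp) (hI.mono_set hsub) measurableSet_Ioc ?_
          intro τ hτ
          have hτ0 : 0 < τ := hsub hτ
          refine pow_le_pow_left₀ hc0 ?_ 2
          rw [norm_smul, norm_laplaceWeight k _ hτ0.le, hc]
          have hTt : (M * Real.exp 1)⁻¹ * ‖T t y‖ ≤ ‖T τ y‖ := by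
            rw [inv_mul_le_iff₀ (by positivity)]
            have e1 : T t y = T (t - τ) (T τ y) := by
              rw [← ContinuousLinearMap.comp_apply,
                ← hT.map_add _ _ (by linarith [hτ.2]) hτ0.le, sub_add_cancel]
            rw [e1]
            refine ((T (t - τ)).le_of_opNorm_le (hM _ (by linarith [hτ.2])) _).trans ?_
            gcongr
            nlinarith
          have hexp : Real.exp (-1) ≤ Real.exp (-((a : ℂ).re * τ)) := by
            gcongr
            rw [Complex.ofReal_re, ← hat]
            gcongr
            exact hτ.2
          gcongr
          exact hτ.1.le
      _ ≤ _ := setIntegral_mono_set hI (Eventually.of_forall fun τ => by positivity)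
          hsub.eventuallyLE
  have hfin : c ^ 2 ≤ (2 * K * M * ‖x‖) ^ 2 := by
    have h1 : t / 2 * c ^ 2 ≤ K ^ 2 * (2 * M ^ 2 * ‖x‖ ^ 2 * t) :=
      hlow.trans (hplan.trans (by gcongr))
    have h2 : t / 2 * c ^ 2 ≤ t / 2 * (2 * K * M * ‖x‖) ^ 2 := h1.trans_eq (by ring)
    exact le_of_mul_le_mul_left h2 (by positivity)
  have hfin' : c ≤ 2 * K * M * ‖x‖ := (pow_le_pow_iff_left₀ hc0 (by positivity) two_ne_zero).1 hfin
  have hN : ‖T t y‖ = c * (k.factorial * Real.exp 2 * M * 2 ^ k * (t ^ k)⁻¹) := by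
    have he : Real.exp 2 = Real.exp 1 * Real.exp 1 := by rw [← Real.exp_add]; norm_num
    have hkf : (k.factorial : ℝ) ≠ 0 := by exact_mod_cast k.factorial_ne_zero
    rw [hc, he, Real.exp_neg, div_pow]
    field_simp
  rw [hN]
  calc _ ≤ 2 * K * M * ‖x‖ * (k.factorial * Real.exp 2 * M * 2 ^ k * (t ^ k)⁻¹) := by gcongr
    _ = _ := by ring

end HilbertDecay

section InverseGenerator

variable {H : Type*} [NormedAddCommGroup H] [InnerProductSpace ℂ H]
variable {A B : H →ₗ.[ℂ] H} {T S : ℝ → H →L[ℂ] H}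

/-- A bounded semigroup with generator `-A⁻¹` forces a half-plane resolvent bound on `A`. -/
theorem IsInversePMap.exists_isResolventAt [CompleteSpace H] (hinv : IsInversePMap A B)
    (hS : IsC0Semigroup S) (hB : IsGenerator S B) {C : ℝ} (hC : ∀ t, 0 ≤ t → ‖S t‖ ≤ C)
    {w : ℂ} (hw : 0 < w.re) :
    ∃ R, IsResolventAt A w R ∧ ‖R‖ ≤ (1 + C) / w.re := by
  have hw0 : w ≠ 0 := by rintro rfl; simp at hw
  have hn : 0 < ‖w‖ := norm_pos_iff.2 hw0
  have hC0 : 0 ≤ C := (norm_nonneg _).trans (hC 0 le_rfl)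
  have hre : (w⁻¹).re = w.re / ‖w‖ ^ 2 := by rw [Complex.inv_re, Complex.normSq_eq_norm_sq]
  have hre0 : 0 < (w⁻¹).re := by rw [hre]; positivity
  obtain ⟨R, hR, hRn⟩ := exists_isResolventAt_of_semigroup hS hB (M := C) (ω := 0)
    (by simpa using hC) hre0
  have h1 := hinv.isResolventAt_inv (inv_ne_zero hw0) hR
  rw [inv_inv] at h1
  refine ⟨_, h1, (norm_smul_one_sub_smul_le _ _).trans ?_⟩
  rw [sub_zero, hre] at hRn
  rw [norm_inv]
  calc ‖w‖⁻¹ * (1 + ‖w‖⁻¹ * ‖R‖) ≤ ‖w‖⁻¹ * (1 + ‖w‖⁻¹ * (C / (w.re / ‖w‖ ^ 2))) := by gcongr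
    _ = ‖w‖⁻¹ + C / w.re := by field_simp
    _ ≤ w.re⁻¹ + C / w.re := by
      gcongr
      exact (le_abs_self _).trans (Complex.abs_re_le_norm w)
    _ = _ := by ring

theorem IsResolventAt.norm_le_mul {z w : ℂ} {R R' : H →L[ℂ] H} (hR : IsResolventAt A z R)
    (hR' : IsResolventAt A w R') {D : ℝ} (hD : ‖z - w‖ * ‖R'‖ ≤ D) :
    ‖R'‖ ≤ (1 + D) * ‖R‖ := by
  rw [mul_comm]
  refine (hR.norm_le hR').trans ?_
  gcongr

/-- Semigroups in the Crandall–Pazy class have polynomially decaying resolvents on `iℝ`. -/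
theorem InCrandallPazy.exists_norm_resolvent_le [CompleteSpace H] (hT : IsC0Semigroup T)
    (hA : IsGenerator T A) {β : ℝ} (hβ0 : 0 < β) (hβ1 : β ≤ 1) (h : InCrandallPazy T A β) :
    ∃ C N : ℝ, 0 ≤ C ∧ 1 ≤ N ∧ ∀ η : ℝ, N ≤ |η| → ∀ R : H →L[ℂ] H,
      IsResolventAt A (Complex.I * η) R → ‖R‖ ≤ C * |η| ^ (-β) := by
  obtain ⟨D, hD, c, t₀, hc, ht₀, hDn⟩ := h
  obtain ⟨M, ω, hM1, hω, hM⟩ := hT.exists_norm_le_exp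
  set M' := M * Real.exp ω with hM'
  have hM'0 : 0 < M' := by positivity
  have hTb : ∀ τ, 0 ≤ τ → τ ≤ 1 → ‖T τ‖ ≤ M' := fun τ h0 h1 => by
    refine (hM τ h0).trans ?_
    rw [hM']
    gcongr
    nlinarith
  set m := min t₀ 1 with hm
  have hm0 : 0 < m := lt_min ht₀ one_pos
  refine ⟨2 * M' * ((2 * c) ^ β + 1), max 1 (2 * c / m ^ (1 / β)), by positivity,
    le_max_left _ _, fun η hη R hR => ?_⟩
  have hη1 : 1 ≤ |η| := (le_max_left _ _).trans hη
  have hη2 : 2 * c / m ^ (1 / β) ≤ |η| := (le_max_right _ _).trans hη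
  have hη0 : 0 < |η| := by linarith
  set t := (2 * c / |η|) ^ β with ht
  have ht0 : 0 < t := by positivity
  have htm : t ≤ m := by
    have h1 : 2 * c / |η| ≤ m ^ (1 / β) := by
      rw [div_le_iff₀ (by positivity)] at hη2 ⊢
      linarith
    calc t ≤ (m ^ (1 / β)) ^ β := by rw [ht]; gcongr
      _ = m := by rw [← Real.rpow_mul hm0.le, one_div_mul_cancel hβ0.ne', Real.rpow_one]
  have htβ : t ^ (-(1 / β)) = |η| / (2 * c) := by
    rw [ht, ← Real.rpow_mul (by positivity)]
    have : β * -(1 / β) = -1 := by field_simp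
    rw [this, Real.rpow_neg_one, inv_div]
  have hinvle : |η|⁻¹ ≤ |η| ^ (-β) := by
    rw [← Real.rpow_neg_one]
    exact Real.rpow_le_rpow_of_exponent_le hη1 (by linarith)
  have hteq : t = (2 * c) ^ β * |η| ^ (-β) := by
    rw [ht, Real.div_rpow (by positivity) hη0.le, Real.rpow_neg hη0.le]; rfl
  refine hR.norm_le_of_lower_bound (by positivity) fun x => ?_
  set y := (Complex.I * η) • (x : H) + A x with hy
  have h1 := norm_le_of_truncated_laplace hT hA ht0.le
    (fun τ h0 h1 => hTb τ h0 (h1.trans (htm.trans (min_le_right _ _))))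
    (z := Complex.I * η) (by simp) x
  rw [← hy] at h1
  have h2 : |η| * ‖T t x‖ ≤ M' * ‖y‖ + |η| / 2 * ‖(x : H)‖ := by
    obtain ⟨hx, e⟩ := hA.map_mem_domain hT x ht0.le
    obtain ⟨hx', e'⟩ := hD t ht0 x
    have e3 : (Complex.I * η) • T t x = T t y - D t x := by
      rw [e', e, hy, map_add, map_smul]; abel
    have e4 : ‖(Complex.I * η) • T t x‖ = |η| * ‖T t x‖ := by simp [norm_smul]
    rw [← e4, e3]
    refine (norm_sub_le _ _).trans (add_le_add ?_ ?_)
    · exact (T t).le_of_opNorm_le (hTb t ht0.le (htm.trans (min_le_right _ _))) y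
    · refine (D t).le_of_opNorm_le ((hDn t ht0 (htm.trans (min_le_left _ _))).trans_eq ?_) _
      rw [htβ]; field_simp
  have h3 : ‖T t x‖ ≤ |η|⁻¹ * (M' * ‖y‖) + ‖(x : H)‖ / 2 := by
    rw [← mul_le_mul_iff_right₀ hη0]
    refine h2.trans_eq ?_
    field_simp
  have h4 : |η|⁻¹ * (M' * ‖y‖) ≤ |η| ^ (-β) * (M' * ‖y‖) := by gcongr
  have h5 : M' * t * ‖y‖ = M' * ((2 * c) ^ β * |η| ^ (-β)) * ‖y‖ := by rw [← hteq]
  nlinarith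

theorem exists_norm_resolvent_le_of_mem_compact {K : Set ℝ} (hK : IsCompact K)
    (h : ∀ η ∈ K, ∃ R, IsResolventAt A (Complex.I * η) R) :
    ∃ C : ℝ, ∀ η ∈ K, ∀ R, IsResolventAt A (Complex.I * η) R → ‖R‖ ≤ C := by
  refine hK.induction_on
    (p := fun s => ∃ C : ℝ, ∀ η ∈ s, ∀ R, IsResolventAt A (Complex.I * η) R → ‖R‖ ≤ C)
    ⟨0, by simp⟩ ?_ ?_ ?_
  · rintro s t hst ⟨C, hC⟩
    exact ⟨C, fun η hη => hC η (hst hη)⟩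
  · rintro s t ⟨C, hC⟩ ⟨D, hD⟩
    refine ⟨max C D, fun η hη R hR => ?_⟩
    rcases hη with hη | hη
    · exact (hC η hη R hR).trans (le_max_left _ _)
    · exact (hD η hη R hR).trans (le_max_right _ _)
  · intro η hη
    obtain ⟨R₀, hR₀⟩ := h η hη
    have hev : ∀ᶠ η' : ℝ in 𝓝[K] η, ‖Complex.I * η - Complex.I * η'‖ * ‖R₀‖ < 1 / 2 := by
      refine nhdsWithin_le_nhds ?_
      have : Continuous fun η' : ℝ => ‖Complex.I * η - Complex.I * η'‖ * ‖R₀‖ := by fun_prop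
      exact this.continuousAt.eventually_lt_const (by simp)
    refine ⟨_, hev, 2 * ‖R₀‖, fun η' hη' R hR => ?_⟩
    have h1 := hR₀.norm_le hR
    have h2 : ‖Complex.I * η - Complex.I * η'‖ * ‖R₀‖ < 1 / 2 := hη'
    nlinarith [norm_nonneg R]

/-- Resolvent bounds for `A` on the imaginary axis: order `-β` at infinity, `-2` at zero. -/
def HasAxisBound (A : H →ₗ.[ℂ] H) (β : ℝ) : Prop :=
  ∃ C : ℝ, 0 ≤ C ∧ ∀ η : ℝ, η ≠ 0 → ∃ R, IsResolventAt A (Complex.I * η) R ∧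
    (1 ≤ |η| → ‖R‖ ≤ C * |η| ^ (-β)) ∧ (|η| ≤ 1 → ‖R‖ ≤ C * |η| ^ (-(2 : ℝ)))

/-- Resolvent bounds on the imaginary axis: bounded at infinity, order `-α` at zero. -/
def HasAxisBoundAtZero (B : H →ₗ.[ℂ] H) (α : ℝ) : Prop :=
  ∃ C : ℝ, 0 ≤ C ∧ ∀ s : ℝ, s ≠ 0 → ∃ R, IsResolventAt B (Complex.I * s) R ∧
    ‖R‖ ≤ C * (min |s| 1) ^ (-α)

theorem InCrandallPazy.hasAxisBound [CompleteSpace H] (hT : IsC0Semigroup T)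
    (hA : IsGenerator T A) {β : ℝ} (hβ0 : 0 < β) (hβ1 : β ≤ 1) (h : InCrandallPazy T A β)
    (hres : ∀ η : ℝ, η ≠ 0 → ∃ R : H →L[ℂ] H, IsResolventAt A (Complex.I * η) R)
    {M δ : ℝ} (hM : 0 < M) (hδ : 0 < δ) (hzero : ∀ η : ℝ, η ≠ 0 → |η| ≤ δ →
      ∀ R : H →L[ℂ] H, IsResolventAt A (Complex.I * η) R → ‖R‖ ≤ M * |η| ^ (-(2 : ℝ))) :
    HasAxisBound A β := by
  obtain ⟨C, N, hC, hN, hinf⟩ := h.exists_norm_resolvent_le hT hA hβ0 hβ1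
  have hcpt : IsCompact {η : ℝ | min δ 1 ≤ |η| ∧ |η| ≤ N} := by
    refine Metric.isCompact_of_isClosed_isBounded ?_ ?_
    · exact (isClosed_le continuous_const continuous_abs).inter
        (isClosed_le continuous_abs continuous_const)
    · refine (Metric.isBounded_closedBall (x := (0 : ℝ)) (r := N)).subset fun η hη => ?_
      simpa using hη.2
  obtain ⟨K, hK⟩ := exists_norm_resolvent_le_of_mem_compact hcpt
    (fun η hη => hres η (abs_pos.1 ((lt_min hδ one_pos).trans_le hη.1)))
  have hN0 : 0 < N := by linarith
  refine ⟨C + M + |K| * N ^ β + |K|, by positivity, fun η hη => ?_⟩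
  obtain ⟨R, hR⟩ := hres η hη
  have hη0 : 0 < |η| := abs_pos.2 hη
  refine ⟨R, hR, fun h1 => ?_, fun h1 => ?_⟩
  · have hp : 0 ≤ |η| ^ (-β) := by positivity
    have hq : 0 ≤ |K| * N ^ β := by positivity
    rcases le_total N |η| with h2 | h2
    · refine (hinf η h2 R hR).trans ?_
      gcongr
      linarith [abs_nonneg K]
    · have hle : 1 ≤ N ^ β * |η| ^ (-β) := by
        rw [Real.rpow_neg hη0.le, ← div_eq_mul_inv, one_le_div (by positivity)]
        gcongr
      calc ‖R‖ ≤ |K| * 1 := by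
            rw [mul_one]
            exact (hK η ⟨(min_le_right _ _).trans h1, h2⟩ R hR).trans (le_abs_self K)
        _ ≤ |K| * (N ^ β * |η| ^ (-β)) := by gcongr
        _ = |K| * N ^ β * |η| ^ (-β) := by ring
        _ ≤ _ := by
          gcongr
          linarith [abs_nonneg K]
  · have hq : 0 ≤ |K| * N ^ β := by positivity
    rcases le_total |η| (min δ 1) with h2 | h2
    · refine (hzero η hη (h2.trans (min_le_left _ _)) R hR).trans ?_
      gcongr
      linarith [abs_nonneg K]
    · have hle : 1 ≤ |η| ^ (-(2 : ℝ)) :=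
        Real.one_le_rpow_of_pos_of_le_one_of_nonpos hη0 h1 (by norm_num)
      calc ‖R‖ ≤ |K| * 1 := by
            rw [mul_one]
            exact (hK η ⟨h2, h1.trans hN⟩ R hR).trans (le_abs_self K)
        _ ≤ |K| * |η| ^ (-(2 : ℝ)) := by gcongr
        _ ≤ _ := by
          gcongr
          linarith

theorem HasAxisBound.hasAxisBoundAtZero {β : ℝ} (hβ1 : β ≤ 1) (hinv : IsInversePMap A B)
    (h : HasAxisBound A β) : HasAxisBoundAtZero B (2 - β) := by
  obtain ⟨C, hC, h⟩ := h
  refine ⟨1 + C, by positivity, fun s hs => ?_⟩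
  have hs0 : 0 < |s| := abs_pos.2 hs
  obtain ⟨R, hR, h1, h2⟩ := h (-s⁻¹) (by simpa using hs)
  rw [abs_neg, abs_inv] at h1 h2
  have hw0 : Complex.I * ((-s⁻¹ : ℝ) : ℂ) ≠ 0 := by simpa using hs
  have hz : (Complex.I * ((-s⁻¹ : ℝ) : ℂ))⁻¹ = Complex.I * s := by
    push_cast
    rw [mul_inv, inv_neg, inv_inv, Complex.inv_I]
    ring
  have hR' := hinv.symm.isResolventAt_inv hw0 hR
  rw [hz] at hR'
  refine ⟨_, hR', (norm_smul_one_sub_smul_le _ _).trans ?_⟩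
  have hn : ‖Complex.I * ((-s⁻¹ : ℝ) : ℂ)‖ = |s|⁻¹ := by simp
  rw [hn]
  rcases le_total |s| 1 with hle | hle
  · have hi : 1 ≤ |s|⁻¹ := (one_le_inv₀ hs0).2 hle
    rw [min_eq_left hle, Real.rpow_neg hs0.le, ← Real.inv_rpow hs0.le]
    have h1 := h1 hi
    set r := |s|⁻¹
    have hr : 0 < r := by linarith
    have e1 : r * r * r ^ (-β) = r ^ (2 - β) := by
      rw [sub_eq_add_neg, Real.rpow_add hr, Real.rpow_two]; ring
    have e2 : r ≤ r ^ (2 - β) := by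
      conv_lhs => rw [← Real.rpow_one r]
      exact Real.rpow_le_rpow_of_exponent_le hi (by linarith)
    calc r * (1 + r * ‖R‖) ≤ r * (1 + r * (C * r ^ (-β))) := by gcongr
      _ = r + C * (r * r * r ^ (-β)) := by ring
      _ ≤ r ^ (2 - β) + C * r ^ (2 - β) := by rw [e1]; gcongr
      _ = _ := by ring
  · have hi : |s|⁻¹ ≤ 1 := inv_le_one_of_one_le₀ hle
    rw [min_eq_right hle, Real.one_rpow, mul_one]
    have h2 := h2 hi
    have hr : 0 < |s|⁻¹ := by positivity
    set r := |s|⁻¹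
    rw [Real.rpow_neg hr.le, Real.rpow_two] at h2
    calc r * (1 + r * ‖R‖) ≤ r * (1 + r * (C * (r ^ 2)⁻¹)) := by gcongr
      _ = r + C := by field_simp
      _ ≤ _ := by gcongr

theorem HasAxisBoundAtZero.hasAxisBound {β : ℝ} (hβ1 : β ≤ 1) (hinv : IsInversePMap A B)
    (h : HasAxisBoundAtZero B (2 - β)) : HasAxisBound A β := by
  obtain ⟨C, hC, h⟩ := h
  refine ⟨1 + C, by positivity, fun s hs => ?_⟩
  have hs0 : 0 < |s| := abs_pos.2 hs
  obtain ⟨R, hR, h1⟩ := h (-s⁻¹) (by simpa using hs)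
  rw [abs_neg, abs_inv] at h1
  have hw0 : Complex.I * ((-s⁻¹ : ℝ) : ℂ) ≠ 0 := by simpa using hs
  have hz : (Complex.I * ((-s⁻¹ : ℝ) : ℂ))⁻¹ = Complex.I * s := by
    push_cast
    rw [mul_inv, inv_neg, inv_inv, Complex.inv_I]
    ring
  have hR' := hinv.isResolventAt_inv hw0 hR
  rw [hz] at hR'
  have hn : ‖Complex.I * ((-s⁻¹ : ℝ) : ℂ)‖ = |s|⁻¹ := by simp
  have hle := norm_smul_one_sub_smul_le (Complex.I * ((-s⁻¹ : ℝ) : ℂ)) R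
  rw [hn] at hle
  have hr : 0 < |s|⁻¹ := by positivity
  refine ⟨_, hR', fun hs1 => hle.trans ?_, fun hs1 => hle.trans ?_⟩
  · have hi : |s|⁻¹ ≤ 1 := inv_le_one_of_one_le₀ hs1
    rw [min_eq_left hi] at h1
    rw [Real.rpow_neg hs0.le, ← Real.inv_rpow hs0.le]
    set r := |s|⁻¹
    have e1 : r * r * r ^ (-(2 - β)) = r ^ β := by
      have : β = 2 + -(2 - β) := by ring
      conv_rhs => rw [this, Real.rpow_add hr, Real.rpow_two]
      ring
    have e2 : r ≤ r ^ β := by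
      conv_lhs => rw [← Real.rpow_one r]
      exact Real.rpow_le_rpow_of_exponent_ge hr hi hβ1
    calc r * (1 + r * ‖R‖) ≤ r * (1 + r * (C * r ^ (-(2 - β)))) := by gcongr
      _ = r + C * (r * r * r ^ (-(2 - β))) := by ring
      _ ≤ r ^ β + C * r ^ β := by rw [e1]; gcongr
      _ = _ := by ring
  · have hi : 1 ≤ |s|⁻¹ := (one_le_inv₀ hs0).2 hs1
    rw [min_eq_right hi, Real.one_rpow, mul_one] at h1
    rw [Real.rpow_neg hs0.le, ← Real.inv_rpow hs0.le, Real.rpow_two]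
    set r := |s|⁻¹
    calc r * (1 + r * ‖R‖) ≤ r * (1 + r * C) := by gcongr
      _ = r + C * r ^ 2 := by ring
      _ ≤ r ^ 2 + C * r ^ 2 := by gcongr; nlinarith
      _ = _ := by ring

end InverseGenerator

section InverseDecay

variable {H : Type*} [NormedAddCommGroup H] [InnerProductSpace ℂ H]
variable {A B : H →ₗ.[ℂ] H} {T S : ℝ → H →L[ℂ] H}
variable {lam z : ℂ} {Rlam R : H →L[ℂ] H}

theorem IsInversePMap.commute_resolvent (hinv : IsInversePMap A B)
    (hRlam : IsResolventAt A lam Rlam) (hz : z ≠ 0) (hR : IsResolventAt B z R) :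
    R * Rlam = Rlam * R := by
  have h1 := hinv.isResolventAt_inv hz hR
  have h2 := h1.commute hRlam
  have h3 : (z * z) • (R * Rlam) = (z * z) • (Rlam * R) := by
    simp only [smul_mul_assoc, mul_smul_comm, sub_mul, mul_sub, one_mul, mul_one, smul_sub,
      smul_smul] at h2
    exact sub_right_injective h2
  exact smul_right_injective _ (mul_ne_zero hz hz) h3

theorem IsInversePMap.norm_resolvent_mul_le (hinv : IsInversePMap A B)
    (hRlam : IsResolventAt A lam Rlam) (hR : IsResolventAt B z R) :
    ‖R * Rlam‖ ≤ (1 + ‖lam‖ * ‖Rlam‖) * (1 + ‖z‖ * ‖R‖) := by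
  have e : R * Rlam = (1 - z • R) * (1 - lam • Rlam) := by
    ext x
    obtain ⟨hx, e⟩ := hRlam.1 x
    obtain ⟨hb, e2⟩ := hinv.1 ⟨Rlam x, hx⟩
    have h1 := hR.2 ⟨_, hb⟩
    rw [e2, map_add, map_smul] at h1
    have e3 : A ⟨Rlam x, hx⟩ = x - lam • Rlam x := eq_sub_of_add_eq' e
    simp only [e3] at h1
    have h2 := eq_sub_of_add_eq' h1
    simp only [mul_apply_eq_comp, sub_apply, smul_apply, one_apply_eq_self]
    exact h2
  have hone : ‖(1 : H →L[ℂ] H)‖ ≤ 1 := ContinuousLinearMap.norm_id_le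
  rw [e, mul_comm (1 + _)]
  refine (norm_mul_le _ _).trans ?_
  gcongr
  · refine (norm_sub_le _ _).trans ?_
    rw [norm_smul]
    gcongr
  · refine (norm_sub_le _ _).trans ?_
    rw [norm_smul]
    gcongr

/-- Polynomial decay of the semigroup generated by `-A⁻¹` on the domain of `A`. -/
theorem HasAxisBoundAtZero.exists_norm_mul_le [CompleteSpace H] (hinv : IsInversePMap A B)
    (hS : IsC0Semigroup S) (hB : IsGenerator S B) {C : ℝ} (hC1 : 1 ≤ C)
    (hC : ∀ t, 0 ≤ t → ‖S t‖ ≤ C) (hRlam : IsResolventAt A lam Rlam)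
    {α : ℝ} (hα : 1 ≤ α) (h : HasAxisBoundAtZero B α) :
    ∃ D : ℝ, ∀ t : ℝ, 1 ≤ t → ‖S t * Rlam‖ ≤ D * t ^ (-(1 / α)) := by
  obtain ⟨C₂, hC₂, h⟩ := h
  have hα0 : 0 < α := by linarith
  set c := 1 + ‖lam‖ * ‖Rlam‖ with hc
  have hc0 : 1 ≤ c := le_add_of_nonneg_right (by positivity)
  set C₃ := c * (1 + 2 * C + 2 * (1 + C) * C₂) + (1 + C) * C₂ * ‖Rlam‖ with hC₃
  have hC₃0 : 0 ≤ C₃ := by positivity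
  refine ⟨4 * C ^ 2 * Real.exp 2 * C₃, fun t ht => ?_⟩
  have ht0 : 0 < t := by linarith
  set ε := t ^ (-(1 / α)) with hε
  have hε0 : 0 < ε := by positivity
  have hε1 : ε ≤ 1 := Real.rpow_le_one_of_one_le_of_nonpos ht (by simp; positivity)
  have hεα : ε ^ α = t⁻¹ := by
    rw [hε, ← Real.rpow_mul ht0.le]
    have : -(1 / α) * α = -1 := by field_simp
    rw [this, Real.rpow_neg_one]
  have htε : t⁻¹ ≤ ε := by
    rw [← hεα]
    conv_rhs => rw [← Real.rpow_one ε]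
    exact Real.rpow_le_rpow_of_exponent_ge hε0 hε1 hα
  have hεα' : ε * ε ^ (-α) = ε ^ (1 - α) := by
    rw [sub_eq_add_neg, Real.rpow_add hε0, Real.rpow_one]
  have hone : 1 ≤ ε ^ (1 - α) :=
    Real.one_le_rpow_of_pos_of_le_one_of_nonpos hε0 hε1 (by linarith)
  have hre : ∀ s : ℝ, ((t⁻¹ : ℝ) + s * Complex.I : ℂ).re = t⁻¹ := fun s => by simp
  have hex : ∀ s : ℝ, ∃ R, IsResolventAt B ((t⁻¹ : ℝ) + s * Complex.I) R ∧ ‖R‖ ≤ C * t := by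
    intro s
    obtain ⟨R, hR, hRn⟩ := exists_isResolventAt_of_semigroup hS hB (M := C) (ω := 0)
      (z := (t⁻¹ : ℝ) + s * Complex.I) (by simpa using hC) (by rw [hre]; positivity)
    refine ⟨R, hR, hRn.trans_eq ?_⟩
    rw [hre, sub_zero, div_inv_eq_mul]
  choose R hR hRn using hex
  have hzn : ∀ s : ℝ, ‖((t⁻¹ : ℝ) + s * Complex.I : ℂ)‖ ≤ t⁻¹ + |s| := fun s => by
    refine (norm_add_le _ _).trans_eq ?_
    simp [abs_of_pos ht0]
  have haxis : ∀ s : ℝ, s ≠ 0 → ‖R s‖ ≤ (1 + C) * (C₂ * min |s| 1 ^ (-α)) := by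
    intro s hs
    obtain ⟨R₀, hR₀, hn⟩ := h s hs
    refine (hR₀.norm_le_mul (hR s) (D := C) ?_).trans (by gcongr)
    have : ‖Complex.I * s - ((t⁻¹ : ℝ) + s * Complex.I)‖ = t⁻¹ := by
      rw [show Complex.I * s - ((t⁻¹ : ℝ) + s * Complex.I) = -((t⁻¹ : ℝ) : ℂ) by ring, norm_neg,
        Complex.norm_real, Real.norm_of_nonneg (by positivity)]
    rw [this]
    calc t⁻¹ * ‖R s‖ ≤ t⁻¹ * (C * t) := by gcongr; exact hRn s
      _ = C := by field_simp
  have hK : ∀ s : ℝ, ‖R s * Rlam‖ ≤ C₃ * ε ^ (1 - α) := by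
    intro s
    have hgen := hinv.norm_resolvent_mul_le hRlam (hR s)
    rw [← hc] at hgen
    have hcase : ∀ K : ℝ, 0 ≤ K → K ≤ C + (1 + C) * C₂ →
        ‖((t⁻¹ : ℝ) + s * Complex.I : ℂ)‖ * ‖R s‖ ≤ 2 * K * ε ^ (1 - α) →
        ‖R s * Rlam‖ ≤ C₃ * ε ^ (1 - α) := by
      intro K hK0 hK1 hK2
      have h0 : 0 ≤ (1 + C) * C₂ * ‖Rlam‖ := by positivity
      calc ‖R s * Rlam‖ ≤ c * (ε ^ (1 - α) + 2 * K * ε ^ (1 - α)) := by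
            refine hgen.trans ?_
            gcongr
        _ = c * (1 + 2 * K) * ε ^ (1 - α) := by ring
        _ ≤ _ := by
          gcongr
          rw [hC₃]
          nlinarith
    rcases le_total |s| ε with h1 | h1
    · refine hcase C (by positivity) (by linarith [show 0 ≤ (1 + C) * C₂ by positivity]) ?_
      have h2 : t = ε ^ (-α) := by rw [Real.rpow_neg hε0.le, hεα, inv_inv]
      calc _ ≤ (ε + ε) * (C * t) := by
            gcongr
            · refine (hzn s).trans ?_
              gcongr
            · exact hRn s
        _ = 2 * C * (ε * ε ^ (-α)) := by rw [← h2]; ring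
        _ = _ := by rw [hεα']
    · have hs0 : 0 < |s| := by linarith
      have hs := haxis s (abs_pos.1 hs0)
      rcases le_total |s| 1 with h2 | h2
      · refine hcase ((1 + C) * C₂) (by positivity) (by linarith) ?_
        rw [min_eq_left h2] at hs
        have e1 : |s| * |s| ^ (-α) = |s| ^ (1 - α) := by
          rw [sub_eq_add_neg, Real.rpow_add hs0, Real.rpow_one]
        calc _ ≤ (|s| + |s|) * ((1 + C) * (C₂ * |s| ^ (-α))) := by
              gcongr
              refine (hzn s).trans ?_
              gcongr
              linarith
          _ = 2 * ((1 + C) * C₂) * (|s| * |s| ^ (-α)) := by ring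
          _ ≤ _ := by
            rw [e1]
            gcongr _ * ?_
            exact Real.rpow_le_rpow_of_nonpos hε0 h1 (by linarith)
      · rw [min_eq_right h2, Real.one_rpow, mul_one] at hs
        have h0 : 0 ≤ c * (1 + 2 * C + 2 * (1 + C) * C₂) := by positivity
        calc ‖R s * Rlam‖ ≤ (1 + C) * C₂ * ‖Rlam‖ * 1 := by
              rw [mul_one]
              refine (norm_mul_le _ _).trans ?_
              gcongr
          _ ≤ _ := by
            gcongr
            linarith
  refine ContinuousLinearMap.opNorm_le_bound _ (by positivity) fun x => ?_
  have hfin := norm_apply_le_of_resolvent_bound hS hB hC1 (ω := 0) le_rfl (by simpa using hC) ht0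
    (by simp) 1 R hR (K := C₃ * ε ^ (1 - α)) (by positivity) x (Rlam x) (fun s => ?_)
  · refine hfin.trans_eq ?_
    have : ε ^ (1 - α) * t⁻¹ = ε := by
      rw [← hεα, ← Real.rpow_add hε0]; simp
    calc _ = 4 * C ^ 2 * Real.exp 2 * C₃ * (ε ^ (1 - α) * t⁻¹) * ‖x‖ := by
          simp only [Nat.factorial_one, Nat.cast_one, pow_one]; ring
      _ = _ := by rw [this]
  · have hz0 : ((t⁻¹ : ℝ) + s * Complex.I : ℂ) ≠ 0 := fun h0 => by
      have := hre s
      rw [h0, Complex.zero_re] at this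
      exact (inv_pos.2 ht0).ne this
    have hcomm := hinv.commute_resolvent hRlam hz0 (hR s)
    have e : (R s ^ (1 + 1)) (Rlam x) = (R s * Rlam) (R s x) := by
      have : R s ^ (1 + 1) * Rlam = R s * Rlam * R s := by
        rw [pow_succ, pow_one, mul_assoc, hcomm, ← mul_assoc, hcomm]
      exact congrArg (fun L : H →L[ℂ] H => L x) this
    rw [e]
    exact (R s * Rlam).le_of_opNorm_le (hK s) _

end InverseDecay

section DecayToResolvent

variable {H : Type*} [NormedAddCommGroup H] [InnerProductSpace ℂ H]
variable {A B : H →ₗ.[ℂ] H} {T S : ℝ → H →L[ℂ] H}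
variable {lam : ℂ} {Rlam : H →L[ℂ] H}

/-- Decay on the domain of `A` bounds `z + A⁻¹` from below in the closed right half-plane. -/
theorem IsInversePMap.exists_lower_bound_of_decay [CompleteSpace H] (hinv : IsInversePMap A B)
    (hS : IsC0Semigroup S) (hB : IsGenerator S B) {C : ℝ} (hC1 : 1 ≤ C)
    (hC : ∀ t, 0 ≤ t → ‖S t‖ ≤ C) (hRlam : IsResolventAt A lam Rlam)
    {α : ℝ} (hα : 1 ≤ α) {K t₁ : ℝ} (hK : 0 ≤ K) (ht₁ : 0 < t₁)
    (hdecay : ∀ t, t₁ ≤ t → ‖S t * Rlam‖ ≤ K * t ^ (-(1 / α))) :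
    ∃ D : ℝ, 0 ≤ D ∧ ∀ z : ℂ, 0 ≤ z.re → z ≠ 0 → ∀ x : B.domain,
      ‖(x : H)‖ ≤ D * min ‖z‖ 1 ^ (-α) * ‖z • (x : H) + B x‖ := by
  have hα0 : 0 < α := by linarith
  set c := 1 + ‖lam‖ * ‖Rlam‖ with hc
  have hc0 : 0 ≤ c := by positivity
  set D := max t₁ ((2 * (K * (1 + ‖lam‖))) ^ α) with hD
  have hD0 : 0 < D := ht₁.trans_le (le_max_left _ _)
  have hDα : K * (1 + ‖lam‖) * D ^ (-(1 / α)) ≤ 1 / 2 := by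
    have h1 : 2 * (K * (1 + ‖lam‖)) ≤ D ^ (1 / α) := by
      calc 2 * (K * (1 + ‖lam‖)) = ((2 * (K * (1 + ‖lam‖))) ^ α) ^ (1 / α) := by
            rw [← Real.rpow_mul (by positivity), mul_one_div_cancel hα0.ne', Real.rpow_one]
        _ ≤ _ := by
          gcongr
          exact le_max_right _ _
    rw [Real.rpow_neg hD0.le, ← div_eq_mul_inv, div_le_iff₀ (by positivity)]
    linarith
  refine ⟨2 * C * (D + c), by positivity, fun z hz hz0 x => ?_⟩
  have hzn : 0 < ‖z‖ := norm_pos_iff.2 hz0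
  set r := min ‖z‖ 1 with hr
  have hr0 : 0 < r := lt_min hzn one_pos
  have hr1 : r ≤ 1 := min_le_right _ _
  have hrz : ‖z‖⁻¹ ≤ r⁻¹ := by gcongr; exact min_le_left _ _
  have hrα : 1 ≤ r ^ (-α) := Real.one_le_rpow_of_pos_of_le_one_of_nonpos hr0 hr1 (by linarith)
  have hrα' : r⁻¹ ≤ r ^ (-α) := by
    rw [← Real.rpow_neg_one]
    exact Real.rpow_le_rpow_of_exponent_ge hr0 hr1 (by linarith)
  set t := D * r ^ (-α) with ht
  have ht0 : 0 < t := by positivity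
  have htt₁ : t₁ ≤ t := by
    calc t₁ ≤ D * 1 := by rw [mul_one]; exact le_max_left _ _
      _ ≤ t := by rw [ht]; gcongr
  have htα : t ^ (-(1 / α)) = D ^ (-(1 / α)) * r := by
    rw [ht, Real.mul_rpow hD0.le (by positivity), ← Real.rpow_mul hr0.le]
    have : -α * -(1 / α) = 1 := by field_simp
    rw [this, Real.rpow_one]
  set y := z • (x : H) + B x with hy
  have h1 := norm_le_of_truncated_laplace hS hB ht0.le (fun τ h0 _ => hC τ h0) hz x
  rw [← hy] at h1
  have e1 : z • (x : H) = y - lam • Rlam y - (1 - lam * z) • Rlam x := by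
    obtain ⟨hb, e⟩ := hinv.2 x
    have h2 := hRlam.2 ⟨B x, hb⟩
    simp only [e] at h2
    have e3 : B x = y - z • (x : H) := by rw [hy]; abel
    rw [e3] at h2
    simp only [map_add, map_sub, map_smul] at h2
    have e4 : z • (x : H) = y - (lam • (Rlam y - z • Rlam x) + Rlam x) := by rw [h2]; abel
    rw [e4]
    module
  have h2 : ‖z‖ * ‖S t x‖ ≤ C * c * ‖y‖ + (1 + ‖lam‖ * ‖z‖) * (K * t ^ (-(1 / α))) * ‖(x : H)‖ := by
    have e5 : z • S t x = S t (y - lam • Rlam y) - (1 - lam * z) • (S t * Rlam) x := by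
      rw [← map_smul, e1, map_sub (S t) (y - lam • Rlam y), map_smul]
      rfl
    rw [← norm_smul, e5]
    refine (norm_sub_le _ _).trans (add_le_add ?_ ?_)
    · rw [mul_assoc]
      refine (S t).le_of_opNorm_le_of_le (hC t ht0.le) ?_
      calc ‖y - lam • Rlam y‖ ≤ ‖y‖ + ‖lam‖ * (‖Rlam‖ * ‖y‖) := by
            refine (norm_sub_le _ _).trans ?_
            rw [norm_smul]
            gcongr
            exact Rlam.le_opNorm y
        _ = c * ‖y‖ := by rw [hc]; ring
    · rw [norm_smul, mul_assoc]
      gcongr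
      · refine (norm_sub_le _ _).trans ?_
        simp
      · exact (S t * Rlam).le_of_opNorm_le (hdecay t htt₁) _
  have h3 : ‖S t x‖ ≤ r ^ (-α) * (C * c * ‖y‖) + 1 / 2 * ‖(x : H)‖ := by
    have h4 : ‖S t x‖ ≤ ‖z‖⁻¹ * (C * c * ‖y‖) +
        (‖z‖⁻¹ + ‖lam‖) * (K * t ^ (-(1 / α))) * ‖(x : H)‖ := by
      rw [← mul_le_mul_iff_right₀ hzn]
      refine h2.trans_eq ?_
      field_simp
    refine h4.trans ?_
    gcongr
    · exact hrz.trans hrα'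
    · have h5 : ‖z‖⁻¹ + ‖lam‖ ≤ (1 + ‖lam‖) * r⁻¹ := by
        have : 1 ≤ r⁻¹ := (one_le_inv₀ hr0).2 hr1
        nlinarith [norm_nonneg lam]
      calc _ ≤ (1 + ‖lam‖) * r⁻¹ * (K * (D ^ (-(1 / α)) * r)) := by rw [htα]; gcongr
        _ = K * (1 + ‖lam‖) * D ^ (-(1 / α)) := by field_simp
        _ ≤ _ := hDα
  have e6 : 2 * C * (D + c) * r ^ (-α) * ‖y‖ =
      2 * (C * t * ‖y‖) + 2 * (r ^ (-α) * (C * c * ‖y‖)) := by rw [ht]; ring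
  rw [e6]
  linarith

theorem hasAxisBoundAtZero_of_lower_bound [CompleteSpace H]
    (hS : IsC0Semigroup S) (hB : IsGenerator S B) {C : ℝ}
    (hC : ∀ t, 0 ≤ t → ‖S t‖ ≤ C) {α D : ℝ} (hα : 0 ≤ α) (hD : 0 ≤ D)
    (h : ∀ z : ℂ, 0 ≤ z.re → z ≠ 0 → ∀ x : B.domain,
      ‖(x : H)‖ ≤ D * min ‖z‖ 1 ^ (-α) * ‖z • (x : H) + B x‖) :
    HasAxisBoundAtZero B α := by
  refine ⟨D, hD, fun s hs => ?_⟩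
  have hs0 : 0 < |s| := abs_pos.2 hs
  have hm0 : 0 < min |s| 1 := lt_min hs0 one_pos
  set K := D * min |s| 1 ^ (-α) with hK
  have hK0 : 0 ≤ K := by positivity
  set ε := (2 * (K + 1))⁻¹ with hε
  have hε0 : 0 < ε := by positivity
  have hre : (ε + Complex.I * s : ℂ).re = ε := by simp
  have him : (ε + Complex.I * s : ℂ).im = s := by simp
  have hz0 : (ε + Complex.I * s : ℂ) ≠ 0 := fun h0 => hε0.ne' (by rw [← hre, h0, Complex.zero_re])
  obtain ⟨R, hR, -⟩ := exists_isResolventAt_of_semigroup hS hB (M := C) (ω := 0)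
    (z := ε + Complex.I * s) (by simpa using hC) (by rw [hre]; exact hε0)
  have hRn : ‖R‖ ≤ K := by
    refine hR.norm_le_of_lower_bound hK0 fun x => (h _ (by rw [hre]; exact hε0.le) hz0 x).trans ?_
    gcongr ?_ * _
    rw [hK]
    gcongr _ * ?_
    refine Real.rpow_le_rpow_of_nonpos hm0 ?_ (by linarith)
    gcongr
    have := Complex.abs_im_le_norm (ε + Complex.I * s)
    rwa [him] at this
  obtain ⟨R', hR'⟩ := hR.exists_of_norm_lt (w := Complex.I * s) (by
    have : ‖Complex.I * s - (ε + Complex.I * s)‖ = ε := by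
      rw [show Complex.I * s - (ε + Complex.I * s) = -((ε : ℝ) : ℂ) by ring, norm_neg,
        Complex.norm_real, Real.norm_of_nonneg hε0.le]
    rw [this]
    calc ε * ‖R‖ ≤ ε * K := by gcongr
      _ < 1 := by
        rw [hε, inv_mul_lt_iff₀ (by positivity)]
        linarith)
  refine ⟨R', hR', hR'.norm_le_of_lower_bound hK0 fun x => ?_⟩
  have := h (Complex.I * s) (by simp) (by simpa using hs) x
  rwa [show ‖Complex.I * (s : ℂ)‖ = |s| by simp] at this

end DecayToResolvent

section ResolventToCrandallPazy

variable {H : Type*} [NormedAddCommGroup H] [InnerProductSpace ℂ H]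
variable {A B : H →ₗ.[ℂ] H} {T S : ℝ → H →L[ℂ] H}
variable {lam : ℂ} {Rlam : H →L[ℂ] H}

theorem IsGenerator.dense_domain (hT : IsC0Semigroup T) (hA : IsGenerator T A)
    (hR : IsResolventAt A lam Rlam) : Dense (A.domain : Set H) := by
  intro x
  obtain ⟨hV, e⟩ := hR.1 x
  set V : A.domain := ⟨Rlam x, hV⟩ with hVdef
  have hlim : Tendsto (fun h : ℝ => lam • (V : H) - (h : ℂ)⁻¹ • (T h (V : H) - (V : H)))
      (𝓝[>] 0) (𝓝 x) := by
    have := (hA.2 V).const_sub (lam • (V : H))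
    rwa [sub_neg_eq_add, show lam • (V : H) + A V = x from e] at this
  refine mem_closure_of_tendsto hlim ?_
  filter_upwards [self_mem_nhdsWithin] with h hh
  obtain ⟨hm, -⟩ := hA.map_mem_domain hT V (le_of_lt hh)
  exact A.domain.sub_mem (A.domain.smul_mem _ V.2)
    (A.domain.smul_mem _ (A.domain.sub_mem hm V.2))

theorem IsGenerator.exists_clm_of_bound [CompleteSpace H] (hT : IsC0Semigroup T)
    (hA : IsGenerator T A) (hR : IsResolventAt A lam Rlam) {t K : ℝ} (ht : 0 ≤ t) (hK : 0 ≤ K)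
    (h : ∀ x : A.domain, ‖T t (A x)‖ ≤ K * ‖(x : H)‖) :
    ∃ E : H →L[ℂ] H, ‖E‖ ≤ K ∧
      ∀ x : H, ∃ hx : T t x ∈ A.domain, E x = A ⟨T t x, hx⟩ := by
  have hdense := hA.dense_domain hT hR
  let f : A.domain →L[ℂ] H := LinearMap.mkContinuous ((T t : H →ₗ[ℂ] H) ∘ₗ A.toFun) K h
  have hdr : DenseRange A.domain.subtypeL := by
    simpa [DenseRange] using hdense
  have hui : IsUniformInducing A.domain.subtypeL := isUniformInducing_val _
  set E := f.extend A.domain.subtypeL with hE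
  have hEx : ∀ x : A.domain, E x = T t (A x) := fun x =>
    ContinuousLinearMap.extend_eq f hdr hui x
  refine ⟨E, ?_, fun x => ?_⟩
  · refine E.opNorm_le_bound hK ?_
    refine fun x => hdense.induction (P := fun x => ‖E x‖ ≤ K * ‖x‖) ?_ ?_ x
    · intro x hx
      rw [hEx ⟨x, hx⟩]
      exact h ⟨x, hx⟩
    · exact isClosed_le (by fun_prop) (by fun_prop)
  · have key : Rlam (lam • T t x + E x) = T t x := by
      refine hdense.induction (P := fun x => Rlam (lam • T t x + E x) = T t x) ?_ ?_ x
      · intro x hx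
        obtain ⟨hm, e⟩ := hA.map_mem_domain hT ⟨x, hx⟩ ht
        rw [hEx ⟨x, hx⟩, ← e]
        exact hR.2 ⟨T t x, hm⟩
      · exact isClosed_eq (by fun_prop) (by fun_prop)
    obtain ⟨hm, e⟩ := hR.1 (lam • T t x + E x)
    have hm' : T t x ∈ A.domain := by rwa [key] at hm
    refine ⟨hm', ?_⟩
    have e1 : (⟨Rlam (lam • T t x + E x), hm⟩ : A.domain) = ⟨T t x, hm'⟩ := Subtype.ext key
    rw [e1, key] at e
    exact (add_left_cancel e).symm

theorem inCrandallPazy_of_bound [CompleteSpace H] (hT : IsC0Semigroup T)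
    (hA : IsGenerator T A) (hR : IsResolventAt A lam Rlam) {β K t₀ : ℝ} (hK : 0 < K)
    (ht₀ : 0 < t₀) (h : ∀ t, 0 < t → t ≤ t₀ → ∀ x : A.domain,
      ‖T t (A x)‖ ≤ K * t ^ (-(1 / β)) * ‖(x : H)‖) : InCrandallPazy T A β := by
  have hex : ∀ t : ℝ, ∃ E : H →L[ℂ] H, 0 < t →
      (∀ x : H, ∃ hx : T t x ∈ A.domain, E x = A ⟨T t x, hx⟩) ∧
      (t ≤ t₀ → ‖E‖ ≤ K * t ^ (-(1 / β))) := by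
    intro t
    rcases le_or_gt t 0 with ht | ht
    · exact ⟨0, fun h0 => absurd h0 ht.not_gt⟩
    rcases le_total t t₀ with hle | hle
    · obtain ⟨E, hE, hE'⟩ := hA.exists_clm_of_bound hT hR ht.le (by positivity) (h t ht hle)
      exact ⟨E, fun _ => ⟨hE', fun _ => hE⟩⟩
    · obtain ⟨E, hE, hE'⟩ := hA.exists_clm_of_bound hT hR ht₀.le (by positivity) (h t₀ ht₀ le_rfl)
      rcases eq_or_lt_of_le hle with rfl | hlt
      · exact ⟨E, fun _ => ⟨hE', fun _ => hE⟩⟩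
      refine ⟨T (t - t₀) ∘L E, fun _ => ⟨fun x => ?_, fun h0 => absurd h0 hlt.not_ge⟩⟩
      obtain ⟨hx, e⟩ := hE' x
      obtain ⟨hm, e2⟩ := hA.map_mem_domain hT ⟨_, hx⟩ (sub_nonneg.2 hle)
      have e3 : T t x = T (t - t₀) (T t₀ x) := by
        have := hT.map_add (t - t₀) t₀ (sub_nonneg.2 hle) ht₀.le
        rw [sub_add_cancel] at this
        rw [this]; rfl
      have hm' : T t x ∈ A.domain := by rw [e3]; exact hm
      refine ⟨hm', ?_⟩
      have e4 : (⟨T t x, hm'⟩ : A.domain) = ⟨T (t - t₀) (T t₀ x), hm⟩ := Subtype.ext e3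
      rw [e4, e2, ContinuousLinearMap.comp_apply, e]
  choose E hE using hex
  exact ⟨E, fun t ht => (hE t ht).1, K, t₀, hK, ht₀, fun t ht => (hE t ht).2⟩

theorem HasAxisBound.inCrandallPazy [CompleteSpace H] (hT : IsC0Semigroup T)
    (hA : IsGenerator T A) (hRlam : IsResolventAt A lam Rlam) {C : ℝ} (hC0 : 0 ≤ C)
    (hC : ∀ w : ℂ, 0 < w.re → ∃ R, IsResolventAt A w R ∧ ‖R‖ ≤ C / w.re)
    {β : ℝ} (hβ0 : 0 < β) (hβ1 : β ≤ 1) (h : HasAxisBound A β) : InCrandallPazy T A β := by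
  obtain ⟨C', hC', h⟩ := h
  obtain ⟨M, ω, hM1, hω, hM⟩ := hT.exists_norm_le_exp
  obtain ⟨j, hj⟩ : ∃ j : ℕ, 1 ≤ β * (j + 1) := by
    obtain ⟨j, hj⟩ := exists_nat_ge (1 / β)
    refine ⟨j, ?_⟩
    rw [div_le_iff₀ hβ0] at hj
    linarith
  set C₆ := C + (1 + C) * C' + 1 with hC₆
  have hC₆0 : 0 < C₆ := by positivity
  set C₇ := C₆ ^ j + 2 * C₆ ^ (j + 1) with hC₇
  have hC₇0 : 0 < C₇ := by positivity
  refine inCrandallPazy_of_bound hT hA hRlam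
    (K := 2 * M ^ 2 * (j + 1).factorial * Real.exp 2 * 2 ^ (j + 1) * C₇)
    (t₀ := min 1 (2 * (ω + 1))⁻¹) (by positivity) (by positivity) fun t ht htle x => ?_
  have ht1 : t ≤ 1 := htle.trans (min_le_left _ _)
  have hωt : ω * t ≤ 1 / 2 := by
    have h1 : t ≤ (2 * (ω + 1))⁻¹ := htle.trans (min_le_right _ _)
    calc ω * t ≤ (ω + 1) * (2 * (ω + 1))⁻¹ := by gcongr; linarith
      _ = 1 / 2 := by field_simp
  set N := t ^ (-(1 / β)) with hN
  have hN0 : 0 < N := by positivity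
  have hN1 : 1 ≤ N := Real.one_le_rpow_of_pos_of_le_one_of_nonpos ht ht1 (by simp; positivity)
  have hNβ : N ^ (-β) = t := by
    rw [hN, ← Real.rpow_mul ht.le]
    have : -(1 / β) * -β = 1 := by field_simp
    rw [this, Real.rpow_one]
  have htN : t⁻¹ ≤ N := by
    rw [← Real.rpow_neg_one, hN]
    refine Real.rpow_le_rpow_of_exponent_ge ht ht1 ?_
    rw [neg_le_neg_iff]
    exact (one_le_div hβ0).2 hβ1
  have hre : ∀ s : ℝ, ((t⁻¹ : ℝ) + s * Complex.I : ℂ).re = t⁻¹ := fun s => by simp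
  have hex : ∀ s : ℝ, ∃ R, IsResolventAt A ((t⁻¹ : ℝ) + s * Complex.I) R ∧ ‖R‖ ≤ C * t := by
    intro s
    obtain ⟨R, hR, hRn⟩ := hC ((t⁻¹ : ℝ) + s * Complex.I) (by rw [hre]; positivity)
    refine ⟨R, hR, hRn.trans_eq ?_⟩
    rw [hre, div_inv_eq_mul]
  choose R hR hRn using hex
  have hzn : ∀ s : ℝ, ‖((t⁻¹ : ℝ) + s * Complex.I : ℂ)‖ ≤ t⁻¹ + |s| := fun s => by
    refine (norm_add_le _ _).trans_eq ?_
    simp [abs_of_pos ht]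
  have hRμ : ∀ s, ‖R s‖ ≤ C₆ * max N |s| ^ (-β) := by
    intro s
    have h0 : 0 ≤ (1 + C) * C' := by positivity
    rcases le_total |s| N with h1 | h1
    · rw [max_eq_left h1, hNβ]
      refine (hRn s).trans ?_
      gcongr
      linarith
    · rw [max_eq_right h1]
      have hs0 : 0 < |s| := by linarith
      obtain ⟨R₀, hR₀, h2, -⟩ := h s (abs_pos.1 hs0)
      have h2 := h2 (hN1.trans h1)
      have h3 : ‖R s‖ ≤ (1 + C) * ‖R₀‖ := by
        refine hR₀.norm_le_mul (hR s) ?_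
        have : ‖Complex.I * s - ((t⁻¹ : ℝ) + s * Complex.I)‖ = t⁻¹ := by
          rw [show Complex.I * s - ((t⁻¹ : ℝ) + s * Complex.I) = -((t⁻¹ : ℝ) : ℂ) by ring,
            norm_neg, Complex.norm_real, Real.norm_of_nonneg (by positivity)]
        rw [this]
        calc t⁻¹ * ‖R s‖ ≤ t⁻¹ * (C * t) := by gcongr; exact hRn s
          _ = C := by field_simp
      calc ‖R s‖ ≤ (1 + C) * (C' * |s| ^ (-β)) := by refine h3.trans ?_; gcongr
        _ = (1 + C) * C' * |s| ^ (-β) := by ring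
        _ ≤ _ := by
          gcongr
          linarith
  have hfin := norm_apply_le_of_resolvent_bound hT hA hM1 hω hM ht hωt (j + 1) R hR
    (K := C₇ * N ^ (1 - β * (j + 1))) (by positivity) x (A x) (fun s => ?_)
  · refine hfin.trans_eq ?_
    have e : N ^ (1 - β * (j + 1)) * (t ^ (j + 1))⁻¹ = N := by
      have e1 : N ^ (1 - β * (j + 1)) = N * t ^ (j + 1) := by
        rw [show 1 - β * ((j : ℝ) + 1) = 1 + -β * ((j + 1 : ℕ) : ℝ) by push_cast; ring,
          Real.rpow_add hN0, Real.rpow_one, Real.rpow_mul hN0.le, hNβ, Real.rpow_natCast]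
      rw [e1]
      field_simp
    calc _ = 2 * M ^ 2 * (j + 1).factorial * Real.exp 2 * 2 ^ (j + 1) * C₇ *
          (N ^ (1 - β * (j + 1)) * (t ^ (j + 1))⁻¹) * ‖(x : H)‖ := by ring
      _ = _ := by rw [e]
  · set μ := max N |s| with hμ
    have hμN : N ≤ μ := le_max_left _ _
    have hμ1 : 1 ≤ μ := hN1.trans hμN
    have hμ0 : 0 < μ := by linarith
    set z : ℂ := (t⁻¹ : ℝ) + s * Complex.I with hz
    have hzμ : ‖z‖ ≤ 2 * μ := by
      have := hzn s
      have h1 : |s| ≤ μ := le_max_right _ _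
      rw [← hz] at this
      linarith
    have e1 : R s (A x) = x - z • R s x := by
      have := (hR s).2 x
      rw [map_add, map_smul] at this
      exact eq_sub_of_add_eq' this
    have e2 : (R s ^ (j + 1 + 1)) (A x) = (R s ^ j) (R s x) - z • (R s ^ (j + 1)) (R s x) := by
      rw [pow_succ, mul_apply_eq_comp, e1, map_sub, map_smul, pow_succ, mul_apply_eq_comp]
    have hpow : ∀ n : ℕ, ‖R s ^ n‖ ≤ C₆ ^ n * μ ^ (-β * n) := by
      intro n
      have h1 : ‖R s ^ n‖ ≤ ‖R s‖ ^ n := by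
        rcases Nat.eq_zero_or_pos n with rfl | hn
        · rw [pow_zero, pow_zero]
          exact ContinuousLinearMap.norm_id_le
        · exact norm_pow_le' _ hn
      calc ‖R s ^ n‖ ≤ (C₆ * μ ^ (-β)) ^ n := h1.trans (by gcongr; exact hRμ s)
        _ = _ := by rw [mul_pow, Real.rpow_mul hμ0.le, Real.rpow_natCast]
    have hb : ‖R s ^ j‖ + ‖z‖ * ‖R s ^ (j + 1)‖ ≤ C₇ * N ^ (1 - β * (j + 1)) := by
      have h1 : μ ^ (-β * j) ≤ μ ^ (1 - β * (j + 1)) :=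
        Real.rpow_le_rpow_of_exponent_le hμ1 (by linarith)
      have h2 : μ * μ ^ (-β * (j + 1 : ℕ)) = μ ^ (1 - β * (j + 1)) := by
        rw [show 1 - β * ((j : ℝ) + 1) = 1 + -β * ((j + 1 : ℕ) : ℝ) by push_cast; ring,
          Real.rpow_add hμ0, Real.rpow_one]
      calc _ ≤ C₆ ^ j * μ ^ (-β * j) + 2 * μ * (C₆ ^ (j + 1) * μ ^ (-β * (j + 1 : ℕ))) := by
            gcongr
            · exact hpow j
            · exact hpow (j + 1)
        _ = C₆ ^ j * μ ^ (-β * j) + 2 * C₆ ^ (j + 1) * (μ * μ ^ (-β * (j + 1 : ℕ))) := by ring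
        _ ≤ C₆ ^ j * μ ^ (1 - β * (j + 1)) + 2 * C₆ ^ (j + 1) * μ ^ (1 - β * (j + 1)) := by
          rw [h2]; gcongr
        _ = C₇ * μ ^ (1 - β * (j + 1)) := by rw [hC₇]; ring
        _ ≤ _ := by
          gcongr _ * ?_
          exact Real.rpow_le_rpow_of_nonpos hN0 hμN (by linarith)
    rw [e2]
    calc _ ≤ ‖R s ^ j‖ * ‖R s x‖ + ‖z‖ * (‖R s ^ (j + 1)‖ * ‖R s x‖) := by
          refine (norm_sub_le _ _).trans ?_
          rw [norm_smul]
          gcongr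
          · exact (R s ^ j).le_opNorm _
          · exact (R s ^ (j + 1)).le_opNorm _
      _ = (‖R s ^ j‖ + ‖z‖ * ‖R s ^ (j + 1)‖) * ‖R s x‖ := by ring
      _ ≤ _ := by gcongr

end ResolventToCrandallPazy

end Auxiliary

open Asymptotics in
/-- Proposition 4.4: let `-A` generate a `C₀`-semigroup `T` on a Hilbert space, let `A` be
injective, and let `-A⁻¹` generate a bounded `C₀`-semigroup `S`.  Fix `β ∈ (0,1]` and
`λ ∈ ρ(-A)` (with resolvent `Rλ = (λ + A)⁻¹`).  Then the following are equivalent: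
(i) `T` is in the Crandall–Pazy class with parameter `β`, `σ(A) ∩ iℝ ⊆ {0}`, and
`‖(iη + A)⁻¹‖ = O(|η|⁻²)` as `η → 0`;
(ii) `‖e^{-tA⁻¹} (λ + A)⁻¹‖ = O(t^{-1/(2-β)})` as `t → ∞`. -/
theorem crandallPazy_iff_inverse_decay_general
    {H : Type*} [NormedAddCommGroup H] [InnerProductSpace ℂ H] [CompleteSpace H]
    (T : ℝ → H →L[ℂ] H) (A : H →ₗ.[ℂ] H)
    (hT : IsC0Semigroup T) (hgen : IsGenerator T A)
    (hinj : ∀ x : A.domain, A x = 0 → (x : H) = 0)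
    (Ainv : H →ₗ.[ℂ] H) (hinv : IsInversePMap A Ainv)
    (S : ℝ → H →L[ℂ] H) (hS : IsC0Semigroup S) (hSgen : IsGenerator S Ainv)
    (hSbdd : ∃ C : ℝ, ∀ t : ℝ, 0 ≤ t → ‖S t‖ ≤ C)
    (β : ℝ) (hβ0 : 0 < β) (hβ1 : β ≤ 1)
    (lam : ℂ) (Rlam : H →L[ℂ] H) (hRlam : IsResolventAt A lam Rlam) :
    (InCrandallPazy T A β ∧
        (∀ η : ℝ, η ≠ 0 → ∃ R : H →L[ℂ] H, IsResolventAt A (Complex.I * η) R) ∧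
        ∃ M δ : ℝ, 0 < M ∧ 0 < δ ∧ ∀ η : ℝ, η ≠ 0 → |η| ≤ δ →
          ∀ R : H →L[ℂ] H, IsResolventAt A (Complex.I * η) R →
            ‖R‖ ≤ M * |η| ^ (-(2 : ℝ))) ↔
      (fun t : ℝ => ‖S t * Rlam‖) =O[atTop] fun t : ℝ => t ^ (-(1 / (2 - β))) := by
  obtain ⟨C₀, hC₀⟩ := hSbdd
  have hC : ∀ t, 0 ≤ t → ‖S t‖ ≤ max C₀ 1 := fun t ht => (hC₀ t ht).trans (le_max_left _ _)
  have hC1 : 1 ≤ max C₀ 1 := le_max_right _ _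
  constructor
  · rintro ⟨hCP, hres, M, δ, hM, hδ, hzero⟩
    obtain ⟨D, hD⟩ := ((hCP.hasAxisBound hT hgen hβ0 hβ1 hres hM hδ hzero).hasAxisBoundAtZero
      hβ1 hinv).exists_norm_mul_le hinv hS hSgen hC1 hC hRlam (by linarith)
    refine IsBigO.of_bound D ?_
    filter_upwards [eventually_ge_atTop 1] with t ht
    rw [norm_norm, Real.norm_of_nonneg (by positivity)]
    exact hD t ht
  · intro hO
    obtain ⟨K, hK, hO⟩ := hO.exists_pos
    obtain ⟨t₁, ht₁⟩ := eventually_atTop.1 hO.bound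
    obtain ⟨D, hD, hlow⟩ := hinv.exists_lower_bound_of_decay hS hSgen hC1 hC hRlam
      (α := 2 - β) (by linarith) hK.le (t₁ := max t₁ 1) (by positivity) (fun t ht => by
        have h := ht₁ t ((le_max_left _ _).trans ht)
        have ht0 : 0 < t := one_pos.trans_le ((le_max_right _ _).trans ht)
        rwa [norm_norm, Real.norm_of_nonneg (by positivity)] at h)
    have hA := (hasAxisBoundAtZero_of_lower_bound hS hSgen hC (by linarith) hD hlow).hasAxisBound
      hβ1 hinv
    refine ⟨hA.inCrandallPazy hT hgen hRlam (C := 1 + max C₀ 1) (by positivity)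
      (fun w hw => hinv.exists_isResolventAt hS hSgen hC hw) hβ0 hβ1, ?_⟩
    obtain ⟨C', hC', hA⟩ := hA
    refine ⟨fun η hη => ?_, C' + 1, 1, by positivity, one_pos, fun η hη hη1 R hR => ?_⟩
    · obtain ⟨R, hR, -⟩ := hA η hη
      exact ⟨R, hR⟩
    · obtain ⟨R', hR', -, hle⟩ := hA η hη
      rw [hR.unique hR']
      refine (hle hη1).trans ?_
      gcongr
      linarith

end
end

section
/- Let −A be the generator of a C₀-semigroup (e^{-tA})_{t≥0} on a complex Hilbert space H such that σ(A) ∩ iℝ = ∅. Let ω ∈ ρ(−A) ∩ (0,∞) and assume sup_{n∈ℕ₀} ‖V_ω(A)^n‖ < ∞. Then for a fixed β ∈ (0,1] the following are equivalent: (i) (e^{-tA})_{t≥0} is in the Crandall–Pazy class with parameter β; (ii) ‖V_ω(A)^n (ω + A)^{-1}‖ = O(n^{-1/(2−β)}) as n → ∞. -/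
open Filter Topology

noncomputable section

variable {H : Type*} [NormedAddCommGroup H] [InnerProductSpace ℂ H]

/-- A finite Parseval identity at nodes on the unit circle that avoid the point `1`. -/
lemma exists_parseval_nodes (M : ℕ) (hM : 0 < M) :
    ∃ l : ℕ → ℂ, (∀ j, ‖l j‖ = 1 ∧ l j ≠ 1) ∧ ∀ f : ℕ → H,
      ∑ j ∈ Finset.range M, ‖∑ k ∈ Finset.range M, (l j) ^ k • f k‖ ^ 2
        = M * ∑ k ∈ Finset.range M, ‖f k‖ ^ 2 := by
  have hMC : (M : ℂ) ≠ 0 := by exact_mod_cast hM.ne'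
  set ζ : ℂ := Complex.exp (2 * Real.pi * Complex.I / M) with hζ
  set ξ : ℂ := Complex.exp (((Real.pi / M : ℝ) : ℂ) * Complex.I) with hξ
  have hprim : IsPrimitiveRoot ζ M := Complex.isPrimitiveRoot_exp M hM.ne'
  have hξM : ξ ^ M = -1 := by
    rw [hξ, ← Complex.exp_nat_mul, ← Complex.exp_pi_mul_I]
    congr 1
    push_cast
    field_simp
  have hnorm : ∀ j, ‖ξ * ζ ^ j‖ = 1 := by
    intro j
    rw [norm_mul, norm_pow, hprim.norm'_eq_one hM.ne', hξ, Complex.norm_exp_ofReal_mul_I]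
    simp
  refine ⟨fun j => ξ * ζ ^ j, fun j => ⟨hnorm j, fun h => ?_⟩, fun f => ?_⟩
  · have h1 : (ξ * ζ ^ j) ^ M = -1 := by
      rw [mul_pow, hξM, ← pow_mul, mul_comm j M, pow_mul, hprim.pow_eq_one]
      simp
    rw [show ξ * ζ ^ j = 1 from h, one_pow] at h1
    norm_num at h1
  have hξ0 : ξ ≠ 0 := Complex.exp_ne_zero _
  have hζ0 : ζ ≠ 0 := Complex.exp_ne_zero _
  have hcoef : ∀ k ∈ Finset.range M, ∀ m ∈ Finset.range M,
      ∑ j ∈ Finset.range M, (starRingEnd ℂ) ((ξ * ζ ^ j) ^ k) * (ξ * ζ ^ j) ^ m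
        = if k = m then (M : ℂ) else 0 := by
    intro k hk m hm
    rw [Finset.mem_range] at hk hm
    have hterm : ∀ j : ℕ, (starRingEnd ℂ) ((ξ * ζ ^ j) ^ k) * (ξ * ζ ^ j) ^ m
        = ξ ^ ((m : ℤ) - k) * (ζ ^ ((m : ℤ) - k)) ^ j := by
      intro j
      have hne : ξ * ζ ^ j ≠ 0 := mul_ne_zero hξ0 (pow_ne_zero _ hζ0)
      rw [map_pow, ← Complex.inv_eq_conj (hnorm j)]
      have : (ζ ^ ((m : ℤ) - k)) ^ j = (ζ ^ j) ^ ((m : ℤ) - k) := by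
        rw [← zpow_natCast, ← zpow_natCast, ← zpow_mul, ← zpow_mul, mul_comm]
      rw [this, ← mul_zpow, zpow_sub₀ hne, zpow_natCast, zpow_natCast, inv_pow, div_eq_inv_mul]
    rw [Finset.sum_congr rfl fun j _ => hterm j, ← Finset.mul_sum]
    split_ifs with h
    · simp [h]
    · set x := ζ ^ ((m : ℤ) - k) with hx
      have hxM : x ^ M = 1 := by
        rw [hx, ← zpow_natCast, ← zpow_mul, mul_comm, zpow_mul, zpow_natCast, hprim.pow_eq_one,
          one_zpow]
      have hx1 : x ≠ 1 := by
        rw [hx, Ne, hprim.zpow_eq_one_iff_dvd]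
        intro hd
        have := Int.eq_zero_of_abs_lt_dvd hd (by rw [abs_lt]; omega)
        omega
      rw [geom_sum_eq hx1, hxM]
      simp
  have key : ((∑ j ∈ Finset.range M, ‖∑ k ∈ Finset.range M, (ξ * ζ ^ j) ^ k • f k‖ ^ 2 : ℝ) : ℂ)
      = ((M * ∑ k ∈ Finset.range M, ‖f k‖ ^ 2 : ℝ) : ℂ) := by
    push_cast
    have hexp : ∀ j, ((‖∑ k ∈ Finset.range M, (ξ * ζ ^ j) ^ k • f k‖ : ℝ) : ℂ) ^ 2
        = ∑ k ∈ Finset.range M, ∑ m ∈ Finset.range M,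
          ((starRingEnd ℂ) ((ξ * ζ ^ j) ^ k) * (ξ * ζ ^ j) ^ m) * inner ℂ (f k) (f m) := by
      intro j
      have h := inner_self_eq_norm_sq_to_K (𝕜 := ℂ)
        (∑ k ∈ Finset.range M, (ξ * ζ ^ j) ^ k • f k)
      simp only [Complex.coe_algebraMap] at h
      rw [← h, sum_inner]
      refine Finset.sum_congr rfl fun k _ => ?_
      rw [inner_sum]
      refine Finset.sum_congr rfl fun m _ => ?_
      rw [inner_smul_left, inner_smul_right]
      ring
    rw [Finset.sum_congr rfl fun j _ => hexp j, Finset.sum_comm, Finset.mul_sum]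
    refine Finset.sum_congr rfl fun k hk => ?_
    rw [Finset.sum_comm]
    have : ∀ m ∈ Finset.range M, ∑ j ∈ Finset.range M,
        ((starRingEnd ℂ) ((ξ * ζ ^ j) ^ k) * (ξ * ζ ^ j) ^ m) * inner ℂ (f k) (f m)
        = if k = m then (M : ℂ) * inner ℂ (f k) (f m) else 0 := by
      intro m hm
      rw [← Finset.sum_mul, hcoef k hk m hm]
      split_ifs <;> simp
    rw [Finset.sum_congr rfl this, Finset.sum_ite_eq, if_pos hk]
    have h := inner_self_eq_norm_sq_to_K (𝕜 := ℂ) (f k)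
    simp only [Complex.coe_algebraMap] at h
    rw [h]
  exact_mod_cast key

/-- If `V = 1 - 2ωR` is power bounded, then `1 + κR` is invertible for every `κ > 0`, with a
bound on the inverse that does not depend on `κ`. -/
lemma exists_inverse_one_add_smul [CompleteSpace H] {ω C : ℝ} (hω : 0 < ω) {R : H →L[ℂ] H}
    (hC : ∀ n : ℕ, ‖((1 : H →L[ℂ] H) - ((2 * ω : ℝ) : ℂ) • R) ^ n‖ ≤ C) {κ : ℝ} (hκ : 0 < κ) :
    ∃ D : H →L[ℂ] H, (1 + (κ : ℂ) • R) * D = 1 ∧ D * (1 + (κ : ℂ) • R) = 1 ∧ ‖D‖ ≤ C := by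
  set V : H →L[ℂ] H := 1 - ((2 * ω : ℝ) : ℂ) • R with hV
  set q : ℝ := κ / (2 * ω + κ) with hq
  have hq0 : 0 < q := by positivity
  have hq1 : q < 1 := by rw [hq, div_lt_one (by positivity)]; linarith
  have hbound : ∀ n : ℕ, ‖((q : ℂ) • V) ^ n‖ ≤ C * q ^ n := by
    intro n
    rw [smul_pow, norm_smul, norm_pow, Complex.norm_real, Real.norm_of_nonneg hq0.le, mul_comm]
    exact mul_le_mul_of_nonneg_right (hC n) (by positivity)
  have hgeo : HasSum (fun n : ℕ => C * q ^ n) (C * (1 - q)⁻¹) :=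
    (hasSum_geometric_of_lt_one hq0.le hq1).mul_left C
  have hsum : Summable fun n : ℕ => ((q : ℂ) • V) ^ n :=
    Summable.of_norm_bounded hgeo.summable hbound
  have hid : (1 : H →L[ℂ] H) + (κ : ℂ) • R = ((1 - q : ℝ) : ℂ)⁻¹ • (1 - (q : ℂ) • V) := by
    have h2 : ((2 * ω + κ : ℝ) : ℂ) ≠ 0 := by exact_mod_cast (by positivity : 2 * ω + κ ≠ 0)
    have h3 : (ω : ℂ) ≠ 0 := by exact_mod_cast hω.ne'
    have h1 : ((1 - q : ℝ) : ℂ) = 2 * ω / ((2 * ω + κ : ℝ) : ℂ) := by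
      have : 1 - q = 2 * ω / (2 * ω + κ) := by rw [hq]; field_simp; ring
      rw [this]; push_cast; rfl
    have h4 : (q : ℂ) = κ / ((2 * ω + κ : ℝ) : ℂ) := by rw [hq]; push_cast; rfl
    rw [h1, h4, hV]
    push_cast at h2 ⊢
    match_scalars <;> field_simp
    ring
  have hq' : ((1 - q : ℝ) : ℂ) ≠ 0 := by
    exact_mod_cast (by linarith : (0 : ℝ) < 1 - q).ne'
  refine ⟨((1 - q : ℝ) : ℂ) • ∑' n : ℕ, ((q : ℂ) • V) ^ n, ?_, ?_, ?_⟩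
  · rw [hid, smul_mul_smul_comm, hsum.one_sub_mul_tsum_pow, inv_mul_cancel₀ hq', one_smul]
  · rw [hid, smul_mul_smul_comm, hsum.tsum_pow_mul_one_sub, mul_inv_cancel₀ hq', one_smul]
  · rw [norm_smul, Complex.norm_real, Real.norm_of_nonneg (by linarith)]
    have := tsum_of_norm_bounded hgeo hbound
    calc (1 - q) * ‖∑' n : ℕ, ((q : ℂ) • V) ^ n‖ ≤ (1 - q) * (C * (1 - q)⁻¹) :=
          mul_le_mul_of_nonneg_left this (by linarith)
      _ = C := by field_simp [(by linarith : 1 - q ≠ 0)]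

open MeasureTheory FourierTransform ContDiff in
/-- Plancherel's theorem for Hilbert space valued functions in `L¹ ∩ L²`. -/
lemma eLpNorm_fourier_eq_of_integrable_of_memLp [CompleteSpace H] {f : ℝ → H}
    (hf1 : Integrable f) (hf2 : MemLp f 2) :
    eLpNorm (𝓕 f) 2 volume = eLpNorm f 2 volume := by
  set F : Lp H 2 (volume : Measure ℝ) := hf2.toLp f with hF
  have hFf : (F : ℝ → H) =ᵐ[volume] f := hf2.coeFn_toLp
  have hcont : Continuous (𝓕 f) :=
    VectorFourier.fourierIntegral_continuous Real.continuous_fourierChar continuous_inner hf1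
  have hae : ((𝓕 F : Lp H 2 (volume : Measure ℝ)) : ℝ → H) =ᵐ[volume] 𝓕 f := by
    apply ae_eq_of_integral_contDiff_smul_eq
    · exact (Lp.memLp _).locallyIntegrable (by norm_num)
    · exact hcont.locallyIntegrable
    · intro g g_smooth g_cpt
      have hg₁ : HasCompactSupport (Complex.ofRealCLM ∘ g) := g_cpt.comp_left rfl
      have hg₂ : ContDiff ℝ ∞ (Complex.ofRealCLM ∘ g) := by fun_prop
      set G := hg₁.toSchwartzMap hg₂ with hG
      have hGg : ∀ x, G x = (g x : ℂ) := fun x => rfl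
      have hdist := congrArg (fun u => u G) (Lp.fourier_toTemperedDistribution_eq F)
      simp only [TemperedDistribution.fourier_apply, Lp.toTemperedDistribution_apply] at hdist
      have hflip : ∫ ξ, (𝓕 G) ξ • f ξ = ∫ x, G x • 𝓕 f x := by
        simpa using! VectorFourier.integral_fourierIntegral_smul_eq_flip (L := innerₗ ℝ)
          Real.continuous_fourierChar continuous_inner G.integrable hf1
      have hleft : ∫ ξ, (𝓕 G) ξ • F ξ = ∫ ξ, (𝓕 G) ξ • f ξ :=
        integral_congr_ae (hFf.mono fun ξ hξ => by simp only [hξ])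
      rw [hleft, hflip] at hdist
      simpa [hGg] using! hdist.symm
  rw [← eLpNorm_congr_ae hae, ← eLpNorm_congr_ae hFf]
  have := Lp.norm_fourier_eq F
  rw [Lp.norm_def, Lp.norm_def] at this
  exact (ENNReal.toReal_eq_toReal_iff' (Lp.eLpNorm_ne_top _) (Lp.eLpNorm_ne_top _)).1 this

lemma sum_range_sq_mul_sq_sub (n : ℕ) (m : ℝ) :
    ∑ k ∈ Finset.range n, ((k : ℝ) * (m - k)) ^ 2
      = m ^ 2 * (n * (n - 1) * (2 * n - 1) / 6) - 2 * m * (n * (n - 1) / 2) ^ 2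
        + n * (n - 1) * (2 * n - 1) * (3 * n ^ 2 - 3 * n - 1) / 30 := by
  induction n with
  | zero => simp
  | succ n ih => rw [Finset.sum_range_succ, ih]; push_cast; ring

/-- Decay of the orbits of a power bounded operator `V` on a Hilbert space: if `Q` commutes with
`V` and is dominated by `λ - V` uniformly on the unit circle, then `‖Vⁿ Q‖ = O(1 / n)`. -/
lemma norm_pow_mul_le_of_circle_bound {V Q : H →L[ℂ] H} {C K : ℝ} (hC : ∀ n : ℕ, ‖V ^ n‖ ≤ C)
    (hcomm : Commute V Q) (hK0 : 0 ≤ K)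
    (hK : ∀ l : ℂ, ‖l‖ = 1 → l ≠ 1 → ∀ y, ‖Q y‖ ≤ K * ‖l • y - V y‖) {n : ℕ} (hn : 2 ≤ n) :
    ‖V ^ n * Q‖ ≤ 6 * C ^ 2 * K / n := by
  have hC0 : 0 ≤ C := (norm_nonneg _).trans (hC 0)
  have hnR : (2 : ℝ) ≤ n := by exact_mod_cast hn
  have hn0 : (0 : ℝ) < n := by linarith
  obtain ⟨l, hl, hpars⟩ := exists_parseval_nodes (H := H) n (by omega)
  refine ContinuousLinearMap.opNorm_le_bound _ (by positivity) fun x => ?_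
  set a : ℕ → ℂ := fun k => (k : ℂ) * (n - k) with ha
  set v : ℕ → H := fun k => a k • (V ^ k) x with hv
  set f : ℕ → H := fun k => ((n : ℂ) - 2 * k - 1) • (V ^ (k + 1)) x with hf
  have hshift : ∀ k, v (k + 1) = V (v k) + f k := by
    intro k
    simp only [hv, hf, ha, map_smul, ← mul_apply_eq_comp, ← pow_succ']
    rw [← add_smul]
    congr 1
    push_cast
    ring
  have hv0 : v 0 = 0 := by simp [hv, ha]
  have hvn : v n = 0 := by simp [hv, ha]
  have hnode : ∀ j, ‖∑ k ∈ Finset.range n, (l j) ^ k • Q (v k)‖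
      ≤ K * ‖∑ k ∈ Finset.range n, (l j) ^ k • f k‖ := by
    intro j
    obtain ⟨hl1, hl2⟩ := hl j
    have hl0 : l j ≠ 0 := by
      intro h
      rw [h, norm_zero] at hl1
      exact zero_ne_one hl1
    have h := hK (l j)⁻¹ (by rw [norm_inv, hl1, inv_one]) (by rwa [Ne, inv_eq_one])
      (∑ k ∈ Finset.range n, (l j) ^ k • v k)
    have hsum : ∑ k ∈ Finset.range n, (l j) ^ (k + 1) • v (k + 1)
        = ∑ k ∈ Finset.range n, (l j) ^ k • v k := by
      have h1 := Finset.sum_range_succ (fun k => (l j) ^ k • v k) n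
      have h2 := Finset.sum_range_succ' (fun k => (l j) ^ k • v k) n
      rw [hvn, smul_zero, add_zero] at h1
      rw [hv0, smul_zero, add_zero] at h2
      rw [← h2, h1]
    have hid : (l j)⁻¹ • (∑ k ∈ Finset.range n, (l j) ^ k • v k)
        - V (∑ k ∈ Finset.range n, (l j) ^ k • v k) = ∑ k ∈ Finset.range n, (l j) ^ k • f k := by
      nth_rewrite 1 [← hsum]
      rw [Finset.smul_sum, map_sum, ← Finset.sum_sub_distrib]
      refine Finset.sum_congr rfl fun k _ => ?_
      rw [smul_smul, pow_succ', inv_mul_cancel_left₀ hl0, hshift, smul_add, ← map_smul]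
      simp
    rw [hid, map_sum] at h
    simpa only [map_smul] using h
  have hVQ : ∀ k, Q ((V ^ k) x) = (V ^ k) (Q x) := fun k =>
    (DFunLike.congr_fun (hcomm.pow_left k).eq x).symm
  have hmain : ∑ k ∈ Finset.range n, ‖Q (v k)‖ ^ 2
      ≤ K ^ 2 * ∑ k ∈ Finset.range n, ‖f k‖ ^ 2 := by
    have h : ∑ j ∈ Finset.range n, ‖∑ k ∈ Finset.range n, (l j) ^ k • Q (v k)‖ ^ 2
        ≤ K ^ 2 * ∑ j ∈ Finset.range n, ‖∑ k ∈ Finset.range n, (l j) ^ k • f k‖ ^ 2 := by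
      rw [Finset.mul_sum]
      refine Finset.sum_le_sum fun j _ => ?_
      rw [← mul_pow]
      exact pow_le_pow_left₀ (norm_nonneg _) (hnode j) 2
    rw [hpars, hpars] at h
    nlinarith
  have hfk : ∀ k ∈ Finset.range n, ‖f k‖ ^ 2 ≤ (n * (C * ‖x‖)) ^ 2 := by
    intro k hk
    have hk' : (k : ℝ) + 1 ≤ n := by exact_mod_cast Finset.mem_range.1 hk
    refine pow_le_pow_left₀ (norm_nonneg _) ?_ 2
    simp only [hf, norm_smul]
    have h1 : ‖(n : ℂ) - 2 * k - 1‖ ≤ n := by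
      have : (n : ℂ) - 2 * k - 1 = ((n - 2 * k - 1 : ℝ) : ℂ) := by push_cast; rfl
      rw [this, Complex.norm_real, Real.norm_eq_abs, abs_le]
      have : (0 : ℝ) ≤ k := k.cast_nonneg
      constructor <;> linarith
    exact mul_le_mul h1 ((V ^ (k + 1)).le_of_opNorm_le (hC _) x) (norm_nonneg _) hn0.le
  have hlow : ∀ k ∈ Finset.range n,
      ((k : ℝ) * (n - k)) ^ 2 * ‖(V ^ n) (Q x)‖ ^ 2 ≤ C ^ 2 * ‖Q (v k)‖ ^ 2 := by
    intro k hk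
    have hk' : k ≤ n := (Finset.mem_range.1 hk).le
    have hkR : (k : ℝ) ≤ n := by exact_mod_cast hk'
    have h1 : ‖Q (v k)‖ = (k : ℝ) * (n - k) * ‖(V ^ k) (Q x)‖ := by
      simp only [hv, ha, map_smul, norm_smul, hVQ]
      have : (k : ℂ) * (n - k) = (((k : ℝ) * (n - k) : ℝ) : ℂ) := by push_cast; rfl
      rw [this, Complex.norm_real, Real.norm_of_nonneg]
      exact mul_nonneg k.cast_nonneg (by linarith)
    have h2 : ‖(V ^ n) (Q x)‖ ≤ C * ‖(V ^ k) (Q x)‖ := by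
      have : (V ^ n) (Q x) = (V ^ (n - k)) ((V ^ k) (Q x)) := by
        rw [← Nat.sub_add_cancel hk', pow_add, Nat.sub_add_cancel hk', mul_apply_eq_comp]
      rw [this]
      exact (V ^ (n - k)).le_of_opNorm_le (hC _) _
    rw [h1, mul_pow _ ‖(V ^ k) (Q x)‖]
    have h3 := pow_le_pow_left₀ (norm_nonneg _) h2 2
    rw [mul_pow] at h3
    nlinarith [sq_nonneg ((k : ℝ) * (n - k))]
  have hsumlow := Finset.sum_le_sum hlow
  rw [← Finset.sum_mul, ← Finset.mul_sum, sum_range_sq_mul_sq_sub] at hsumlow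
  have hsumf := Finset.sum_le_sum hfk
  rw [Finset.sum_const, Finset.card_range, nsmul_eq_mul] at hsumf
  have hS : (n : ℝ) ^ 5 / 36 ≤ (n : ℝ) ^ 2 * (n * (n - 1) * (2 * n - 1) / 6)
      - 2 * n * (n * (n - 1) / 2) ^ 2 + n * (n - 1) * (2 * n - 1) * (3 * n ^ 2 - 3 * n - 1) / 30 := by
    have : (n : ℝ) ^ 5 ≥ 16 * n := by
      have : (2 : ℝ) ^ 4 ≤ n ^ 4 := pow_le_pow_left₀ (by norm_num) hnR 4
      nlinarith
    nlinarith
  have hfin : (n : ℝ) ^ 5 / 36 * ‖(V ^ n) (Q x)‖ ^ 2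
      ≤ C ^ 2 * (K ^ 2 * (n * (n * (C * ‖x‖)) ^ 2)) := by
    calc _ ≤ _ := mul_le_mul_of_nonneg_right hS (sq_nonneg _)
      _ ≤ _ := hsumlow
      _ ≤ _ := mul_le_mul_of_nonneg_left
        (hmain.trans (mul_le_mul_of_nonneg_left hsumf (sq_nonneg K))) (sq_nonneg C)
  rw [mul_apply_eq_comp]
  refine (sq_le_sq₀ (norm_nonneg _) (by positivity)).1 ?_
  have h3 : (0 : ℝ) < n ^ 5 / 36 := by positivity
  refine le_of_mul_le_mul_left (hfin.trans (le_of_eq ?_)) h3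
  field_simp
  ring

lemma IsC0Semigroup.exists_bound [CompleteSpace H] {T : ℝ → H →L[ℂ] H} (hT : IsC0Semigroup T) :
    ∃ M : ℝ, 1 ≤ M ∧ ∀ t, 0 ≤ t → t ≤ 1 → ‖T t‖ ≤ M := by
  obtain ⟨M, hM⟩ := banach_steinhaus (g := fun t : Set.Icc (0 : ℝ) 1 => T t) fun x => by
    obtain ⟨B, hB⟩ := isCompact_Icc.exists_bound_of_continuousOn
      ((hT.strong_continuity x).mono (fun t ht => ht.1 : Set.Icc (0 : ℝ) 1 ⊆ Set.Ici 0))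
    exact ⟨B, fun t => hB t t.2⟩
  exact ⟨max 1 M, le_max_left _ _, fun t h0 h1 => (hM ⟨t, h0, h1⟩).trans (le_max_right _ _)⟩

lemma IsC0Semigroup.apply_add {T : ℝ → H →L[ℂ] H} (hT : IsC0Semigroup T) {s t : ℝ} (hs : 0 ≤ s)
    (ht : 0 ≤ t) (x : H) : T (s + t) x = T s (T t x) := by
  rw [hT.map_add s t hs ht]
  rfl

lemma IsC0Semigroup.pow_eq {T : ℝ → H →L[ℂ] H} (hT : IsC0Semigroup T) {t : ℝ} (ht : 0 ≤ t)
    (n : ℕ) : T t ^ n = T (n * t) := by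
  induction n with
  | zero => simp [hT.map_zero]
  | succ n ih =>
    rw [pow_succ, ih]
    push_cast
    rw [add_mul, one_mul, hT.map_add _ _ (by positivity) ht]
    rfl

lemma IsResolventAt.tendsto_difference_quotient {T : ℝ → H →L[ℂ] H} {A : H →ₗ.[ℂ] H}
    (hgen : IsGenerator T A) {lam : ℂ} {R : H →L[ℂ] H} (hR : IsResolventAt A lam R) (z : H) :
    Tendsto (fun h : ℝ => (h : ℂ)⁻¹ • (T h (R z) - R z)) (𝓝[>] 0) (𝓝 (-(z - lam • R z))) := by
  obtain ⟨hx, hz⟩ := hR.1 z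
  have h := hgen.2 ⟨R z, hx⟩
  rwa [eq_sub_of_add_eq' hz] at h

lemma IsResolventAt.tendsto_semigroup {T : ℝ → H →L[ℂ] H} {A : H →ₗ.[ℂ] H}
    (hT : IsC0Semigroup T) (hgen : IsGenerator T A) {lam : ℂ} {R : H →L[ℂ] H}
    (hR : IsResolventAt A lam R) {t : ℝ} (ht : 0 ≤ t) (z : H) :
    Tendsto (fun h : ℝ => (h : ℂ)⁻¹ • (T (t + h) (R z) - T t (R z))) (𝓝[>] 0)
      (𝓝 (-(T t (z - lam • R z)))) := by
  rw [← map_neg]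
  refine (((T t).continuous.tendsto _).comp (hR.tendsto_difference_quotient hgen z)).congr' ?_
  filter_upwards [self_mem_nhdsWithin] with h hh
  rw [hT.apply_add ht (le_of_lt hh)]
  simp

lemma IsResolventAt.commute_semigroup {T : ℝ → H →L[ℂ] H} {A : H →ₗ.[ℂ] H}
    (hT : IsC0Semigroup T) (hgen : IsGenerator T A) {lam : ℂ} {R : H →L[ℂ] H}
    (hR : IsResolventAt A lam R) {t : ℝ} (ht : 0 ≤ t) : Commute (T t) R := by
  ext z
  change T t (R z) = R (T t z)
  have hlim : Tendsto (fun h : ℝ => (h : ℂ)⁻¹ • (T h (T t (R z)) - T t (R z))) (𝓝[>] 0)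
      (𝓝 (-(T t (z - lam • R z)))) := by
    refine (hR.tendsto_semigroup hT hgen ht z).congr' ?_
    filter_upwards [self_mem_nhdsWithin] with h hh
    rw [add_comm, hT.apply_add (le_of_lt hh) ht]
  have hmem : T t (R z) ∈ A.domain := (hgen.1 _).2 ⟨_, hlim⟩
  have hA : A ⟨T t (R z), hmem⟩ = T t (z - lam • R z) :=
    neg_injective (tendsto_nhds_unique (hgen.2 ⟨T t (R z), hmem⟩) hlim)
  have h := hR.2 ⟨T t (R z), hmem⟩
  rw [hA] at h
  exact h.symm.trans (congrArg R (by simp))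

lemma IsResolventAt.hasDerivWithinAt_semigroup {T : ℝ → H →L[ℂ] H} {A : H →ₗ.[ℂ] H}
    (hT : IsC0Semigroup T) (hgen : IsGenerator T A) {lam : ℂ} {R : H →L[ℂ] H}
    (hR : IsResolventAt A lam R) {t : ℝ} (ht : 0 ≤ t) (z : H) :
    HasDerivWithinAt (fun s => T s (R z)) (-(T t (z - lam • R z))) (Set.Ioi t) t := by
  rw [hasDerivWithinAt_iff_tendsto_slope' Set.self_notMem_Ioi]
  have hmap : Tendsto (fun s : ℝ => s - t) (𝓝[>] t) (𝓝[>] 0) := by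
    refine tendsto_nhdsWithin_iff.2 ⟨?_, ?_⟩
    · have : Tendsto (fun s : ℝ => s - t) (𝓝 t) (𝓝 (t - t)) := tendsto_id.sub_const t
      rw [sub_self] at this
      exact this.mono_left nhdsWithin_le_nhds
    · filter_upwards [self_mem_nhdsWithin] with s hs
      exact sub_pos.2 (Set.mem_Ioi.1 hs)
  refine ((hR.tendsto_semigroup hT hgen ht z).comp hmap).congr fun s => ?_
  simp only [Function.comp_apply, slope_def_module, add_sub_cancel]
  rw [← Complex.ofReal_inv, Complex.coe_smul]

open MeasureTheory in
/-- Integration of the product rule for `p(t) e^{-tA} (ω + A)⁻¹ z`. -/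
lemma IsResolventAt.integral_deriv_smul_semigroup [CompleteSpace H] {T : ℝ → H →L[ℂ] H}
    {A : H →ₗ.[ℂ] H} (hT : IsC0Semigroup T) (hgen : IsGenerator T A) {lam : ℂ} {R : H →L[ℂ] H}
    (hR : IsResolventAt A lam R) {τ : ℝ} (hτ : 0 ≤ τ) {p p' : ℝ → ℂ}
    (hp : ∀ t, HasDerivAt p (p' t) t) (hp' : Continuous p') (z : H) :
    ∫ t in 0..τ, (p t • -(T t (z - lam • R z)) + p' t • T t (R z))
      = p τ • T τ (R z) - p 0 • R z := by
  have hpc : Continuous p := continuous_iff_continuousAt.2 fun t => (hp t).continuousAt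
  have hcont : ∀ x, ContinuousOn (fun t => T t x) (Set.uIcc 0 τ) := fun x => by
    rw [Set.uIcc_of_le hτ]
    exact (hT.strong_continuity x).mono Set.Icc_subset_Ici_self
  have h := intervalIntegral.integral_eq_sub_of_hasDeriv_right
    (f := fun t => p t • T t (R z))
    (f' := fun t => p t • -(T t (z - lam • R z)) + p' t • T t (R z)) (a := 0) (b := τ)
    (hpc.continuousOn.smul (hcont _))
    (fun t ht => by
      rw [min_eq_left hτ] at ht
      exact (hp t).hasDerivWithinAt.smul
        (hR.hasDerivWithinAt_semigroup hT hgen ht.1.le z))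
    (((hpc.continuousOn.smul (hcont _).neg).add
      (hp'.continuousOn.smul (hcont _))).intervalIntegrable)
  simpa only [hT.map_zero, one_apply_eq_self] using h

open MeasureTheory FourierTransform in
/-- Smoothing of a semigroup on a Hilbert space: if `Q` commutes with the semigroup and is
dominated by `iη + A` uniformly in `η ∈ ℝ`, then `‖Q e^{-τA}‖ = O(1 / τ)` as `τ → 0`. -/
lemma IsResolventAt.norm_mul_semigroup_le [CompleteSpace H] {T : ℝ → H →L[ℂ] H}
    {A : H →ₗ.[ℂ] H} (hT : IsC0Semigroup T) (hgen : IsGenerator T A) {ω : ℝ} {R : H →L[ℂ] H}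
    (hR : IsResolventAt A (ω : ℂ) R) {M : ℝ} (hM1 : 1 ≤ M)
    (hM : ∀ t, 0 ≤ t → t ≤ 1 → ‖T t‖ ≤ M) {Q : H →L[ℂ] H} (hQ : ∀ t, 0 ≤ t → Commute Q (T t))
    {K : ℝ} (hK0 : 0 ≤ K)
    (hK : ∀ s : ℂ, s.re = -ω → ∀ z, ‖Q (R z)‖ ≤ K * ‖z + s • R z‖) {τ : ℝ} (hτ : 0 < τ)
    (hτ1 : τ ≤ 1) : ‖Q * T τ‖ ≤ 16 * M ^ 2 * K / τ := by
  have hM0 : 0 < M := by linarith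
  refine ContinuousLinearMap.opNorm_le_bound _ (by positivity) fun x => ?_
  set a : ℝ → ℂ := fun t => (t : ℂ) * (τ - t) with ha
  set a' : ℝ → ℂ := fun t => (τ : ℂ) - 2 * t with ha'
  have hda : ∀ t, HasDerivAt a (a' t) t := by
    intro t
    have h1 : HasDerivAt (fun t : ℝ => (t : ℂ)) 1 t := Complex.ofRealCLM.hasDerivAt
    refine (h1.mul (h1.const_sub (τ : ℂ))).congr_deriv ?_
    simp only [ha']
    ring
  have hac : Continuous a := by fun_prop
  have hac' : Continuous a' := by fun_prop
  have hcont : ContinuousOn (fun t => T t x) (Set.Icc 0 τ) :=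
    (hT.strong_continuity x).mono fun t ht => ht.1
  -- the Fourier transforms of the truncated functions
  set F : (ℝ → ℂ) → ℝ → H := fun b => (Set.Ioc 0 τ).indicator fun t => b t • T t x with hF
  have hFint : ∀ b : ℝ → ℂ, Continuous b → IntervalIntegrable (fun t => b t • T t x) volume 0 τ :=
    fun b hb => ContinuousOn.intervalIntegrable (by
      rw [Set.uIcc_of_le hτ.le]; exact hb.continuousOn.smul hcont)
  have hF1 : ∀ b : ℝ → ℂ, Continuous b → Integrable (F b) := fun b hb => by
    rw [hF, integrable_indicator_iff measurableSet_Ioc]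
    exact (intervalIntegrable_iff_integrableOn_Ioc_of_le hτ.le).1 (hFint b hb)
  have hF2 : ∀ b : ℝ → ℂ, Continuous b → MemLp (F b) 2 := fun b hb => by
    have hc : ContinuousOn (fun t => b t • T t x) (Set.Icc 0 τ) := hb.continuousOn.smul hcont
    obtain ⟨B, hB⟩ := isCompact_Icc.exists_bound_of_continuousOn hc
    have h2 : MemLp (fun t => b t • T t x) 2 (volume.restrict (Set.Icc 0 τ)) :=
      MemLp.of_bound (hc.aestronglyMeasurable measurableSet_Icc) B
        ((ae_restrict_iff' measurableSet_Icc).2 (Eventually.of_forall hB))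
    exact (memLp_indicator_iff_restrict measurableSet_Ioc).2
      (h2.mono_measure (Measure.restrict_mono Set.Ioc_subset_Icc_self le_rfl))
  have hFour : ∀ (b : ℝ → ℂ) (ξ : ℝ), 𝓕 (F b) ξ
      = ∫ t in 0..τ, (Complex.exp (((-2 * Real.pi * ξ : ℝ) : ℂ) * Complex.I * t) * b t) • T t x := by
    intro b ξ
    rw [Real.fourier_real_eq_integral_exp_smul, intervalIntegral.integral_of_le hτ.le,
      ← integral_indicator measurableSet_Ioc]
    congr 1
    ext t
    simp only [hF, Set.indicator_apply]
    split_ifs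
    · rw [smul_smul]
      congr 3
      push_cast
      ring
    · simp
  have hpoint : ∀ ξ, ‖Q (𝓕 (F a) ξ)‖ ≤ K * ‖𝓕 (F a') ξ‖ := by
    intro ξ
    set lam : ℂ := ((-2 * Real.pi * ξ : ℝ) : ℂ) * Complex.I with hlam
    set e : ℝ → ℂ := fun t => Complex.exp (lam * t) with he
    have hde : ∀ t, HasDerivAt e (lam * e t) t := by
      intro t
      have h1 : HasDerivAt (fun t : ℝ => (t : ℂ)) 1 t := Complex.ofRealCLM.hasDerivAt
      have := (h1.const_mul lam).cexp
      refine this.congr_deriv ?_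
      simp only [he]
      ring
    have hec : Continuous e := by fun_prop
    have hint := hR.integral_deriv_smul_semigroup hT hgen hτ.le (p := fun t => e t * a t)
      (p' := fun t => lam * e t * a t + e t * a' t) (fun t => (hde t).mul (hda t))
      (by fun_prop) x
    have hends : a τ = 0 ∧ a 0 = 0 := by simp [ha]
    simp only [hends.1, hends.2, mul_zero, zero_smul, sub_zero] at hint
    set v := 𝓕 (F a) ξ with hv
    set f := 𝓕 (F a') ξ with hf
    have hv' : v = ∫ t in 0..τ, (e t * a t) • T t x := hFour a ξ
    have hf' : f = ∫ t in 0..τ, (e t * a' t) • T t x := hFour a' ξ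
    have hcomm : ∀ t ∈ Set.uIcc 0 τ, T t (R x) = R (T t x) := fun t ht => by
      rw [Set.uIcc_of_le hτ.le] at ht
      exact DFunLike.congr_fun (hR.commute_semigroup hT hgen ht.1).eq x
    have hzero : R (f + (lam + ω) • v) - v = 0 := by
      have i1 := hFint (fun t => e t * a t) (by fun_prop)
      have i2 := hFint (fun t => e t * a' t) (by fun_prop)
      have i1' : IntervalIntegrable (fun t => (lam + ω) • (e t * a t) • T t x) volume 0 τ :=
        i1.smul _
      have i4 : IntervalIntegrable
          (fun t => (e t * a' t) • T t x + (lam + ω) • (e t * a t) • T t x) volume 0 τ :=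
        i2.add i1'
      have h3 : R (f + (lam + ω) • v)
          = ∫ t in 0..τ, R ((e t * a' t) • T t x + (lam + ω) • (e t * a t) • T t x) := by
        rw [R.intervalIntegral_comp_comm i4,
          intervalIntegral.integral_add i2 i1', intervalIntegral.integral_smul,
          ← hv', ← hf']
      have i3 : IntervalIntegrable
          (fun t => R ((e t * a' t) • T t x + (lam + ω) • (e t * a t) • T t x)) volume 0 τ :=
        ⟨R.integrable_comp i4.1, R.integrable_comp i4.2⟩
      rw [h3, hv', ← intervalIntegral.integral_sub i3 i1, ← hint]
      refine intervalIntegral.integral_congr fun t ht => ?_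
      simp only [map_sub, map_smul, map_add, hcomm t ht]
      module
    have hRz : R (f + (lam + ω) • v) = v := sub_eq_zero.1 hzero
    have h := hK (-(lam + ω)) (by simp [hlam]) (f + (lam + ω) • v)
    have h6 : f + (lam + ω) • v + -(lam + ω) • v = f := by module
    rwa [hRz, h6] at h
  have hQF : 𝓕 (fun t => Q (F a t)) = fun ξ => Q (𝓕 (F a) ξ) := by
    ext ξ
    rw [Real.fourier_real_eq_integral_exp_smul, Real.fourier_real_eq_integral_exp_smul,
      ← Q.integral_comp_comm]
    · simp
    · have := (Real.fourierIntegral_convergent_iff (μ := volume) (f := F a) ξ).2 (hF1 a hac)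
      refine this.congr (Eventually.of_forall fun t => ?_)
      simp [Circle.smul_def, Real.fourierChar_apply]
      ring_nf
  have hnorm : eLpNorm (fun t => Q (F a t)) 2 volume
      ≤ ENNReal.ofReal K * eLpNorm (F a') 2 volume := by
    rw [← eLpNorm_fourier_eq_of_integrable_of_memLp (Q.integrable_comp (hF1 a hac))
      (Q.comp_memLp' (hF2 a hac)), ← eLpNorm_fourier_eq_of_integrable_of_memLp (hF1 a' hac')
      (hF2 a' hac'), hQF]
    exact eLpNorm_le_mul_eLpNorm_of_ae_le_mul (Eventually.of_forall hpoint) 2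
  have hupper : eLpNorm (F a') 2 volume
      ≤ eLpNorm ((Set.Ioc 0 τ).indicator fun _ => τ * (M * ‖x‖)) 2 volume := by
    refine eLpNorm_mono fun t => ?_
    simp only [hF, Set.indicator_apply]
    split_ifs with ht
    · rw [norm_smul, Real.norm_of_nonneg (by positivity)]
      refine mul_le_mul ?_ ((T t).le_of_opNorm_le (hM t ht.1.le (ht.2.trans hτ1)) x)
        (norm_nonneg _) hτ.le
      have : a' t = ((τ - 2 * t : ℝ) : ℂ) := by simp [ha']
      rw [this, Complex.norm_real, Real.norm_eq_abs, abs_le]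
      constructor <;> linarith [ht.1, ht.2]
    · simp
  set c : ℝ := τ ^ 2 / 8 * (‖Q (T τ x)‖ / M) with hc
  have hlower : eLpNorm ((Set.Ioc (τ / 4) (τ / 2)).indicator fun _ => c) 2 volume
      ≤ eLpNorm (fun t => Q (F a t)) 2 volume := by
    refine eLpNorm_mono fun t => ?_
    rw [Set.indicator_apply]
    split_ifs with ht
    · have ht0 : 0 < t := by linarith [ht.1]
      have htτ : t ≤ τ := by linarith [ht.2]
      simp only [hF]
      rw [Set.indicator_of_mem (show t ∈ Set.Ioc 0 τ from ⟨ht0, htτ⟩), map_smul, norm_smul,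
        Real.norm_of_nonneg (by positivity)]
      have h1 : τ ^ 2 / 8 ≤ ‖a t‖ := by
        have : a t = ((t * (τ - t) : ℝ) : ℂ) := by simp [ha]
        rw [this, Complex.norm_real, Real.norm_of_nonneg (mul_nonneg ht0.le (by linarith))]
        nlinarith [ht.1, ht.2]
      have h2 : ‖Q (T τ x)‖ / M ≤ ‖Q (T t x)‖ := by
        rw [div_le_iff₀ hM0, mul_comm]
        have : Q (T τ x) = T (τ - t) (Q (T t x)) := by
          have h := hT.apply_add (sub_nonneg.2 htτ) ht0.le x
          rw [sub_add_cancel] at h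
          rw [h]
          exact DFunLike.congr_fun (hQ (τ - t) (sub_nonneg.2 htτ)).eq (T t x)
        rw [this]
        exact (T (τ - t)).le_of_opNorm_le (hM _ (sub_nonneg.2 htτ) (by linarith)) _
      exact mul_le_mul h1 h2 (by positivity) (norm_nonneg _)
    · simp
  have hall := hlower.trans (hnorm.trans (mul_le_mul_right hupper _))
  rw [eLpNorm_indicator_const measurableSet_Ioc (by norm_num) (by norm_num),
    eLpNorm_indicator_const measurableSet_Ioc (by norm_num) (by norm_num), Real.volume_Ioc,
    Real.volume_Ioc, Real.enorm_of_nonneg (by positivity), Real.enorm_of_nonneg (by positivity),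
    ENNReal.ofReal_rpow_of_nonneg (by linarith) (by norm_num),
    ENNReal.ofReal_rpow_of_nonneg (by linarith) (by norm_num),
    ← ENNReal.ofReal_mul (by positivity), ← ENNReal.ofReal_mul (by positivity),
    ← ENNReal.ofReal_mul (by positivity), ENNReal.ofReal_le_ofReal_iff (by positivity)] at hall
  have hhalf : (τ / 2 - τ / 4) ^ (1 / (2 : ENNReal).toReal)
      = 1 / 2 * (τ - 0) ^ (1 / (2 : ENNReal).toReal) := by
    rw [show τ / 2 - τ / 4 = (1 / 2) ^ 2 * (τ - 0) by ring,
      Real.mul_rpow (by norm_num) (by linarith)]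
    congr 1
    rw [← Real.rpow_natCast, ← Real.rpow_mul (by norm_num)]
    norm_num
  rw [hhalf] at hall
  have hpos : 0 < (τ - 0) ^ (1 / (2 : ENNReal).toReal) := Real.rpow_pos_of_pos (by linarith) _
  have hall' : c * (1 / 2) ≤ K * (τ * (M * ‖x‖)) := by
    refine le_of_mul_le_mul_right ?_ hpos
    linarith
  rw [mul_apply_eq_comp]
  rw [hc] at hall'
  have h5 : ‖Q (T τ x)‖ = (τ ^ 2 / 8 * (‖Q (T τ x)‖ / M) * (1 / 2)) * (16 * M / τ ^ 2) := by
    field_simp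
    ring
  rw [h5]
  calc _ ≤ K * (τ * (M * ‖x‖)) * (16 * M / τ ^ 2) :=
        mul_le_mul_of_nonneg_right hall' (by positivity)
    _ = _ := by field_simp

/-- The operator `R = (ω + A)⁻¹` satisfies `‖(s + ω + A)⁻¹‖ ≤ c |s|⁻ᵝ` on the line
`Re s = -ω`, i.e. the resolvent of `A` decays along the imaginary axis. The inequality is written
without inverses: `z + s R z = (s + ω + A) R z`. -/
def ResolventDecay (R : H →L[ℂ] H) (ω β c : ℝ) : Prop :=
  ∀ s : ℂ, s.re = -ω → ∀ z, ‖R z‖ ≤ c * ‖s‖ ^ (-β) * ‖z + s • R z‖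

lemma norm_pos_of_re_eq_neg {s : ℂ} {ω : ℝ} (hω : 0 < ω) (hs : s.re = -ω) : 0 < ‖s‖ := by
  refine norm_pos_iff.2 fun h => ?_
  rw [h, Complex.zero_re] at hs
  linarith

lemma mul_rpow_neg_eq {t : ℝ} (ht : 0 < t) (β : ℝ) : t * t ^ (-β) = t ^ (1 - β) := by
  rw [sub_eq_add_neg, Real.rpow_add ht, Real.rpow_one]

section Yosida

variable {R D : H →L[ℂ] H} {κ : ℝ}

lemma smul_mul_of_inverse (h : (1 + (κ : ℂ) • R) * D = 1) : (κ : ℂ) • (R * D) = 1 - D := by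
  rw [add_mul, one_mul, smul_mul_assoc] at h
  exact eq_sub_of_add_eq' h

lemma smul_mul_of_inverse' (h : D * (1 + (κ : ℂ) • R) = 1) : (κ : ℂ) • (D * R) = 1 - D := by
  rw [mul_add, mul_one, mul_smul_comm] at h
  exact eq_sub_of_add_eq' h

lemma commute_of_inverse (hκ : 0 < κ) (h1 : (1 + (κ : ℂ) • R) * D = 1)
    (h2 : D * (1 + (κ : ℂ) • R) = 1) : Commute R D :=
  smul_right_injective _ (r := (κ : ℂ)) (by exact_mod_cast hκ.ne')
    ((smul_mul_of_inverse h1).trans (smul_mul_of_inverse' h2).symm)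

lemma norm_one_sub_apply_le {C : ℝ} (hD : ‖D‖ ≤ C) (z : H) :
    ‖(1 - D) z‖ ≤ (1 + C) * ‖z‖ := by
  rw [sub_apply, one_apply_eq_self]
  refine (norm_sub_le _ _).trans ?_
  linarith [D.le_of_opNorm_le hD z]

lemma ResolventDecay.norm_mul_one_sub_apply_le {ω β c C : ℝ} (hR : ResolventDecay R ω β c)
    (hω : 0 < ω) (hβ0 : 0 < β) (hβ1 : β ≤ 1) (hc : 0 < c) (hκ : 1 ≤ κ)
    (h1 : (1 + (κ : ℂ) • R) * D = 1) (h2 : D * (1 + (κ : ℂ) • R) = 1) (hD : ‖D‖ ≤ C)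
    {s : ℂ} (hs : s.re = -ω) (z : H) :
    ‖s‖ * ‖(R * (1 - D)) z‖ ≤ (1 + C) * (1 + c) * κ ^ (1 - β) * ‖z + s • R z‖ := by
  have hC : 0 ≤ C := (norm_nonneg _).trans hD
  have hκ0 : 0 < κ := by linarith
  have hcomm := commute_of_inverse hκ0 h1 h2
  have hs0 := norm_pos_of_re_eq_neg hω hs
  have hκβ : 1 ≤ κ ^ (1 - β) := Real.one_le_rpow hκ (by linarith)
  have hRz := hR s hs z
  have he := norm_nonneg (z + s • R z)
  have hcomm' : R * (1 - D) = (1 - D) * R := by rw [mul_sub, sub_mul, hcomm.eq]; simp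
  rcases le_or_gt ‖s‖ κ with hle | hgt
  · rw [hcomm', mul_apply_eq_comp]
    have hpow : ‖s‖ * ‖s‖ ^ (-β) ≤ κ ^ (1 - β) := by
      rw [mul_rpow_neg_eq hs0]
      exact Real.rpow_le_rpow hs0.le hle (by linarith)
    calc ‖s‖ * ‖(1 - D) (R z)‖ ≤ ‖s‖ * ((1 + C) * (c * ‖s‖ ^ (-β) * ‖z + s • R z‖)) := by
          gcongr
          exact (norm_one_sub_apply_le hD _).trans (by gcongr)
      _ = (1 + C) * c * (‖s‖ * ‖s‖ ^ (-β)) * ‖z + s • R z‖ := by ring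
      _ ≤ (1 + C) * (1 + c) * κ ^ (1 - β) * ‖z + s • R z‖ := by gcongr; linarith
  · have hpow : κ * ‖s‖ ^ (-β) ≤ κ ^ (1 - β) := by
      rw [← mul_rpow_neg_eq hκ0]
      exact mul_le_mul_of_nonneg_left
        (Real.rpow_le_rpow_of_nonpos hκ0 hgt.le (neg_nonpos.2 hβ0.le)) hκ0.le
    have hid : s • (R * (1 - D)) z = (1 - D) (z + s • R z) - (κ : ℂ) • D (R z) := by
      have h3 := DFunLike.congr_fun (smul_mul_of_inverse' h2) z
      have h4 : (κ : ℂ) • D (R z) = (1 - D) z := h3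
      rw [h4, map_add, add_sub_cancel_left, map_smul, hcomm', mul_apply_eq_comp]
    calc ‖s‖ * ‖(R * (1 - D)) z‖ = ‖(1 - D) (z + s • R z) - (κ : ℂ) • D (R z)‖ := by
          rw [← norm_smul, hid]
      _ ≤ (1 + C) * ‖z + s • R z‖ + κ * (C * (c * ‖s‖ ^ (-β) * ‖z + s • R z‖)) := by
          refine (norm_sub_le _ _).trans (add_le_add (norm_one_sub_apply_le hD _) ?_)
          rw [norm_smul, Complex.norm_real, Real.norm_of_nonneg hκ0.le]
          gcongr
          exact (D.le_of_opNorm_le hD _).trans (by gcongr)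
      _ = ((1 + C) + C * c * (κ * ‖s‖ ^ (-β))) * ‖z + s • R z‖ := by ring
      _ ≤ ((1 + C) * κ ^ (1 - β) + (1 + C) * c * κ ^ (1 - β)) * ‖z + s • R z‖ := by
          gcongr
          · nlinarith
          · linarith
      _ = _ := by ring

lemma ResolventDecay.norm_mul_apply_le {ω β c C : ℝ} (hR : ResolventDecay R ω β c)
    (hω : 0 < ω) (hβ0 : 0 < β) (hβ1 : β ≤ 1) (hc : 0 < c) (hκ : 1 ≤ κ)
    (h2 : D * (1 + (κ : ℂ) • R) = 1) (hD : ‖D‖ ≤ C) {s : ℂ} (hs : s.re = -ω) (z : H) :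
    ‖D (R z)‖ ≤ (1 + C) * (1 + c) * κ ^ (-β) * ‖z + s • R z‖ := by
  have hC : 0 ≤ C := (norm_nonneg _).trans hD
  have hκ0 : 0 < κ := by linarith
  have hs0 := norm_pos_of_re_eq_neg hω hs
  have hRz := hR s hs z
  have he := norm_nonneg (z + s • R z)
  rcases le_or_gt κ ‖s‖ with hle | hgt
  · calc ‖D (R z)‖ ≤ C * (c * ‖s‖ ^ (-β) * ‖z + s • R z‖) :=
          (D.le_of_opNorm_le hD _).trans (by gcongr)
      _ ≤ C * (c * κ ^ (-β) * ‖z + s • R z‖) := by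
          have := Real.rpow_le_rpow_of_nonpos hκ0 hle (neg_nonpos.2 hβ0.le)
          gcongr
      _ = C * c * (κ ^ (-β) * ‖z + s • R z‖) := by ring
      _ ≤ (1 + C) * (1 + c) * (κ ^ (-β) * ‖z + s • R z‖) := by gcongr <;> linarith
      _ = _ := by ring
  · have h4 : (κ : ℂ) • D (R z) = (1 - D) z := DFunLike.congr_fun (smul_mul_of_inverse' h2) z
    have hz : ‖z‖ ≤ (1 + c) * κ ^ (1 - β) * ‖z + s • R z‖ := by
      have hκβ : 1 ≤ κ ^ (1 - β) := Real.one_le_rpow hκ (by linarith)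
      have hpow : ‖s‖ * ‖s‖ ^ (-β) ≤ κ ^ (1 - β) := by
        rw [mul_rpow_neg_eq hs0]
        exact Real.rpow_le_rpow hs0.le hgt.le (by linarith)
      calc ‖z‖ = ‖(z + s • R z) - s • R z‖ := by rw [add_sub_cancel_right]
        _ ≤ ‖z + s • R z‖ + ‖s‖ * (c * ‖s‖ ^ (-β) * ‖z + s • R z‖) := by
            refine (norm_sub_le _ _).trans ?_
            rw [norm_smul]
            gcongr
        _ = (1 + c * (‖s‖ * ‖s‖ ^ (-β))) * ‖z + s • R z‖ := by ring
        _ ≤ (1 * κ ^ (1 - β) + c * κ ^ (1 - β)) * ‖z + s • R z‖ := by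
            gcongr
            linarith
        _ = _ := by ring
    refine le_of_mul_le_mul_left ?_ hκ0
    calc κ * ‖D (R z)‖ = ‖(1 - D) z‖ := by
          rw [← h4, norm_smul, Complex.norm_real, Real.norm_of_nonneg hκ0.le]
      _ ≤ (1 + C) * ((1 + c) * κ ^ (1 - β) * ‖z + s • R z‖) :=
          (norm_one_sub_apply_le hD z).trans (by gcongr)
      _ = _ := by
          rw [← mul_rpow_neg_eq hκ0]
          ring

end Yosida

lemma ResolventDecay.norm_cayley_pow_mul_le [CompleteSpace H] {R : H →L[ℂ] H} {ω β c C : ℝ}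
    (hR : ResolventDecay R ω β c) (hω : 0 < ω) (hβ0 : 0 < β) (hβ1 : β ≤ 1) (hc : 0 < c)
    (hC : ∀ n, ‖(1 - ((2 * ω : ℝ) : ℂ) • R) ^ n‖ ≤ C) {n : ℕ} (hn : 2 ≤ n) :
    ‖(1 - ((2 * ω : ℝ) : ℂ) • R) ^ n * R‖
      ≤ (6 * C ^ 2 * ((1 + C) * (1 + c) / (2 * ω)) + C * (1 + C)) * (n : ℝ) ^ (-(1 / (2 - β))) := by
  set V := 1 - ((2 * ω : ℝ) : ℂ) • R with hV
  have hC0 : 0 ≤ C := (norm_nonneg _).trans (hC 0)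
  have hn1 : (1 : ℝ) ≤ n := by exact_mod_cast (by lia : 1 ≤ n)
  have hn0 : (0 : ℝ) < n := by linarith
  have hβ2 : 0 < 2 - β := by linarith
  set κ : ℝ := (n : ℝ) ^ (1 / (2 - β)) with hκ
  have hκ1 : 1 ≤ κ := Real.one_le_rpow hn1 (by positivity)
  have hκ0 : 0 < κ := by linarith
  have hκinv : (n : ℝ) ^ (-(1 / (2 - β))) = κ⁻¹ := Real.rpow_neg hn0.le _
  have hκpow : κ ^ (1 - β) / n = κ⁻¹ := by
    rw [hκ, ← Real.rpow_mul hn0.le, ← Real.rpow_neg hn0.le, div_eq_iff hn0.ne',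
      ← Real.rpow_add_one hn0.ne']
    congr 1
    field_simp
    ring
  obtain ⟨D, h1, h2, hD⟩ := exists_inverse_one_add_smul hω hC hκ0
  have hcomm := commute_of_inverse hκ0 h1 h2
  have hVR : Commute V R := (Commute.one_left R).sub_left ((Commute.refl R).smul_left _)
  have hVD : Commute V D := (Commute.one_left D).sub_left (hcomm.smul_left _)
  have hQ : Commute V (R * (1 - D)) := hVR.mul_right ((Commute.one_right V).sub_right hVD)
  have hmain := norm_pow_mul_le_of_circle_bound hC hQ
    (K := (1 + C) * (1 + c) * κ ^ (1 - β) / (2 * ω)) (by positivity) (fun l hl hl1 y => by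
      have hl0 : l - 1 ≠ 0 := sub_ne_zero.2 hl1
      set s : ℂ := ((2 * ω : ℝ) : ℂ) / (l - 1) with hs
      have hsre : s.re = -ω := by
        have h7 : l.re ^ 2 + l.im ^ 2 = 1 := by
          have := Complex.sq_norm l
          rw [hl, Complex.normSq_apply] at this
          linarith
        have h8 : (l.re - 1) ^ 2 + l.im ^ 2 ≠ 0 := by
          have := (Complex.normSq_pos.2 hl0).ne'
          rw [Complex.normSq_apply] at this
          simpa [sq] using this
        rw [hs, Complex.div_re, Complex.normSq_apply]
        simp only [Complex.ofReal_re, Complex.ofReal_im, Complex.sub_re, Complex.one_re,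
          Complex.sub_im, Complex.one_im, sub_zero, zero_mul, zero_div, add_zero, ← sq]
        rw [div_eq_iff h8]
        linear_combination ω * h7
      have hs0 := norm_pos_of_re_eq_neg hω hsre
      have hs1 : s ≠ 0 := norm_pos_iff.1 hs0
      have hid : l • y - V y = (((2 * ω : ℝ) : ℂ) / s) • (y + s • R y) := by
        have h5 : ((2 * ω : ℝ) : ℂ) / s = l - 1 := by
          have : ((2 * ω : ℝ) : ℂ) ≠ 0 := by exact_mod_cast (by positivity)
          rw [hs]
          field_simp
        rw [smul_add, smul_smul, div_mul_cancel₀ _ hs1, h5, hV, sub_apply,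
          smul_apply, one_apply_eq_self]
        module
      rw [hid, norm_smul, norm_div, Complex.norm_real, Real.norm_of_nonneg (by positivity)]
      refine le_of_mul_le_mul_left ?_ hs0
      refine (hR.norm_mul_one_sub_apply_le hω hβ0 hβ1 hc hκ1 h1 h2 hD hsre y).trans_eq ?_
      field_simp) hn
  have hRD : ‖R * D‖ ≤ (1 + C) * κ⁻¹ := by
    have h6 : R * D = (κ : ℂ)⁻¹ • (1 - D) := by
      rw [← smul_mul_of_inverse h1, smul_smul, inv_mul_cancel₀ (by exact_mod_cast hκ0.ne'),
        one_smul]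
    rw [h6, norm_smul, norm_inv, Complex.norm_real, Real.norm_of_nonneg hκ0.le, mul_comm]
    gcongr
    exact ContinuousLinearMap.opNorm_le_bound _ (by positivity) (norm_one_sub_apply_le hD)
  have hsplit : V ^ n * R = V ^ n * (R * (1 - D)) + V ^ n * (R * D) := by
    rw [mul_sub, mul_one]
    noncomm_ring
  rw [hsplit, hκinv]
  calc _ ≤ 6 * C ^ 2 * ((1 + C) * (1 + c) * κ ^ (1 - β) / (2 * ω)) / n + C * ((1 + C) * κ⁻¹) :=
        (norm_add_le _ _).trans (add_le_add hmain
          ((norm_mul_le _ _).trans (mul_le_mul (hC n) hRD (norm_nonneg _) hC0)))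
    _ = 6 * C ^ 2 * ((1 + C) * (1 + c) / (2 * ω)) * (κ ^ (1 - β) / n) + C * (1 + C) * κ⁻¹ := by
        ring
    _ = _ := by rw [hκpow]; ring

lemma le_norm_of_re_eq_neg {s : ℂ} {ω : ℝ} (hs : s.re = -ω) : ω ≤ ‖s‖ := by
  have := (abs_le.1 (Complex.abs_re_le_norm s)).1
  linarith

lemma norm_pow_smul_sub_pow_apply_le {V : H →L[ℂ] H} {C : ℝ} (hC : ∀ n, ‖V ^ n‖ ≤ C) {l : ℂ}
    (hl : ‖l‖ = 1) (z : H) (n : ℕ) : ‖l ^ n • z - (V ^ n) z‖ ≤ n * (C * ‖l • z - V z‖) := by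
  induction n with
  | zero => simp
  | succ n ih =>
    have h : l ^ (n + 1) • z - (V ^ (n + 1)) z
        = l • (l ^ n • z - (V ^ n) z) + (V ^ n) (l • z - V z) := by
      rw [pow_succ V, mul_apply_eq_comp, map_sub, map_smul, smul_sub, smul_smul, ← pow_succ']
      module
    rw [h]
    refine (norm_add_le _ _).trans ?_
    rw [norm_smul, hl, one_mul]
    rw [Nat.cast_succ]
    linarith [(V ^ n).le_of_opNorm_le (hC n) (l • z - V z)]

lemma norm_one_add_div {s : ℂ} {ω : ℝ} (hω : 0 < ω) (hs : s.re = -ω) :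
    ‖1 + ((2 * ω : ℝ) : ℂ) / s‖ = 1 := by
  have hs0 := norm_pos_of_re_eq_neg hω hs
  have hs1 : s ≠ 0 := norm_pos_iff.1 hs0
  have h1 : 1 + ((2 * ω : ℝ) : ℂ) / s = -(starRingEnd ℂ s) / s := by
    rw [eq_div_iff hs1, add_mul, div_mul_cancel₀ _ hs1, one_mul]
    apply Complex.ext
    · simp [hs]
      ring
    · simp
  rw [h1, norm_div, norm_neg, RCLike.norm_conj, div_self hs0.ne']

lemma exists_resolventDecay_of_cayley {R : H →L[ℂ] H} {ω β C c₀ : ℝ} (hω : 0 < ω)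
    (hβ1 : β ≤ 1) (hC : ∀ n, ‖(1 - ((2 * ω : ℝ) : ℂ) • R) ^ n‖ ≤ C) (hc₀ : 0 < c₀) (n₀ : ℕ)
    (h : ∀ n, n₀ ≤ n → ‖(1 - ((2 * ω : ℝ) : ℂ) • R) ^ n * R‖ ≤ c₀ * (n : ℝ) ^ (-(1 / (2 - β)))) :
    ∃ c, 0 < c ∧ ResolventDecay R ω β c := by
  set V := 1 - ((2 * ω : ℝ) : ℂ) • R with hV
  have hC0 : 0 ≤ C := (norm_nonneg _).trans (hC 0)
  have hβ2 : 0 < 2 - β := by linarith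
  have hp : 0 < ω ^ (1 - β) := Real.rpow_pos_of_pos hω _
  refine ⟨(1 + 2 * C * (1 + 2 * (n₀ + 2))) / ω ^ (1 - β) + 4 * C * ω * (2 * c₀) ^ (2 - β),
    by positivity, fun s hs z => ?_⟩
  have hs0 := norm_pos_of_re_eq_neg hω hs
  have hsω := le_norm_of_re_eq_neg hs
  have hs1 : s ≠ 0 := norm_pos_iff.1 hs0
  set e := ‖z + s • R z‖ with he
  have he0 : 0 ≤ e := norm_nonneg _
  set r := 2 * ω / ‖s‖ with hr
  have hr0 : 0 < r := by positivity
  set μ : ℂ := ((2 * ω : ℝ) : ℂ) / s with hμ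
  have hμr : ‖μ‖ = r := by
    rw [hμ, norm_div, Complex.norm_real, Real.norm_of_nonneg (by positivity)]
  have hVz : V z = z - ((2 * ω : ℝ) : ℂ) • R z := by
    rw [hV, sub_apply, smul_apply, one_apply_eq_self]
  have hw : (1 + μ) • z - V z = μ • (z + s • R z) := by
    rw [smul_add, smul_smul, hμ, div_mul_cancel₀ _ hs1, hVz]
    module
  have hwn : ‖(1 + μ) • z - V z‖ = r * e := by rw [hw, norm_smul, hμr]
  set n : ℕ := ⌈(2 * c₀ * ‖s‖) ^ (2 - β)⌉₊ + n₀ + 1 with hn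
  have hn1 : (2 * c₀ * ‖s‖) ^ (2 - β) ≤ n := by
    have := Nat.le_ceil ((2 * c₀ * ‖s‖) ^ (2 - β))
    push_cast [hn]
    have : (0 : ℝ) ≤ n₀ := n₀.cast_nonneg
    linarith
  have hn2 : n ≤ (2 * c₀ * ‖s‖) ^ (2 - β) + n₀ + 2 := by
    have := Nat.ceil_lt_add_one (a := (2 * c₀ * ‖s‖) ^ (2 - β)) (by positivity)
    push_cast [hn]
    linarith
  have hdecay : 2 * ω * ‖V ^ n * R‖ ≤ r / 2 := by
    have h1 := h n (by lia)
    have h2 : (n : ℝ) ^ (-(1 / (2 - β))) ≤ (2 * c₀ * ‖s‖)⁻¹ := by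
      refine (Real.rpow_le_rpow_of_nonpos (by positivity) hn1
        (neg_nonpos.2 (by positivity))).trans_eq ?_
      rw [← Real.rpow_mul (by positivity), ← Real.rpow_neg_one]
      congr 1
      field_simp
    calc 2 * ω * ‖V ^ n * R‖ ≤ 2 * ω * (c₀ * (2 * c₀ * ‖s‖)⁻¹) := by
          gcongr
          exact h1.trans (by gcongr)
      _ = r / 2 := by rw [hr]; field_simp
  have hVn : r * ‖(V ^ n) z‖ ≤ C * (r * e) + r / 2 * ‖z‖ := by
    have h3 : μ • (V ^ n) z
        = (V ^ n) ((1 + μ) • z - V z) - ((2 * ω : ℝ) : ℂ) • (V ^ n * R) z := by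
      rw [hVz, mul_apply_eq_comp]
      simp only [map_sub, map_smul]
      module
    rw [← hμr, ← norm_smul, h3]
    refine (norm_sub_le _ _).trans (add_le_add ?_ ?_)
    · rw [hμr, ← hwn]
      exact (V ^ n).le_of_opNorm_le (hC n) _
    · rw [norm_smul, Complex.norm_real, Real.norm_of_nonneg (by positivity), hμr]
      calc _ ≤ 2 * ω * (‖V ^ n * R‖ * ‖z‖) := by gcongr; exact (V ^ n * R).le_opNorm z
        _ = 2 * ω * ‖V ^ n * R‖ * ‖z‖ := by ring
        _ ≤ _ := by gcongr
  have hz1 : ‖z‖ ≤ ‖(V ^ n) z‖ + n * (C * (r * e)) := by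
    have hl := norm_one_add_div hω hs
    have h4 := norm_pow_smul_sub_pow_apply_le hC hl z n
    rw [← hμ, hwn] at h4
    calc ‖z‖ = ‖(1 + μ) ^ n • z‖ := by rw [norm_smul, norm_pow, hl, one_pow, one_mul]
      _ = ‖((1 + μ) ^ n • z - (V ^ n) z) + (V ^ n) z‖ := by rw [sub_add_cancel]
      _ ≤ _ := (norm_add_le _ _).trans (by linarith)
  have hz2 : ‖z‖ ≤ 2 * C * (1 + r * n) * e := by
    have h5 : r * ‖z‖ ≤ r * ‖(V ^ n) z‖ + r * (n * (C * (r * e))) := by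
      rw [← mul_add]
      gcongr
    refine le_of_mul_le_mul_left ?_ hr0
    linarith
  have hsr : s • R z = (z + s • R z) - z := by rw [add_sub_cancel_left]
  have hRz : ‖s‖ * ‖R z‖ ≤ (1 + 2 * C * (1 + r * n)) * e := by
    rw [← norm_smul, hsr]
    refine (norm_sub_le _ _).trans ?_
    linarith
  have hsp : 1 ≤ ‖s‖ ^ (1 - β) / ω ^ (1 - β) := by
    rw [one_le_div hp]
    exact Real.rpow_le_rpow hω.le hsω (by linarith)
  have hrn : r * n ≤ 2 * ω * (2 * c₀) ^ (2 - β) * ‖s‖ ^ (1 - β) + 2 * (n₀ + 2) := by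
    have h6 : ‖s‖ ^ (2 - β) = ‖s‖ * ‖s‖ ^ (1 - β) := by
      rw [show 2 - β = 1 + (1 - β) by ring, Real.rpow_add hs0, Real.rpow_one]
    have h7 : r ≤ 2 := by
      rw [hr, div_le_iff₀ hs0]
      linarith
    calc r * n ≤ r * ((2 * c₀ * ‖s‖) ^ (2 - β) + n₀ + 2) := by gcongr
      _ = r * ‖s‖ * (2 * c₀) ^ (2 - β) * ‖s‖ ^ (1 - β) + r * (n₀ + 2) := by
          rw [Real.mul_rpow (by positivity) hs0.le, h6]
          ring
      _ ≤ _ := by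
          rw [show r * ‖s‖ = 2 * ω by rw [hr]; field_simp]
          gcongr
  refine le_of_mul_le_mul_left (hRz.trans ?_) hs0
  calc (1 + 2 * C * (1 + r * n)) * e
      ≤ (1 + 2 * C * (1 + (2 * ω * (2 * c₀) ^ (2 - β) * ‖s‖ ^ (1 - β) + 2 * (n₀ + 2)))) * e := by
        gcongr
    _ = ((1 + 2 * C * (1 + 2 * (n₀ + 2))) * 1
          + 4 * C * ω * (2 * c₀) ^ (2 - β) * ‖s‖ ^ (1 - β)) * e := by ring
    _ ≤ ((1 + 2 * C * (1 + 2 * (n₀ + 2))) * (‖s‖ ^ (1 - β) / ω ^ (1 - β))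
          + 4 * C * ω * (2 * c₀) ^ (2 - β) * ‖s‖ ^ (1 - β)) * e := by gcongr
    _ = _ := by rw [← mul_rpow_neg_eq hs0]; ring

lemma IsResolventAt.exists_bound_of_isCompact {A : H →ₗ.[ℂ] H} {lam : ℂ} {R : H →L[ℂ] H}
    (hR : IsResolventAt A lam R)
    (hspec : ∀ η : ℝ, ∃ R : H →L[ℂ] H, IsResolventAt A (Complex.I * η) R) {S : Set ℝ}
    (hS : IsCompact S) :
    ∃ c, 0 < c ∧ ∀ η ∈ S, ∀ z, ‖R z‖ ≤ c * ‖z + (Complex.I * η - lam) • R z‖ := by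
  refine hS.induction_on (p := fun S : Set ℝ => ∃ c, 0 < c ∧ ∀ η ∈ S, ∀ z,
    ‖R z‖ ≤ c * ‖z + (Complex.I * η - lam) • R z‖) ⟨1, one_pos, by simp⟩ ?_ ?_ ?_
  · rintro S S' hSS' ⟨c, hc, h⟩
    exact ⟨c, hc, fun η hη => h η (hSS' hη)⟩
  · rintro S S' ⟨c, hc, h⟩ ⟨c', hc', h'⟩
    refine ⟨max c c', lt_max_of_lt_left hc, fun η hη z => ?_⟩
    rcases hη with hη | hη
    · exact (h η hη z).trans (by gcongr; exact le_max_left _ _)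
    · exact (h' η hη z).trans (by gcongr; exact le_max_right _ _)
  · intro η₀ _
    obtain ⟨R₀, hR₀⟩ := hspec η₀
    set c := ‖R₀‖ + 1 with hc
    have hc0 : 0 < c := by positivity
    refine ⟨Metric.ball η₀ (1 / (2 * c)),
      mem_nhdsWithin_of_mem_nhds (Metric.ball_mem_nhds _ (by positivity)), 2 * c, by positivity,
      fun η hη z => ?_⟩
    obtain ⟨hx, hz⟩ := hR.1 z
    have h1 : R₀ ((z + (Complex.I * η - lam) • R z) - (Complex.I * ((η - η₀ : ℝ) : ℂ)) • R z)
        = R z := by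
      refine (congrArg R₀ ?_).trans (hR₀.2 ⟨R z, hx⟩)
      rw [eq_sub_of_add_eq' hz]
      push_cast
      module
    have h2 : ‖R z‖ ≤ c * (‖z + (Complex.I * η - lam) • R z‖ + |η - η₀| * ‖R z‖) := by
      rw [← h1]
      refine (R₀.le_opNorm _).trans ?_
      rw [h1]
      gcongr
      · linarith
      · refine (norm_sub_le _ _).trans_eq ?_
        rw [norm_smul, norm_mul, Complex.norm_I, one_mul, Complex.norm_real, Real.norm_eq_abs]
    have h3 : c * |η - η₀| ≤ 1 / 2 := by
      rw [Metric.mem_ball, Real.dist_eq, lt_div_iff₀ (by positivity)] at hη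
      linarith
    have h4 := mul_le_mul_of_nonneg_right h3 (norm_nonneg (R z))
    linarith

lemma IsResolventAt.norm_apply_le_norm_semigroup_apply_add [CompleteSpace H]
    {T : ℝ → H →L[ℂ] H} {A : H →ₗ.[ℂ] H} (hT : IsC0Semigroup T) (hgen : IsGenerator T A)
    {ω : ℝ} {R : H →L[ℂ] H} (hR : IsResolventAt A (ω : ℂ) R) {M : ℝ}
    (hM : ∀ t, 0 ≤ t → t ≤ 1 → ‖T t‖ ≤ M) {τ : ℝ} (hτ : 0 ≤ τ) (hτ1 : τ ≤ 1) (η : ℝ) (z : H) :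
    ‖R z‖ ≤ ‖T τ (R z)‖ + τ * (M * ‖z + (Complex.I * η - ω) • R z‖) := by
  set g := z + (Complex.I * η - ω) • R z with hg
  set p : ℝ → ℂ := fun t => Complex.exp (-(Complex.I * η) * t) with hp
  have hpn : ∀ t, ‖p t‖ = 1 := fun t => by
    simp [hp, Complex.norm_exp]
  have hdp : ∀ t, HasDerivAt p (-(Complex.I * η) * p t) t := fun t => by
    have h1 : HasDerivAt (fun t : ℝ => (t : ℂ)) 1 t := Complex.ofRealCLM.hasDerivAt
    refine ((h1.const_mul (-(Complex.I * η))).cexp).congr_deriv ?_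
    simp only [hp]
    ring
  have hpc : Continuous p := by fun_prop
  have hint := hR.integral_deriv_smul_semigroup hT hgen hτ hdp (by fun_prop) z
  have hbound : ‖∫ t in 0..τ, (p t • -(T t (z - (ω : ℂ) • R z))
      + (-(Complex.I * η) * p t) • T t (R z))‖ ≤ M * ‖g‖ * |τ - 0| := by
    refine intervalIntegral.norm_integral_le_of_norm_le_const fun t ht => ?_
    rw [Set.uIoc_of_le hτ] at ht
    have h2 : p t • -(T t (z - (ω : ℂ) • R z)) + (-(Complex.I * η) * p t) • T t (R z)
        = -(p t • T t g) := by
      simp only [hg, map_sub, map_add, map_smul]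
      module
    rw [h2, norm_neg, norm_smul, hpn, one_mul]
    exact (T t).le_of_opNorm_le (hM t ht.1.le (ht.2.trans hτ1)) g
  have hp0 : p 0 = 1 := by simp [hp]
  rw [hint, hp0, one_smul, sub_zero, abs_of_nonneg hτ] at hbound
  calc ‖R z‖ = ‖p τ • T τ (R z) - (p τ • T τ (R z) - R z)‖ := by rw [sub_sub_cancel]
    _ ≤ ‖T τ (R z)‖ + M * ‖g‖ * τ := by
        refine (norm_sub_le _ _).trans (add_le_add ?_ hbound)
        rw [norm_smul, hpn, one_mul]
    _ = _ := by ring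

lemma IsResolventAt.abs_mul_norm_semigroup_apply_le
    {T : ℝ → H →L[ℂ] H} {A : H →ₗ.[ℂ] H} (hT : IsC0Semigroup T) (hgen : IsGenerator T A)
    {ω : ℝ} {R : H →L[ℂ] H} (hR : IsResolventAt A (ω : ℂ) R) {M : ℝ} {τ : ℝ} (hτ : 0 ≤ τ)
    (hM : ‖T τ‖ ≤ M) {B : H →L[ℂ] H} (hB : ∀ x, ∃ hx : T τ x ∈ A.domain, B x = A ⟨T τ x, hx⟩)
    (η : ℝ) (z : H) :
    |η| * ‖T τ (R z)‖ ≤ M * ‖z + (Complex.I * η - ω) • R z‖ + ‖B‖ * ‖R z‖ := by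
  have hcomm : T τ (R z) = R (T τ z) :=
    DFunLike.congr_fun (hR.commute_semigroup hT hgen hτ).eq z
  obtain ⟨hx, hz⟩ := hR.1 (T τ z)
  obtain ⟨hx', hBz⟩ := hB (R z)
  have hBR : B (R z) = T τ z - (ω : ℂ) • T τ (R z) := by
    rw [hBz]
    simp only [hcomm]
    exact eq_sub_of_add_eq' hz
  have h : (Complex.I * η) • T τ (R z)
      = T τ (z + (Complex.I * η - ω) • R z) - B (R z) := by
    rw [hBR, map_add, map_smul]
    module
  have hn : |η| * ‖T τ (R z)‖ = ‖(Complex.I * η) • T τ (R z)‖ := by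
    rw [norm_smul, norm_mul, Complex.norm_I, one_mul, Complex.norm_real, Real.norm_eq_abs]
  rw [hn, h]
  exact (norm_sub_le _ _).trans (add_le_add ((T τ).le_of_opNorm_le hM _) (B.le_opNorm _))

lemma InCrandallPazy.exists_resolventDecay [CompleteSpace H]
    {T : ℝ → H →L[ℂ] H} {A : H →ₗ.[ℂ] H} {β : ℝ} (hCP : InCrandallPazy T A β)
    (hT : IsC0Semigroup T) (hgen : IsGenerator T A)
    (hspec : ∀ η : ℝ, ∃ R : H →L[ℂ] H, IsResolventAt A (Complex.I * η) R)
    {ω : ℝ} (hω : 0 < ω) {R : H →L[ℂ] H} (hR : IsResolventAt A (ω : ℂ) R)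
    (hβ0 : 0 < β) (hβ1 : β ≤ 1) : ∃ c, 0 < c ∧ ResolventDecay R ω β c := by
  obtain ⟨M, hM1, hM⟩ := hT.exists_bound
  obtain ⟨B, hB, N, t₀, hN, ht₀, hBN⟩ := hCP
  have hM0 : 0 < M := by linarith
  set t₁ := min t₀ 1 with ht₁
  have ht₁0 : 0 < t₁ := lt_min ht₀ one_pos
  set η₁ := max 1 (2 * N * t₁ ^ (-(1 / β))) with hη₁
  have hη₁0 : 0 < η₁ := lt_max_of_lt_left one_pos
  obtain ⟨c₂, hc₂, hsmall⟩ := hR.exists_bound_of_isCompact hspec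
    (isCompact_Icc : IsCompact (Set.Icc (-η₁) η₁))
  set c₁ := 2 * M * (1 + (2 * N) ^ β) with hc₁
  have hc₁0 : 0 < c₁ := by positivity
  refine ⟨c₁ * (1 + ω) ^ β + c₂ * (η₁ + ω) ^ β, by positivity, fun s hs z => ?_⟩
  have hs0 := norm_pos_of_re_eq_neg hω hs
  set η := s.im with hη
  have hsη : s = Complex.I * η - ω := by
    apply Complex.ext <;> simp [hs, hη]
  have hsn : ‖s‖ ≤ |η| + ω := by
    have := Complex.norm_le_abs_re_add_abs_im s
    rw [hs, abs_neg, abs_of_pos hω] at this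
    linarith
  set e := ‖z + s • R z‖ with he
  have he0 : 0 ≤ e := norm_nonneg _
  have hsβ : 0 < ‖s‖ ^ (-β) := Real.rpow_pos_of_pos hs0 _
  rcases le_or_gt |η| η₁ with hle | hgt
  · have h1 : ‖R z‖ ≤ c₂ * e := by
      rw [he, hsη]
      exact hsmall η (abs_le.1 hle) z
    have h2 : 1 ≤ (η₁ + ω) ^ β * ‖s‖ ^ (-β) := by
      rw [Real.rpow_neg hs0.le, ← div_eq_mul_inv, one_le_div (by positivity)]
      exact Real.rpow_le_rpow hs0.le (by linarith) hβ0.le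
    calc ‖R z‖ ≤ c₂ * 1 * e := by linarith
      _ ≤ c₂ * ((η₁ + ω) ^ β * ‖s‖ ^ (-β)) * e := by gcongr
      _ ≤ c₁ * (1 + ω) ^ β * ‖s‖ ^ (-β) * e + c₂ * ((η₁ + ω) ^ β * ‖s‖ ^ (-β)) * e :=
          le_add_of_nonneg_left (by positivity)
      _ = _ := by ring
  · have hη1 : 1 < |η| := (le_max_left _ _).trans_lt hgt
    have hη0 : 0 < |η| := by linarith
    set τ := (2 * N / |η|) ^ β with hτ
    have hτ0 : 0 < τ := by positivity
    have hττ : τ ^ (-(1 / β)) = |η| / (2 * N) := by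
      rw [hτ, ← Real.rpow_mul (by positivity), mul_neg, mul_one_div_cancel hβ0.ne',
        Real.rpow_neg_one, inv_div]
    have hτ1 : τ ≤ t₁ := by
      have h3 : 2 * N * t₁ ^ (-(1 / β)) < |η| := (le_max_right _ _).trans_lt hgt
      have h4 : 2 * N / |η| ≤ t₁ ^ (1 / β) := by
        rw [Real.rpow_neg ht₁0.le, ← div_eq_mul_inv, div_lt_iff₀ (by positivity)] at h3
        rw [div_le_iff₀ hη0]
        linarith
      calc τ ≤ (t₁ ^ (1 / β)) ^ β := Real.rpow_le_rpow (by positivity) h4 hβ0.le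
        _ = t₁ := by rw [← Real.rpow_mul ht₁0.le, one_div_mul_cancel hβ0.ne', Real.rpow_one]
    have hB1 : ‖B τ‖ ≤ |η| / 2 := by
      refine (hBN τ hτ0 (hτ1.trans (min_le_left _ _))).trans_eq ?_
      rw [hττ]
      field_simp
    have hτ1' := hτ1.trans (min_le_right _ _)
    have h5 := hR.norm_apply_le_norm_semigroup_apply_add hT hgen hM hτ0.le hτ1' η z
    have h6 := hR.abs_mul_norm_semigroup_apply_le hT hgen hτ0.le (hM τ hτ0.le hτ1') (hB τ hτ0) η z
    rw [← hsη, ← he] at h5 h6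
    have h7 : |η| * ‖R z‖ ≤ |η| * (2 * M * (|η|⁻¹ + τ) * e) := by
      have h8 := mul_le_mul_of_nonneg_left h5 hη0.le
      have h9 := mul_le_mul_of_nonneg_right hB1 (norm_nonneg (R z))
      have h10 : |η| * (2 * M * (|η|⁻¹ + τ) * e) = 2 * (M * e + |η| * (τ * (M * e))) := by
        field_simp
      rw [h10]
      linarith
    have hinv : |η|⁻¹ ≤ |η| ^ (-β) := by
      rw [← Real.rpow_neg_one]
      exact Real.rpow_le_rpow_of_exponent_le hη1.le (by linarith)
    have hτ2 : τ = (2 * N) ^ β * |η| ^ (-β) := by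
      rw [hτ, Real.div_rpow (by positivity) hη0.le, Real.rpow_neg hη0.le, div_eq_mul_inv]
    have hcomp : |η| ^ (-β) ≤ (1 + ω) ^ β * ‖s‖ ^ (-β) := by
      rw [Real.rpow_neg hη0.le, Real.rpow_neg hs0.le, ← div_eq_mul_inv, ← one_div,
        div_le_div_iff₀ (by positivity) (by positivity), one_mul,
        ← Real.mul_rpow (by positivity) hη0.le]
      exact Real.rpow_le_rpow hs0.le (by nlinarith) hβ0.le
    calc ‖R z‖ ≤ 2 * M * (|η|⁻¹ + τ) * e := le_of_mul_le_mul_left h7 hη0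
      _ ≤ 2 * M * (|η| ^ (-β) + (2 * N) ^ β * |η| ^ (-β)) * e := by rw [← hτ2]; gcongr
      _ = c₁ * |η| ^ (-β) * e := by rw [hc₁]; ring
      _ ≤ c₁ * ((1 + ω) ^ β * ‖s‖ ^ (-β)) * e := by gcongr
      _ ≤ c₁ * ((1 + ω) ^ β * ‖s‖ ^ (-β)) * e + c₂ * (η₁ + ω) ^ β * ‖s‖ ^ (-β) * e :=
          le_add_of_nonneg_right (by positivity)
      _ = _ := by ring

lemma commute_of_commute_of_inverse {𝓐 : Type*} [Monoid 𝓐] {X F D : 𝓐} (h : Commute X F)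
    (h1 : F * D = 1) (h2 : D * F = 1) : Commute X D :=
  calc X * D = D * F * X * D := by rw [h2, one_mul]
    _ = D * (X * F) * D := by rw [h.eq]; simp only [mul_assoc]
    _ = D * X := by rw [mul_assoc, mul_assoc, h1, mul_one]

/-- If the regularisations `D k = (1 + 2 ^ k κ₀ R)⁻¹` become small on the range of `S` at a
geometric rate, then a power of `S` maps into the range of `R`, with a quantitative bound. -/
lemma exists_mul_eq_pow_of_geometric [CompleteSpace H] {R S : H →L[ℂ] H}
    (hinj : Function.Injective R) {κ₀ : ℝ} (hκ₀ : 0 < κ₀) {D : ℕ → H →L[ℂ] H}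
    (h1 : ∀ k, (1 + ((2 ^ k * κ₀ : ℝ) : ℂ) • R) * D k = 1)
    (h2 : ∀ k, D k * (1 + ((2 ^ k * κ₀ : ℝ) : ℂ) • R) = 1) {C : ℝ} (hC1 : 1 ≤ C)
    (hD : ∀ k, ‖D k‖ ≤ C) (hS : ∀ k, Commute (D k) S) {K b : ℝ} (hK : 0 ≤ K) (hb0 : 0 < b)
    (hb1 : b < 1) (hDS : ∀ k, ‖D k * S‖ ≤ K * b ^ k) {m : ℕ} (hm : 1 ≤ m)
    (hbm : 2 * b ^ (m + 1) < 1) {M : ℝ} (hM : ‖S ^ (m + 1)‖ ≤ M) :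
    ∃ B : H →L[ℂ] H, R * B = S ^ (m + 1) ∧
      ‖B‖ ≤ (m * C ^ m * M + m * K ^ (m + 1) / (1 - 2 * b ^ (m + 1))) * κ₀ := by
  have hC0 : 0 ≤ C := by linarith
  have hM0 : 0 ≤ M := (norm_nonneg _).trans hM
  have hκ : ∀ k : ℕ, 0 < 2 ^ k * κ₀ := fun k => by positivity
  have hRD : ∀ k, Commute R (D k) := fun k => commute_of_inverse (hκ k) (h1 k) (h2 k)
  have hDD : ∀ k l, Commute (D k) (D l) := fun k l => commute_of_commute_of_inverse
    ((Commute.one_right _).add_right ((hRD k).symm.smul_right _)) (h1 l) (h2 l)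
  have hpow : ∀ k j, ‖D k ^ j‖ ≤ C ^ j := fun k j => by
    rcases j.eq_zero_or_pos with rfl | hj
    · rw [pow_zero, pow_zero]
      exact ContinuousLinearMap.norm_id_le
    · exact (norm_pow_le' _ hj).trans (by gcongr; exact hD k)
  have hcancel : ∀ X Y : H →L[ℂ] H, R * X = R * Y → X = Y := fun X Y h =>
    ContinuousLinearMap.ext fun x => hinj (DFunLike.congr_fun h x)
  set E : ℕ → H →L[ℂ] H :=
    fun k => ((2 ^ k * κ₀ : ℝ) : ℂ) • (D k * ∑ j ∈ Finset.range m, D k ^ j) with hE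
  have hRE : ∀ k, R * E k = 1 - D k ^ m := fun k => by
    rw [hE]
    simp only
    rw [mul_smul_comm, ← mul_assoc, ← smul_mul_assoc, smul_mul_of_inverse (h1 k), mul_neg_geom_sum]
  have hsub : ∀ k, D k - D (k + 1) = ((2 ^ k * κ₀ : ℝ) : ℂ) • (R * (D k * D (k + 1))) := fun k => by
    have h3 : D k * (1 + ((2 ^ (k + 1) * κ₀ : ℝ) : ℂ) • R) * D (k + 1)
        - D k * (1 + ((2 ^ k * κ₀ : ℝ) : ℂ) • R) * D (k + 1) = D k - D (k + 1) := by
      rw [mul_assoc, h1, h2, mul_one, one_mul]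
    rw [← h3, ← sub_mul, ← mul_sub, add_sub_add_left_eq_sub, ← sub_smul, mul_smul_comm,
      smul_mul_assoc, ← (hRD k).eq, mul_assoc]
    congr 1
    push_cast
    ring
  have hdiff : ∀ k, E (k + 1) - E k = ((2 ^ k * κ₀ : ℝ) : ℂ) •
      (D k * D (k + 1) * ∑ j ∈ Finset.range m, D k ^ j * D (k + 1) ^ (m - 1 - j)) := fun k => by
    apply hcancel
    rw [mul_sub, hRE, hRE, sub_sub_sub_cancel_left, ← (hDD k (k + 1)).mul_geom_sum₂ m, hsub,
      smul_mul_assoc, mul_smul_comm, mul_assoc R]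
  have hterm : ∀ k, ∀ j ∈ Finset.range m,
      ‖D k * D (k + 1) * (D k ^ j * D (k + 1) ^ (m - 1 - j)) * S ^ (m + 1)‖
        ≤ K ^ (m + 1) * (b ^ (m + 1)) ^ k := fun k j hj => by
    have hj' : j < m := Finset.mem_range.1 hj
    have hmj : m + 1 = (j + 1) + (m - 1 - j + 1) := by lia
    have h4 : D k * D (k + 1) * (D k ^ j * D (k + 1) ^ (m - 1 - j)) * S ^ (m + 1)
        = (D k * S) ^ (j + 1) * (D (k + 1) * S) ^ (m - 1 - j + 1) := by
      rw [(hS k).mul_pow, (hS (k + 1)).mul_pow, hmj, pow_add S,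
        (hDD k (k + 1)).symm.pow_right j |>.mul_mul_mul_comm (D k), ← pow_succ', ← pow_succ',
        ((hS (k + 1)).pow_pow (m - 1 - j + 1) (j + 1)).mul_mul_mul_comm]
    have h5 : ‖D (k + 1) * S‖ ≤ K * b ^ k :=
      (hDS (k + 1)).trans (by gcongr 1; exact pow_le_pow_of_le_one hb0.le hb1.le (by lia))
    rw [h4]
    calc _ ≤ ‖D k * S‖ ^ (j + 1) * ‖D (k + 1) * S‖ ^ (m - 1 - j + 1) :=
          (norm_mul_le _ _).trans (mul_le_mul (norm_pow_le' _ (by lia)) (norm_pow_le' _ (by lia))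
            (norm_nonneg _) (by positivity))
      _ ≤ (K * b ^ k) ^ (j + 1) * (K * b ^ k) ^ (m - 1 - j + 1) := by
          gcongr
          exact hDS k
      _ = _ := by rw [← pow_add, ← hmj, mul_pow, ← pow_mul, ← pow_mul, mul_comm k]
  have hstep : ∀ k, dist (E k * S ^ (m + 1)) (E (k + 1) * S ^ (m + 1))
      ≤ (m * K ^ (m + 1) * κ₀) * (2 * b ^ (m + 1)) ^ k := fun k => by
    rw [dist_comm, dist_eq_norm, ← sub_mul, hdiff, smul_mul_assoc, Finset.mul_sum, Finset.sum_mul,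
      norm_smul, Complex.norm_real, Real.norm_of_nonneg (hκ k).le]
    have h6 := norm_sum_le_of_le _ (hterm k)
    rw [Finset.sum_const, Finset.card_range, nsmul_eq_mul] at h6
    calc _ ≤ 2 ^ k * κ₀ * (m * (K ^ (m + 1) * (b ^ (m + 1)) ^ k)) := by gcongr
      _ = _ := by rw [mul_pow]; ring
  obtain ⟨B, hB⟩ := cauchySeq_tendsto_of_complete (cauchySeq_of_le_geometric _ _ hbm hstep)
  refine ⟨B, ?_, ?_⟩
  · have hzero : Tendsto (fun k => D k ^ m * S ^ (m + 1)) atTop (𝓝 0) := by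
      have h7 : Tendsto (fun k => C ^ (m - 1) * (K * b ^ k) * ‖S ^ m‖) atTop (𝓝 0) := by
        simpa using (((tendsto_pow_atTop_nhds_zero_of_lt_one hb0.le hb1).const_mul K).const_mul
          (C ^ (m - 1))).mul_const ‖S ^ m‖
      refine squeeze_zero_norm (fun k => ?_) h7
      have h8 : D k ^ m * S ^ (m + 1) = D k ^ (m - 1) * (D k * S) * S ^ m := by
        rw [pow_succ' S, ← pow_sub_mul_pow (D k) hm, pow_one]
        simp only [mul_assoc]
      rw [h8]
      refine (norm_mul_le _ _).trans (mul_le_mul_of_nonneg_right ?_ (norm_nonneg _))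
      exact (norm_mul_le _ _).trans (mul_le_mul (hpow k _) (hDS k) (norm_nonneg _) (by positivity))
    have h9 : Tendsto (fun k => R * (E k * S ^ (m + 1))) atTop (𝓝 (S ^ (m + 1))) := by
      have : (fun k => R * (E k * S ^ (m + 1))) = fun k => S ^ (m + 1) - D k ^ m * S ^ (m + 1) := by
        ext1 k
        rw [← mul_assoc, hRE, sub_mul, one_mul]
      rw [this]
      simpa using hzero.const_sub (S ^ (m + 1))
    exact tendsto_nhds_unique (hB.const_mul R) h9
  · have h10 := dist_le_of_le_geometric_of_tendsto₀ _ _ hbm hstep hB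
    have h11 : ‖E 0 * S ^ (m + 1)‖ ≤ m * C ^ m * M * κ₀ := by
      have h12 : ‖D 0 * ∑ j ∈ Finset.range m, D 0 ^ j‖ ≤ m * C ^ m := by
        rw [Finset.mul_sum]
        have h13 : ∀ j ∈ Finset.range m, ‖D 0 * D 0 ^ j‖ ≤ C ^ m := fun j hj => by
          rw [← pow_succ']
          exact (hpow 0 _).trans (pow_le_pow_right₀ hC1 (Finset.mem_range.1 hj))
        simpa using norm_sum_le_of_le _ h13
      refine (norm_mul_le _ _).trans ?_
      simp only [hE, norm_smul, Complex.norm_real, pow_zero, one_mul, Real.norm_of_nonneg hκ₀.le]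
      calc _ ≤ κ₀ * (m * C ^ m) * M := by gcongr
        _ = _ := by ring
    rw [dist_comm, dist_eq_norm] at h10
    calc ‖B‖ = ‖(B - E 0 * S ^ (m + 1)) + E 0 * S ^ (m + 1)‖ := by rw [sub_add_cancel]
      _ ≤ m * K ^ (m + 1) * κ₀ / (1 - 2 * b ^ (m + 1)) + m * C ^ m * M * κ₀ :=
          (norm_add_le _ _).trans (add_le_add h10 h11)
      _ = _ := by ring

lemma ResolventDecay.norm_mul_semigroup_le [CompleteSpace H] {T : ℝ → H →L[ℂ] H}
    {A : H →ₗ.[ℂ] H} (hT : IsC0Semigroup T) (hgen : IsGenerator T A) {ω β c C : ℝ}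
    {R : H →L[ℂ] H} (hR : IsResolventAt A (ω : ℂ) R) (hdec : ResolventDecay R ω β c)
    (hω : 0 < ω) (hβ0 : 0 < β) (hβ1 : β ≤ 1) (hc : 0 < c) {M : ℝ} (hM1 : 1 ≤ M)
    (hM : ∀ t, 0 ≤ t → t ≤ 1 → ‖T t‖ ≤ M) {κ : ℝ} (hκ : 1 ≤ κ) {D : H →L[ℂ] H}
    (h1 : (1 + (κ : ℂ) • R) * D = 1) (h2 : D * (1 + (κ : ℂ) • R) = 1) (hD : ‖D‖ ≤ C) :
    (∀ t, 0 ≤ t → Commute D (T t)) ∧ ∀ t, 0 < t → t ≤ 1 →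
      ‖D * T t‖ ≤ 16 * M ^ 2 * ((1 + C) * (1 + c)) * κ ^ (-β) / t := by
  have hC : 0 ≤ C := (norm_nonneg _).trans hD
  have hcomm : ∀ t, 0 ≤ t → Commute D (T t) := fun t ht =>
    (commute_of_commute_of_inverse ((Commute.one_right _).add_right
      ((hR.commute_semigroup hT hgen ht).smul_right _)) h1 h2).symm
  refine ⟨hcomm, fun t ht ht1 => ?_⟩
  have h := hR.norm_mul_semigroup_le hT hgen hM1 hM hcomm
    (K := (1 + C) * (1 + c) * κ ^ (-β)) (by positivity)
    (fun s hs z => hdec.norm_mul_apply_le hω hβ0 hβ1 hc hκ h2 hD hs z) ht ht1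
  exact h.trans_eq (by ring)

lemma IsResolventAt.injective {A : H →ₗ.[ℂ] H} {lam : ℂ} {R : H →L[ℂ] H}
    (hR : IsResolventAt A lam R) : Function.Injective R := by
  refine (injective_iff_map_eq_zero R).2 fun x hx => ?_
  obtain ⟨hmem, h⟩ := hR.1 x
  have h0 : (⟨R x, hmem⟩ : A.domain) = 0 := Subtype.ext hx
  rw [h0, hx, A.map_zero, smul_zero, add_zero] at h
  exact h.symm

lemma ResolventDecay.inCrandallPazy [CompleteSpace H] {T : ℝ → H →L[ℂ] H}
    {A : H →ₗ.[ℂ] H} (hT : IsC0Semigroup T) (hgen : IsGenerator T A) {ω β c C : ℝ}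
    {R : H →L[ℂ] H} (hR : IsResolventAt A (ω : ℂ) R) (hdec : ResolventDecay R ω β c)
    (hω : 0 < ω) (hβ0 : 0 < β) (hβ1 : β ≤ 1) (hc : 0 < c)
    (hC : ∀ n, ‖(1 - ((2 * ω : ℝ) : ℂ) • R) ^ n‖ ≤ C) : InCrandallPazy T A β := by
  obtain ⟨M, hM1, hM⟩ := hT.exists_bound
  have hM0 : 0 < M := by linarith
  wlog hC1 : 1 ≤ C generalizing C
  · exact this (fun n => (hC n).trans (le_max_left C 1)) (le_max_right C 1)
  choose! D h1 h2 hD using fun κ (hκ : 0 < κ) => exists_inverse_one_add_smul hω hC hκ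
  obtain ⟨m, hm⟩ := exists_nat_gt (1 / β)
  have hm0 : 1 ≤ m := by
    have : (0 : ℝ) < m := (one_div_pos.2 hβ0).trans hm
    exact_mod_cast this
  set b : ℝ := 2 ^ (-β) with hb
  have hb0 : 0 < b := by positivity
  have hb1 : b < 1 := Real.rpow_lt_one_of_one_lt_of_neg one_lt_two (by linarith)
  have hbm : 2 * b ^ (m + 1) < 1 := by
    have h3 : 2 * b ^ (m + 1) = (2 : ℝ) ^ (1 - β * (m + 1)) := by
      rw [hb, ← Real.rpow_natCast, ← Real.rpow_mul zero_le_two, sub_eq_add_neg,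
        Real.rpow_add zero_lt_two, Real.rpow_one]
      push_cast
      ring_nf
    rw [h3]
    refine Real.rpow_lt_one_of_one_lt_of_neg one_lt_two ?_
    rw [div_lt_iff₀ hβ0] at hm
    linarith
  set K : ℝ := 16 * M ^ 2 * ((1 + C) * (1 + c)) * (m + 1) with hK
  set L : ℝ := m * C ^ m * M + m * K ^ (m + 1) / (1 - 2 * b ^ (m + 1)) with hL
  have hL0 : 0 < L := by
    have : 0 < 1 - 2 * b ^ (m + 1) := by linarith
    positivity
  have hfactor : ∀ t, 0 < t → t ≤ 1 →
      ∃ B : H →L[ℂ] H, R * B = T t ∧ ‖B‖ ≤ L * t ^ (-(1 / β)) := fun t ht ht1 => by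
    set κ₀ : ℝ := t ^ (-(1 / β)) with hκ₀
    have hκ₀1 : 1 ≤ κ₀ :=
      Real.one_le_rpow_of_pos_of_le_one_of_nonpos ht ht1 (neg_nonpos.2 (by positivity))
    have hκ₀0 : 0 < κ₀ := by linarith
    have hκ1 : ∀ k : ℕ, 1 ≤ 2 ^ k * κ₀ := fun k =>
      one_le_mul_of_one_le_of_one_le (one_le_pow₀ one_le_two) hκ₀1
    have hκ : ∀ k : ℕ, 0 < 2 ^ k * κ₀ := fun k => by positivity
    have hκβ : ∀ k : ℕ, (2 ^ k * κ₀) ^ (-β) = b ^ k * t := fun k => by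
      rw [Real.mul_rpow (by positivity) hκ₀0.le, hκ₀, ← Real.rpow_mul ht.le, hb,
        ← Real.rpow_natCast, ← Real.rpow_natCast, ← Real.rpow_mul zero_le_two,
        ← Real.rpow_mul zero_le_two, neg_mul_neg, one_div_mul_cancel hβ0.ne', Real.rpow_one,
        mul_comm (k : ℝ)]
    set u : ℝ := t / (m + 1) with hu
    have hu0 : 0 < u := by positivity
    have hu1 : u ≤ 1 := by
      rw [hu, div_le_one (by positivity)]
      have : (0 : ℝ) ≤ m := m.cast_nonneg
      linarith
    have hTu : T u ^ (m + 1) = T t := by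
      rw [hT.pow_eq hu0.le]
      congr 1
      rw [hu]
      push_cast
      field_simp
    have hsmall := fun k : ℕ => hdec.norm_mul_semigroup_le hT hgen hR hω hβ0 hβ1 hc hM1 hM (hκ1 k)
      (h1 _ (hκ k)) (h2 _ (hκ k)) (hD _ (hκ k))
    rw [← hTu]
    refine exists_mul_eq_pow_of_geometric hR.injective hκ₀0 (fun k => h1 _ (hκ k))
      (fun k => h2 _ (hκ k)) hC1 (fun k => hD _ (hκ k)) (fun k => (hsmall k).1 u hu0.le)
      (by positivity) hb0 hb1 (fun k => ?_) hm0 hbm ?_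
    · refine ((hsmall k).2 u hu0 hu1).trans_eq ?_
      rw [hκβ, hu, hK]
      field_simp
    · rw [hTu]
      exact hM t ht.le ht1
  choose! B hRB hBn using hfactor
  have hdom : ∀ t, 0 < t → t ≤ 1 → ∀ x,
      ∃ hx : T t x ∈ A.domain, (B t - (ω : ℂ) • T t) x = A ⟨T t x, hx⟩ := fun t ht ht1 x => by
    have hx : R (B t x) = T t x := DFunLike.congr_fun (hRB t ht ht1) x
    obtain ⟨hmem, h⟩ := hR.1 (B t x)
    simp only [hx] at hmem h
    exact ⟨hmem, (eq_sub_of_add_eq' h).symm⟩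
  refine ⟨fun t => if t ≤ 1 then B t - (ω : ℂ) • T t else (B 1 - (ω : ℂ) • T 1) * T (t - 1),
    fun t ht x => ?_, L + ω * M, 1, by positivity, one_pos, fun t ht ht1 => ?_⟩
  · by_cases ht1 : t ≤ 1
    · simp only [if_pos ht1]
      exact hdom t ht ht1 x
    · simp only [if_neg ht1]
      push Not at ht1
      have hx : T t x = T 1 (T (t - 1) x) := by
        rw [← hT.apply_add zero_le_one (by linarith), add_sub_cancel]
      obtain ⟨hmem, h⟩ := hdom 1 one_pos le_rfl (T (t - 1) x)
      simp only [hx]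
      exact ⟨hmem, h⟩
  · simp only [if_pos ht1]
    have h4 : 1 ≤ t ^ (-(1 / β)) :=
      Real.one_le_rpow_of_pos_of_le_one_of_nonpos ht ht1 (neg_nonpos.2 (by positivity))
    calc _ ≤ L * t ^ (-(1 / β)) + ω * M := by
          refine (norm_sub_le _ _).trans (add_le_add (hBn t ht ht1) ?_)
          rw [norm_smul, Complex.norm_real, Real.norm_of_nonneg hω.le]
          gcongr
          exact hM t ht.le ht1
      _ ≤ L * t ^ (-(1 / β)) + ω * M * t ^ (-(1 / β)) := by
          exact add_le_add_right (le_mul_of_one_le_right (by positivity) h4) _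
      _ = _ := by ring

open Asymptotics in
/-- Theorem 4.7: let `-A` generate a `C₀`-semigroup on a Hilbert space with
`σ(A) ∩ iℝ = ∅`, let `ω ∈ ρ(-A) ∩ (0,∞)` (with resolvent `Rω = (ω + A)⁻¹`), and assume
`sup_{n} ‖V_ω(A)ⁿ‖ < ∞`, where `V_ω(A) = (A - ω)(A + ω)⁻¹ = 1 - 2ω (ω + A)⁻¹`.  Then for
fixed `β ∈ (0,1]` the following are equivalent:
(i) the semigroup is in the Crandall–Pazy class with parameter `β`;
(ii) `‖V_ω(A)ⁿ (ω + A)⁻¹‖ = O(n^{-1/(2-β)})` as `n → ∞`. -/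
theorem crandallPazy_iff_cayley_decay
    {H : Type*} [NormedAddCommGroup H] [InnerProductSpace ℂ H] [CompleteSpace H]
    (T : ℝ → H →L[ℂ] H) (A : H →ₗ.[ℂ] H)
    (hT : IsC0Semigroup T) (hgen : IsGenerator T A)
    (hspec : ∀ η : ℝ, ∃ R : H →L[ℂ] H, IsResolventAt A (Complex.I * η) R)
    (ω : ℝ) (hω : 0 < ω) (Rω : H →L[ℂ] H) (hRω : IsResolventAt A ((ω : ℝ) : ℂ) Rω)
    (hpow : ∃ C : ℝ, ∀ n : ℕ,
      ‖((1 : H →L[ℂ] H) - ((2 * ω : ℝ) : ℂ) • Rω) ^ n‖ ≤ C)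
    (β : ℝ) (hβ0 : 0 < β) (hβ1 : β ≤ 1) :
    InCrandallPazy T A β ↔
      (fun n : ℕ => ‖((1 : H →L[ℂ] H) - ((2 * ω : ℝ) : ℂ) • Rω) ^ n * Rω‖) =O[atTop]
        fun n : ℕ => (n : ℝ) ^ (-(1 / (2 - β))) := by
  obtain ⟨C, hC⟩ := hpow
  constructor
  · intro hCP
    obtain ⟨c, hc, hdec⟩ := hCP.exists_resolventDecay hT hgen hspec hω hRω hβ0 hβ1
    refine IsBigO.of_bound
      (6 * C ^ 2 * ((1 + C) * (1 + c) / (2 * ω)) + C * (1 + C))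
      (eventually_atTop.2 ⟨2, fun n hn => ?_⟩)
    rw [norm_norm, Real.norm_of_nonneg (by positivity)]
    exact hdec.norm_cayley_pow_mul_le hω hβ0 hβ1 hc hC hn
  · intro hO
    obtain ⟨c₀, hc₀, hbound⟩ := hO.exists_pos
    obtain ⟨n₀, hn₀⟩ := eventually_atTop.1 hbound.bound
    obtain ⟨c, hc, hdec⟩ := exists_resolventDecay_of_cayley hω hβ1 hC hc₀ n₀ fun n hn => by
      have h := hn₀ n hn
      rwa [norm_norm, Real.norm_of_nonneg (by positivity)] at h
    exact hdec.inCrandallPazy hT hgen hRω hω hβ0 hβ1 hc hC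

end
end
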